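/- arXiv:math/0609262 — 2 statements merged into one kernel-verified Lean document; each statement's English description precedes it below -/
import Mathlib

section
/- The following 20 words in two noncommuting indeterminates x, y form a test set for M₄(ℂ): x; x², xy; x³, x²y; x⁴, x³y, x²y², xyxy; x³y²; (x²y)², x²y²xy, y²x²yx; x³y²xy; x³y²x²y, x³y³xy, y³x³yx; x³yx²yxy, x²y²xyx²y; x³y³x²y². That is, two matrices a, b ∈ M₄(ℂ) are unitarily similar (there exists a unitary u with b = u a u*) if and only if tr(w(a, a*)) = tr(w(b, b*)) for each of these 20 words w, where a* denotes the conjugate transpose. -/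
open Matrix

noncomputable section

/-- The traces `tr(w(a, a*))` of the 20 words
`x; x², xy; x³, x²y; x⁴, x³y, x²y², xyxy; x³y²; (x²y)², x²y²xy, y²x²yx; x³y²xy;
x³y²x²y, x³y³xy, y³x³yx; x³yx²yxy, x²y²xyx²y; x³y³x²y²`
evaluated at `x = a`, `y = a*` (the conjugate transpose). -/
def wordTraces (a : Matrix (Fin 4) (Fin 4) ℂ) : Fin 20 → ℂ :=
  let x := a
  let y := aᴴ
  ![(x).trace,
    (x ^ 2).trace, (x * y).trace,
    (x ^ 3).trace, (x ^ 2 * y).trace,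
    (x ^ 4).trace, (x ^ 3 * y).trace, (x ^ 2 * y ^ 2).trace, (x * y * x * y).trace,
    (x ^ 3 * y ^ 2).trace,
    ((x ^ 2 * y) ^ 2).trace, (x ^ 2 * y ^ 2 * x * y).trace, (y ^ 2 * x ^ 2 * y * x).trace,
    (x ^ 3 * y ^ 2 * x * y).trace,
    (x ^ 3 * y ^ 2 * x ^ 2 * y).trace, (x ^ 3 * y ^ 3 * x * y).trace,
    (y ^ 3 * x ^ 3 * y * x).trace,
    (x ^ 3 * y * x ^ 2 * y * x * y).trace, (x ^ 2 * y ^ 2 * x * y * x ^ 2 * y).trace,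
    (x ^ 3 * y ^ 3 * x ^ 2 * y ^ 2).trace]

/-! ### Words and rows -/
namespace TS

def decF : ℕ → ℕ → List Bool
  | 0, _ => []
  | _ + 1, 0 => []
  | f + 1, n + 1 => Nat.beq (n % 2) 1 :: decF f (n / 2)

def dec (n : ℕ) : List Bool := decF n n

def cc (l : Bool) (c : ℕ) : ℕ := cond l (2 * c + 2) (2 * c + 1)

abbrev Row := List (ℕ × ℕ)
abbrev Rules := List (ℕ × Row)

def ins (c v : ℕ) : Row → Row
  | [] => [(c, v)]
  | (d, u) :: t =>
    cond (Nat.beq c d)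
      (match (u + v) % 5 with
        | 0 => t
        | s + 1 => (d, s + 1) :: t)
      (cond (Nat.ble c d) ((d, u) :: ins c v t) ((c, v) :: (d, u) :: t))

def addmul (k : ℕ) : Row → Row → Row
  | [], s => s
  | (c, v) :: r, s => ins c (k * v % 5) (addmul k r s)

def look (c : ℕ) : Rules → Row
  | [] => [(c, 1)]
  | (l, t) :: R => cond (Nat.beq c l) t (look c R)

def red (R : Rules) : Row → Row
  | [] => []
  | (c, v) :: r => addmul v (look c R) (red R r)

def consRow (l : Bool) : Row → Row
  | [] => []
  | (c, v) :: r => (cc l c, v) :: consRow l r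

def nf : List Bool → List Rules → Row
  | [], _ => [(0, 1)]
  | l :: w, [] => consRow l (nf w [])
  | l :: w, R :: Rs => red R (consRow l (nf w Rs))

def nfrow (Rs : List Rules) : List (List Bool × ℕ) → Row
  | [] => []
  | (w, c) :: r => addmul c (nf w Rs) (nfrow Rs r)

def redAll (R : Rules) : Rules → Rules
  | [] => []
  | (l, t) :: Q => (l, red R t) :: redAll R Q

def elim (rows : List Row) (R : Rules) : Rules :=
  match rows with
  | [] => R
  | r :: rs =>
    match red R r with
    | [] => elim rs R
    | (l, c) :: t =>
      cond (Nat.beq (c * (c * c * c) % 5) 1)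
        (elim rs ((l, addmul (4 * (c * c * c)) t []) ::
          redAll [(l, addmul (4 * (c * c * c)) t [])] R))
        R

def P4 {α : Type} (m : α → α → α) (a b c d : α) : List α :=
  [m (m (m a b) c) d, m (m (m a b) d) c, m (m (m a c) b) d, m (m (m a c) d) b,
   m (m (m a d) b) c, m (m (m a d) c) b,
   m (m (m b a) c) d, m (m (m b a) d) c, m (m (m b c) a) d, m (m (m b c) d) a,
   m (m (m b d) a) c, m (m (m b d) c) a,
   m (m (m c a) b) d, m (m (m c a) d) b, m (m (m c b) a) d, m (m (m c b) d) a,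
   m (m (m c d) a) b, m (m (m c d) b) a,
   m (m (m d a) b) c, m (m (m d a) c) b, m (m (m d b) a) c, m (m (m d b) c) a,
   m (m (m d c) a) b, m (m (m d c) b) a]

/-! ### Relations -/

def ruleRow (l' : Bool) (r : ℕ × Row) : List (List Bool × ℕ) :=
  (dec r.1 ++ [l'], 1) :: r.2.map (fun e => (dec e.1 ++ [l'], 4 * e.2))

def genRow (g : Bool × Bool × Bool × List Bool) : List (List Bool × ℕ) :=
  (P4 (· ++ ·) [g.1] [g.2.1] [g.2.2.1] g.2.2.2).map (fun w => (w, 1))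

def srcRows (prev : Rules) (gens : List (Bool × Bool × Bool × List Bool)) : List (List (List Bool × ℕ)) :=
  prev.map (ruleRow false) ++ (prev.map (ruleRow true) ++ gens.map genRow)

def step (Rs : List Rules) (prev : Rules) (gens : List (Bool × Bool × Bool × List Bool)) : Rules :=
  elim ((srcRows prev gens).map (nfrow ([] :: Rs))) []

def nextS (R : Rules) (S : List ℕ) : List ℕ :=
  (S.flatMap (fun b => [cc false b, cc true b])).filter
    (fun c => !(R.any (fun r => Nat.beq c r.1)))

def cycRow (b : ℕ) (l m : Bool) : List (List Bool × ℕ) :=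
  [(l :: (dec b ++ [m]), 1), (dec b ++ [m, l], 4)]

def cycRows (S : List ℕ) : List (List (List Bool × ℕ)) :=
  S.flatMap (fun b => [cycRow b false false, cycRow b false true, cycRow b true false,
    cycRow b true true])

def cycElim (Rs : List Rules) (S : List ℕ) (known : List (List Bool)) : Rules :=
  elim ((cycRows S ++ known.map (fun w => [(w, 1)])).map (nfrow ([] :: Rs))) []

def cycCheck (Rs : List Rules) (S S' : List ℕ) (known : List (List Bool)) : Bool :=
  let E := cycElim Rs S known
  S'.all (fun b => (look (cc false b) E).isEmpty && (look (cc true b) E).isEmpty)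

end TS
namespace TS

set_option linter.unusedSectionVars false

theorem decF_eq (f : ℕ) : ∀ g n : ℕ, n ≤ f → n ≤ g → decF f n = decF g n := by
  induction f with
  | zero =>
    intro g n hf hg
    obtain rfl : n = 0 := by omega
    cases g <;> simp [decF]
  | succ f ih =>
    intro g n hf hg
    cases n with
    | zero => cases g <;> simp [decF]
    | succ n =>
      cases g with
      | zero => omega
      | succ g =>
        simp only [decF]
        rw [ih g (n / 2) (by omega) (by omega)]

theorem dec_cc (l : Bool) (c : ℕ) : dec (cc l c) = l :: dec c := by
  cases l
  · have h : (2 * c) % 2 = 0 := by omega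
    have h2 : (2 * c) / 2 = c := by omega
    simp only [dec, cc, cond_false, decF, h, h2]
    rw [decF_eq (2 * c) c c (by omega) le_rfl]
    rfl
  · have h : (2 * c + 1) % 2 = 1 := by omega
    have h2 : (2 * c + 1) / 2 = c := by omega
    simp only [dec, cc, cond_true, decF, h, h2]
    rw [decF_eq (2 * c + 1) c c (by omega) le_rfl]
    rfl

section sound

variable {M : Type*} [AddCommGroup M]

def ev (φ : ℕ → M) : Row → M
  | [] => 0
  | (c, v) :: r => v • φ c + ev φ r

theorem mod_smul {m : M} (h : 5 • m = 0) (v : ℕ) : (v % 5) • m = v • m := by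
  conv_rhs => rw [← Nat.mod_add_div v 5, add_smul, mul_comm, mul_smul, h, smul_zero, add_zero]

theorem ev_ins (φ : ℕ → M) (h5 : ∀ c, 5 • φ c = 0) (c v : ℕ) (r : Row) :
    ev φ (ins c v r) = v • φ c + ev φ r := by
  induction r with
  | nil => simp [ins, ev]
  | cons e t ih =>
    obtain ⟨d, u⟩ := e
    simp only [ins]
    cases h : Nat.beq c d with
    | true =>
      obtain rfl : c = d := Nat.eq_of_beq_eq_true h
      have h6 : ((u + v) % 5) • φ c = (u + v) • φ c := mod_smul (h5 c) _
      simp only [cond_true]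
      rw [add_smul] at h6
      split
      · rename_i h0
        rw [h0, zero_smul] at h6
        simp only [ev]
        rw [← add_assoc, add_comm (v • φ c), ← h6, zero_add]
      · rename_i s h0
        rw [h0] at h6
        simp only [ev]
        rw [h6]; abel
    | false =>
      simp only [cond_false]
      cases Nat.ble c d with
      | true => simp only [cond_true, ev, ih]; abel
      | false => simp only [cond_false, ev]

theorem ev_addmul (φ : ℕ → M) (h5 : ∀ c, 5 • φ c = 0) (k : ℕ) (r s : Row) :
    ev φ (addmul k r s) = k • ev φ r + ev φ s := by
  induction r with
  | nil => simp [addmul, ev]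
  | cons e t ih =>
    obtain ⟨d, u⟩ := e
    simp only [addmul, ev, ev_ins φ h5, ih, mod_smul (h5 d), smul_add, mul_smul]
    abel

def Ok (φ : ℕ → M) (R : Rules) : Prop := ∀ r ∈ R, φ r.1 = ev φ r.2

theorem ev_look (φ : ℕ → M) (R : Rules) (hR : Ok φ R) (c : ℕ) :
    ev φ (look c R) = φ c := by
  induction R with
  | nil => simp [look, ev]
  | cons e R ih =>
    obtain ⟨l, t⟩ := e
    simp only [look]
    cases h : Nat.beq c l with
    | true =>
      obtain rfl : c = l := Nat.eq_of_beq_eq_true h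
      exact (hR (c, t) (by simp)).symm
    | false =>
      exact ih (fun r hr => hR r (by simp [hr]))

theorem ev_red (φ : ℕ → M) (h5 : ∀ c, 5 • φ c = 0) (R : Rules) (hR : Ok φ R) (r : Row) :
    ev φ (red R r) = ev φ r := by
  induction r with
  | nil => simp [red]
  | cons e t ih =>
    obtain ⟨d, u⟩ := e
    simp only [red, ev, ev_addmul φ h5, ih, ev_look φ R hR]

theorem ev_consRow (φ : ℕ → M) (l : Bool) (r : Row) :
    ev φ (consRow l r) = ev (fun c => φ (cc l c)) r := by
  induction r with
  | nil => simp [consRow, ev]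
  | cons e t ih =>
    obtain ⟨d, u⟩ := e
    simp only [consRow, ev, ih]

theorem ok_redAll (φ : ℕ → M) (h5 : ∀ c, 5 • φ c = 0) (R : Rules) (hR : Ok φ R) (Q : Rules)
    (hQ : Ok φ Q) : Ok φ (redAll R Q) := by
  induction Q with
  | nil => simpa [redAll] using hQ
  | cons e Q ih =>
    obtain ⟨l, t⟩ := e
    intro r hr
    simp only [redAll, List.mem_cons] at hr
    rcases hr with rfl | hr
    · simp only [ev_red φ h5 R hR]
      exact hQ (l, t) (by simp)
    · exact ih (fun r hr => hQ r (by simp [hr])) r hr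

theorem ok_elim (φ : ℕ → M) (h5 : ∀ c, 5 • φ c = 0) (rows : List Row) :
    ∀ R : Rules, Ok φ R → (∀ r ∈ rows, ev φ r = 0) → Ok φ (elim rows R) := by
  induction rows with
  | nil => intro R hR _; simpa [elim] using hR
  | cons r rs ih =>
    intro R hR h0
    have hr := h0 r (by simp)
    have hrs : ∀ r ∈ rs, ev φ r = 0 := fun r hr => h0 r (by simp [hr])
    rw [← ev_red φ h5 R hR] at hr
    unfold elim
    split
    · exact ih R hR hrs
    · rename_i l c t heq
      rw [heq] at hr
      cases hc : Nat.beq (c * (c * c * c) % 5) 1 with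
      | false => simpa using hR
      | true =>
        have hc' : c * (c * c * c) % 5 = 1 := Nat.eq_of_beq_eq_true hc
        simp only [cond_true]
        have hnew : Ok φ [(l, addmul (4 * (c * c * c)) t [])] := by
          intro q hq
          simp only [List.mem_singleton] at hq
          subst hq
          simp only [ev_addmul φ h5, ev, add_zero]
          simp only [ev] at hr
          have e1 : ev φ t = - (c • φ l) := by
            rw [eq_neg_iff_add_eq_zero, add_comm]; exact hr
          have e2 : (c * (c * c * c)) • φ l = φ l := by
            rw [← mod_smul (h5 l), hc', one_smul]
          have e3 : (c * c * c) • c • φ l = φ l := by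
            rw [← mul_smul, mul_comm]; exact e2
          rw [e1, smul_neg, mul_smul, e3]
          have := h5 l
          rw [show 5 = 4 + 1 from rfl, add_smul, one_smul] at this
          rw [eq_neg_iff_add_eq_zero, add_comm]; exact this
        refine ih _ ?_ hrs
        intro q hq
        rcases List.mem_cons.1 hq with rfl | hq
        · exact hnew _ (by simp)
        · exact ok_redAll φ h5 _ hnew R hR q hq

/-! Now the functional `D`. -/

variable (D : List Bool → M)

def phi (z : List Bool) (c : ℕ) : M := D (dec c ++ z)

theorem phi5 (h5 : ∀ w, 5 • D w = 0) (z : List Bool) : ∀ c, 5 • phi D z c = 0 := fun _ => h5 _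

def Valid (R : Rules) : Prop := ∀ z, z ≠ [] → Ok (phi D z) R

theorem phi_cc (hc : ∀ u v, D (u ++ v) = D (v ++ u)) (z : List Bool) (l : Bool) :
    (fun c => phi D z (cc l c)) = phi D (z ++ [l]) := by
  funext c
  simp only [phi, dec_cc]
  have := hc [l] (dec c ++ z)
  simpa using this

theorem ev_nf (h5 : ∀ w, 5 • D w = 0) (hc : ∀ u v, D (u ++ v) = D (v ++ u))
    (w : List Bool) : ∀ (Rs : List Rules), (∀ R ∈ Rs, Valid D R) → ∀ z, z ≠ [] →
      ev (phi D z) (nf w Rs) = D (w ++ z) := by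
  induction w with
  | nil => intro Rs _ z _; simp [nf, ev, phi, dec, decF]
  | cons l w ih =>
    intro Rs hRs z hz
    have key : ∀ Rs : List Rules, (∀ R ∈ Rs, Valid D R) →
        ev (phi D z) (consRow l (nf w Rs)) = D (l :: w ++ z) := by
      intro Rs hRs
      rw [ev_consRow, phi_cc D hc, ih Rs hRs (z ++ [l]) (by simp)]
      have := hc [l] (w ++ z)
      simpa using this.symm
    cases Rs with
    | nil => simp only [nf]; exact key [] (by simp)
    | cons R Rs =>
      simp only [nf]
      rw [ev_red _ (phi5 D h5 _) R (hRs R (by simp) z hz)]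
      exact key Rs (fun R hR => hRs R (by simp [hR]))

theorem ev_nf_top (h5 : ∀ w, 5 • D w = 0) (hc : ∀ u v, D (u ++ v) = D (v ++ u))
    (w : List Bool) (hw : w ≠ []) (Rs : List Rules) (hRs : ∀ R ∈ Rs, Valid D R) (z : List Bool) :
      ev (phi D z) (nf w ([] :: Rs)) = D (w ++ z) := by
  cases w with
  | nil => exact absurd rfl hw
  | cons l w =>
    simp only [nf]
    rw [ev_red _ (phi5 D h5 _) [] (by intro r hr; simp at hr), ev_consRow, phi_cc D hc,
      ev_nf D h5 hc w Rs hRs (z ++ [l]) (by simp)]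
    have := hc [l] (w ++ z)
    simpa using this.symm

def rawEv (z : List Bool) (r : List (List Bool × ℕ)) : M :=
  (r.map (fun e => e.2 • D (e.1 ++ z))).sum

theorem ev_nfrow (h5 : ∀ w, 5 • D w = 0) (hc : ∀ u v, D (u ++ v) = D (v ++ u))
    (Rs : List Rules) (hRs : ∀ R ∈ Rs, Valid D R) (z : List Bool)
    (r : List (List Bool × ℕ)) (hr : ∀ e ∈ r, e.1 ≠ []) :
      ev (phi D z) (nfrow ([] :: Rs) r) = rawEv D z r := by
  induction r with
  | nil => simp [nfrow, ev, rawEv]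
  | cons e r ih =>
    obtain ⟨w, c⟩ := e
    simp only [nfrow]
    rw [ev_addmul _ (phi5 D h5 _), ih (fun e he => hr e (by simp [he])),
      ev_nf_top D h5 hc w (hr (w, c) (by simp)) Rs hRs z]
    simp [rawEv]

theorem raw_rule (z : List Bool) (l : Bool) (t : Row) :
    rawEv D z (t.map (fun e => (dec e.1 ++ [l], 4 * e.2))) = 4 • ev (phi D (l :: z)) t := by
  induction t with
  | nil => simp [rawEv, ev]
  | cons e t ih =>
    obtain ⟨c, v⟩ := e
    simp only [rawEv, List.map_cons, List.sum_cons, ev, smul_add, mul_smul] at ih ⊢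
    rw [ih]
    simp [phi]

theorem raw_ruleRow (h5 : ∀ w, 5 • D w = 0) (R : Rules) (hR : Valid D R) (r : ℕ × Row)
    (hr : r ∈ R) (l : Bool) (z : List Bool) : rawEv D z (ruleRow l r) = 0 := by
  have h1 : rawEv D z (ruleRow l r) = phi D (l :: z) r.1 + 4 • ev (phi D (l :: z)) r.2 := by
    rw [← raw_rule]
    simp [ruleRow, rawEv, phi]
  rw [h1, ← hR (l :: z) (by simp) r hr]
  have := h5 (dec r.1 ++ (l :: z))
  rw [show 5 = 1 + 4 from rfl, add_smul, one_smul] at this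
  exact this

def Pol : Prop := ∀ w1 w2 w3 w4 z : List Bool, w1 ≠ [] → w2 ≠ [] → w3 ≠ [] → w4 ≠ [] → z ≠ [] →
  ((P4 (· ++ ·) w1 w2 w3 w4).map (fun w => D (w ++ z))).sum = 0

theorem valid_step (h5 : ∀ w, 5 • D w = 0) (hc : ∀ u v, D (u ++ v) = D (v ++ u))
    (hP : Pol D) (Rs : List Rules) (hRs : ∀ R ∈ Rs, Valid D R) (prev : Rules)
    (hprev : Valid D prev) (gens : List (Bool × Bool × Bool × List Bool))
    (hg : gens.all (fun g => !g.2.2.2.isEmpty) = true) :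
    Valid D (step Rs prev gens) := by
  intro z hz
  refine ok_elim _ (phi5 D h5 _) _ _ (by intro r hr; simp at hr) ?_
  intro r hr
  obtain ⟨q, hq, rfl⟩ := List.mem_map.1 hr
  simp only [srcRows, List.mem_append, List.mem_map] at hq
  rcases hq with ⟨r, hrp, rfl⟩ | ⟨r, hrp, rfl⟩ | ⟨g, hg', rfl⟩
  · rw [ev_nfrow D h5 hc Rs hRs z _ ?_, raw_ruleRow D h5 prev hprev r hrp]
    intro e he
    simp only [ruleRow, List.mem_cons, List.mem_map] at he
    rcases he with rfl | ⟨_, _, rfl⟩ <;> simp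
  · rw [ev_nfrow D h5 hc Rs hRs z _ ?_, raw_ruleRow D h5 prev hprev r hrp]
    intro e he
    simp only [ruleRow, List.mem_cons, List.mem_map] at he
    rcases he with rfl | ⟨_, _, rfl⟩ <;> simp
  · have hv : g.2.2.2 ≠ [] := by
      have := List.all_eq_true.1 hg g hg'
      simpa using this
    rw [ev_nfrow D h5 hc Rs hRs z _ ?_]
    · have := hP [g.1] [g.2.1] [g.2.2.1] g.2.2.2 z (by simp) (by simp) (by simp) hv hz
      rw [← this]
      simp [rawEv, genRow, P4]
    · intro e he
      simp only [genRow, List.mem_map] at he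
      obtain ⟨w, hw, rfl⟩ := he
      simp only [P4, List.mem_cons, List.not_mem_nil, or_false] at hw
      rcases hw with h | h | h | h | h | h | h | h | h | h | h | h | h | h | h | h | h | h | h |
        h | h | h | h | h <;> simp [h]

/-- spanning -/
def Spans (n : ℕ) (S : List ℕ) : Prop := ∀ z, z ≠ [] → (∀ b ∈ S, D (dec b ++ z) = 0) →
  ∀ w : List Bool, w.length = n → D (w ++ z) = 0

def spanCheck (R : Rules) (S S' : List ℕ) : Bool :=
  S.all (fun b => (look (cc false b) R).all (fun e => S'.any (Nat.beq e.1)) &&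
    (look (cc true b) R).all (fun e => S'.any (Nat.beq e.1)))

theorem ev_zero (φ : ℕ → M) (S : List ℕ) (hS : ∀ b ∈ S, φ b = 0) (r : Row)
    (hr : r.all (fun e => S.any (Nat.beq e.1)) = true) : ev φ r = 0 := by
  induction r with
  | nil => rfl
  | cons e r ih =>
    obtain ⟨c, v⟩ := e
    simp only [List.all_cons, Bool.and_eq_true, List.any_eq_true] at hr
    obtain ⟨⟨b, hb, hb'⟩, h2⟩ := hr
    obtain rfl : c = b := Nat.eq_of_beq_eq_true hb'
    simp [ev, hS c hb, ih h2]

theorem spans_step (hc : ∀ u v, D (u ++ v) = D (v ++ u))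
    (R : Rules) (hR : Valid D R) (n : ℕ) (S S' : List ℕ) (hS : Spans D n S)
    (hk : spanCheck R S S' = true) : Spans D (n + 1) S' := by
  intro z hz h0 w hw
  cases w with
  | nil => simp at hw
  | cons l w =>
    have e1 : D (l :: w ++ z) = D (w ++ (z ++ [l])) := by
      have := hc [l] (w ++ z)
      simpa using this
    rw [e1]
    refine hS _ (by simp) ?_ w (by simpa using hw)
    intro b hb
    have e2 : D (dec b ++ (z ++ [l])) = phi D z (cc l b) :=
      (congrFun (phi_cc D hc z l) b).symm
    rw [e2, ← ev_look _ R (hR z hz)]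
    apply ev_zero _ S' h0
    have := List.all_eq_true.1 hk b hb
    simp only [Bool.and_eq_true] at this
    cases l
    · exact this.1
    · exact this.2

theorem spans_zero : Spans D 0 [0] := by
  intro z _ h w hw
  have := h 0 (by simp)
  rw [List.length_eq_zero_iff] at hw
  subst hw
  simpa [dec, decF] using this

theorem valid_nil : Valid D [] := by
  intro z _ r hr; simp at hr

theorem cyc_zero (h5 : ∀ w, 5 • D w = 0) (hc : ∀ u v, D (u ++ v) = D (v ++ u))
    (Rs : List Rules) (hRs : ∀ R ∈ Rs, Valid D R) (n : ℕ) (S S' : List ℕ)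
    (hS : Spans D n S') (known : List (List Bool)) (hk : ∀ w ∈ known, w ≠ [] ∧ D w = 0)
    (hcheck : cycCheck Rs S S' known = true) (w : List Bool) (hw : w.length = n + 1) :
    D w = 0 := by
  have hOk : Ok (phi D []) (cycElim Rs S known) := by
    refine ok_elim _ (phi5 D h5 _) _ _ (by intro r hr; simp at hr) ?_
    intro r hr
    obtain ⟨q, hq, rfl⟩ := List.mem_map.1 hr
    have hrow : ∀ b l m, ev (phi D []) (nfrow ([] :: Rs) (cycRow b l m)) = 0 := by
      intro b l m
      rw [ev_nfrow D h5 hc Rs hRs]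
      · have e1 : D (l :: (dec b ++ [m])) = D (dec b ++ [m, l]) := by
          have := hc [l] (dec b ++ [m])
          simpa using this
        have := h5 (dec b ++ [m, l])
        rw [show 5 = 1 + 4 from rfl, add_smul, one_smul] at this
        simpa [rawEv, cycRow, e1] using this
      · intro e he
        simp only [cycRow, List.mem_cons, List.not_mem_nil, or_false] at he
        rcases he with rfl | rfl <;> simp
    rw [List.mem_append] at hq
    rcases hq with hq | hq
    · simp only [cycRows, List.mem_flatMap, List.mem_cons, List.not_mem_nil, or_false] at hq
      obtain ⟨b, _, h | h | h | h⟩ := hq <;> rw [h] <;> exact hrow _ _ _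
    · obtain ⟨w, hw, rfl⟩ := List.mem_map.1 hq
      rw [ev_nfrow D h5 hc Rs hRs]
      · simp [rawEv, (hk w hw).2]
      · intro e he
        simp only [List.mem_singleton] at he
        subst he
        exact (hk w hw).1
  cases w with
  | nil => simp at hw
  | cons l w =>
    have e1 : D (l :: w) = D (w ++ [l]) := by
      have := hc [l] w
      simpa using this
    rw [e1]
    refine hS [l] (by simp) ?_ w (by simpa using hw)
    intro b hb
    have e2 : D (dec b ++ [l]) = phi D [] (cc l b) :=
      (congrFun (phi_cc D hc [] l) b).symm
    rw [e2, ← ev_look _ _ hOk]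
    have h3 := List.all_eq_true.1 hcheck b hb
    simp only [Bool.and_eq_true, List.isEmpty_iff] at h3
    cases l
    · rw [h3.1]; rfl
    · rw [h3.2]; rfl

end sound
end TS
namespace TS

def R4 : Rules :=
  [(30, []), (29, [(28,4), (26,4), (22,4)]), (27, [(25,4), (24,4), (21,4), (20,4), (18,4)]),
   (23, [(19,4), (17,4), (16,4)]), (15, [])]

def R5 : Rules :=
  [(57, [(53,4), (52,4), (38,1)]), (51, [(49,4), (41,4), (34,1)]), (39, [(35,4), (33,4)]), (43,
   [(41,4), (40,4), (37,4), (36,4), (34,4)]), (45, [(44,4), (42,4), (38,4)]), (46, [])]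

def R6 : Rules :=
  [(117, [(106,1), (102,1), (86,1)]), (105, [(70,4)]), (99, [(73,1), (69,1), (68,1)]), (110,
   []), (107, [(101,4), (84,1), (82,1), (74,1), (70,1)]), (109, [(108,4), (106,4), (102,4)]),
   (78, []), (77, [(76,4), (74,4), (70,4)]), (75, [(73,4), (72,4), (69,4), (68,4)]), (71,
   [(67,4)]), (83, [(81,4), (73,4)]), (89, [(85,4), (84,4), (70,1)])]

def R7 : Rules :=
  [(213, [(204,1), (202,4), (172,1), (170,4), (154,4), (150,2)]), (201, [(165,1), (164,1),
   (149,4), (148,4), (146,4), (138,2)]), (205, [(204,4), (202,4), (166,1), (150,1)]), (206, []),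
   (238, []), (203, [(149,2), (148,1), (146,1), (140,4), (138,1)]), (217, [(204,4), (202,1),
   (172,4), (170,1), (166,4), (154,1), (150,2)]), (237, [(218,1), (214,1), (182,1)]), (153,
   [(149,4), (148,4)]), (147, [(145,4), (137,4)]), (135, []), (139, [(137,4), (136,4)]), (141,
   [(140,4), (138,4)]), (142, []), (173, [(172,4), (170,4), (166,4)]), (171, [(165,4), (148,1),
   (146,1), (138,1)]), (174, []), (163, [(137,1)]), (169, []), (181, [(170,1), (166,1),
   (150,1)])]

def R8 : Rules :=
  [(406, [(342,4), (310,4)]), (278, []), (332, [(330,1), (300,1), (298,2)]), (277, [(276,4),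
   (274,4)]), (405, [(330,4), (300,4), (298,4), (294,1), (282,1)]), (430, []), (429, [(410,4),
   (346,4), (310,4)]), (409, [(330,4), (300,1), (282,4)]), (437, [(342,4)]), (309, [(298,1),
   (294,1)]), (297, []), (291, []), (302, []), (299, [(293,4), (276,1), (274,1)]), (301,
   [(300,4), (298,4), (294,4)]), (275, [(273,4)]), (281, [(274,1)]), (365, [(346,1), (342,1),
   (310,1)]), (345, [(300,3), (298,4), (294,4), (282,1)]), (331, [(276,4), (274,4)]), (366, []),
   (334, []), (333, [(330,3), (300,4), (298,3), (294,1)]), (329, [(293,1), (292,1)]), (341,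
   [(300,2), (298,1), (282,4)])]

def R9 : Rules :=
  [(822, [(694,4)]), (566, []), (550, []), (549, [(548,4)]), (877, [(694,4)]), (878, []), (821,
   []), (585, []), (589, [(586,3), (554,4)]), (590, []), (622, []), (587, []), (597, [(554,4)]),
   (621, [(602,1), (598,1)]), (547, []), (553, []), (565, [(554,1)]), (693, [(598,4)]), (601,
   [(554,1)]), (685, [(602,3), (598,4)]), (686, []), (661, [(586,4)]), (588, [(586,1),
   (554,1)]), (662, [(598,4)])]

def R10 : Rules :=
  [(1110, []), (1174, []), (1173, []), (1198, []), (1197, []), (1109, []), (1098, []), (1097,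
   []), (1205, []), (1390, []), (1389, []), (1206, [])]

theorem step4 : step [[], [], []] []
    [(false, false, false, dec 1), (false, false, false, dec 2), (false, false, true, dec 2),
    (false, true, true, dec 2), (true, true, true, dec 2)] = R4 := by
  decide +kernel

theorem step5 : step [R4, [], [], []] R4
    [(false, false, false, dec 6), (false, false, true, dec 6)] = R5 := by
  decide +kernel

theorem step6 : step [R5, R4, [], [], []] R5
    [(false, false, false, dec 12), (false, false, false, dec 14), (false, false, true, dec 14)]
    = R6 := by
  decide +kernel

theorem step7 : step [R6, R5, R4, [], [], []] R6
    [(false, false, false, dec 28), (false, false, true, dec 28)] = R7 := by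
  decide +kernel

theorem step8 : step [R7, R6, R5, R4, [], [], []] R7
    [(false, false, false, dec 56), (false, false, false, dec 60), (false, false, false, dec
    58), (false, false, true, dec 60)] = R8 := by
  decide +kernel

theorem step9 : step [R8, R7, R6, R5, R4, [], [], []] R8
    [(false, false, false, dec 104), (false, false, false, dec 120), (false, false, false, dec
    122), (false, false, true, dec 122)] = R9 := by
  decide +kernel

theorem step10 : step [R9, R8, R7, R6, R5, R4, [], [], []] R9
    [(false, false, false, dec 244)] = R10 := by
  decide +kernel

def S1 : List ℕ := nextS [] [0]
def S2 : List ℕ := nextS [] S1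
def S3 : List ℕ := nextS [] S2
def S4 : List ℕ := nextS R4 S3
def S5 : List ℕ := nextS R5 S4
def S6 : List ℕ := nextS R6 S5
def S7 : List ℕ := nextS R7 S6
def S8 : List ℕ := nextS R8 S7
def S9 : List ℕ := nextS R9 S8
def S10 : List ℕ := nextS R10 S9
theorem S10_nil : S10 = [] := by decide +kernel

theorem cyc1 : cycCheck [] [] [0]
    ([1, 2].map dec) = true := by
  decide +kernel

theorem cyc2 : cycCheck [[]] [0] S1
    ([3, 6, 5].map dec) = true := by
  decide +kernel

theorem cyc3 : cycCheck [[], []] S1 S2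
    ([7, 14, 11, 13].map dec) = true := by
  decide +kernel

theorem cyc4 : cycCheck [[], [], []] S2 S3
    ([15, 30, 23, 29, 27, 25].map dec) = true := by
  decide +kernel

theorem cyc5 : cycCheck [R4, [], [], []] S3 S4
    ([55, 59].map dec) = true := by
  decide +kernel

theorem cyc6 : cycCheck [R5, R4, [], [], []] S4 S5
    ([99, 117, 107, 113, 82, 76].map dec) = true := by
  decide +kernel

theorem cyc7 : cycCheck [R6, R5, R4, [], [], []] S5 S6
    ([215, 241].map dec) = true := by
  decide +kernel

theorem cyc8 : cycCheck [R7, R6, R5, R4, [], [], []] S6 S7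
    ([407, 485, 439, 481, 326, 284].map dec) = true := by
  decide +kernel

theorem cyc9 : cycCheck [R8, R7, R6, R5, R4, [], [], []] S7 S8
    ([839, 985, 811, 917].map dec) = true := by
  decide +kernel

theorem cyc10 : cycCheck [R9, R8, R7, R6, R5, R4, [], [], []] S8 S9
    ([1847, 1931].map dec) = true := by
  decide +kernel

def knownCodes : List ℕ :=
  [1, 2, 3, 6, 5, 7, 14, 11, 13, 15, 30, 23, 29, 27, 25, 55, 59, 99, 117, 107, 113, 82, 76, 215,
   241, 407, 485, 439, 481, 326, 284, 839, 985, 811, 917, 1847, 1931]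

theorem core {M : Type*} [AddCommGroup M] (D : List Bool → M) (h5 : ∀ w, 5 • D w = 0)
    (hc : ∀ u v, D (u ++ v) = D (v ++ u)) (hP : Pol D) (hnil : D [] = 0)
    (hk : ∀ c ∈ knownCodes, D (dec c) = 0) (w : List Bool) : D w = 0 := by
  have v0 := valid_nil D
  have v4 : Valid D R4 := by
    rw [← step4]
    exact valid_step D h5 hc hP _ (by simp [v0]) _ v0 _ (by decide)
  have v5 : Valid D R5 := by
    rw [← step5]
    exact valid_step D h5 hc hP _ (by simp [v4, v0]) _ v4 _ (by decide)
  have v6 : Valid D R6 := by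
    rw [← step6]
    exact valid_step D h5 hc hP _ (by simp [v5, v4, v0]) _ v5 _ (by decide)
  have v7 : Valid D R7 := by
    rw [← step7]
    exact valid_step D h5 hc hP _ (by simp [v6, v5, v4, v0]) _ v6 _ (by decide)
  have v8 : Valid D R8 := by
    rw [← step8]
    exact valid_step D h5 hc hP _ (by simp [v7, v6, v5, v4, v0]) _ v7 _ (by decide)
  have v9 : Valid D R9 := by
    rw [← step9]
    exact valid_step D h5 hc hP _ (by simp [v8, v7, v6, v5, v4, v0]) _ v8 _ (by decide)
  have v10 : Valid D R10 := by
    rw [← step10]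
    exact valid_step D h5 hc hP _ (by simp [v9, v8, v7, v6, v5, v4, v0]) _ v9 _ (by decide)
  have s0 := spans_zero D
  have s1 : Spans D 1 S1 := spans_step D hc _ v0 0 [0] S1 s0 (by decide +kernel)
  have s2 : Spans D 2 S2 := spans_step D hc _ v0 1 S1 S2 s1 (by decide +kernel)
  have s3 : Spans D 3 S3 := spans_step D hc _ v0 2 S2 S3 s2 (by decide +kernel)
  have s4 : Spans D 4 S4 := spans_step D hc _ v4 3 S3 S4 s3 (by decide +kernel)
  have s5 : Spans D 5 S5 := spans_step D hc _ v5 4 S4 S5 s4 (by decide +kernel)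
  have s6 : Spans D 6 S6 := spans_step D hc _ v6 5 S5 S6 s5 (by decide +kernel)
  have s7 : Spans D 7 S7 := spans_step D hc _ v7 6 S6 S7 s6 (by decide +kernel)
  have s8 : Spans D 8 S8 := spans_step D hc _ v8 7 S7 S8 s7 (by decide +kernel)
  have s9 : Spans D 9 S9 := spans_step D hc _ v9 8 S8 S9 s8 (by decide +kernel)
  have s10 : Spans D 10 S10 := spans_step D hc _ v10 9 S9 S10 s9 (by decide +kernel)
  have hk' : ∀ L : List ℕ, L.all (fun c => knownCodes.any (Nat.beq c) && !(dec c).isEmpty) = true →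
      ∀ w ∈ L.map dec, w ≠ [] ∧ D w = 0 := by
    intro L hL w hw
    obtain ⟨c, hc, rfl⟩ := List.mem_map.1 hw
    have h := List.all_eq_true.1 hL c hc
    simp only [Bool.and_eq_true, List.any_eq_true] at h
    obtain ⟨⟨b, hb, hb'⟩, h2⟩ := h
    obtain rfl : c = b := Nat.eq_of_beq_eq_true hb'
    exact ⟨by simpa using h2, hk c hb⟩
  by_cases h11 : 11 ≤ w.length
  · have := s10 (w.drop 10) (by
      intro h
      have := congrArg List.length h
      simp at this
      omega) (by rw [S10_nil]; simp) (w.take 10) (by simp; omega)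
    simpa using this
  have hlt : w.length < 11 := by omega
  have hcases : w.length = 0 ∨ w.length = 1 ∨ w.length = 2 ∨ w.length = 3 ∨ w.length = 4 ∨
      w.length = 5 ∨ w.length = 6 ∨ w.length = 7 ∨ w.length = 8 ∨ w.length = 9 ∨
      w.length = 10 := by omega
  rcases hcases with h | h | h | h | h | h | h | h | h | h | h
  · rw [List.length_eq_zero_iff] at h
    rw [h, hnil]
  · exact cyc_zero D h5 hc _ (by simp [v0]) 0 _ _ s0 _ (hk' _ (by decide +kernel)) cyc1 w h
  · exact cyc_zero D h5 hc _ (by simp [v0]) 1 _ _ s1 _ (hk' _ (by decide +kernel)) cyc2 w h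
  · exact cyc_zero D h5 hc _ (by simp [v0]) 2 _ _ s2 _ (hk' _ (by decide +kernel)) cyc3 w h
  · exact cyc_zero D h5 hc _ (by simp [v0]) 3 _ _ s3 _ (hk' _ (by decide +kernel)) cyc4 w h
  · exact cyc_zero D h5 hc _ (by simp [v4, v0]) 4 _ _ s4 _ (hk' _ (by decide +kernel)) cyc5 w h
  · exact cyc_zero D h5 hc _ (by simp [v5, v4, v0]) 5 _ _ s5 _ (hk' _ (by decide +kernel)) cyc6 w h
  · exact cyc_zero D h5 hc _ (by simp [v6, v5, v4, v0]) 6 _ _ s6 _ (hk' _ (by decide +kernel)) cyc7 w h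
  · exact cyc_zero D h5 hc _ (by simp [v7, v6, v5, v4, v0]) 7 _ _ s7 _ (hk' _ (by decide +kernel)) cyc8 w h
  · exact cyc_zero D h5 hc _ (by simp [v8, v7, v6, v5, v4, v0]) 8 _ _ s8 _ (hk' _ (by decide +kernel)) cyc9 w h
  · exact cyc_zero D h5 hc _ (by simp [v9, v8, v7, v6, v5, v4, v0]) 9 _ _ s9 _ (hk' _ (by decide +kernel)) cyc10 w h
end TS

set_option maxHeartbeats 4000000 in
theorem ch4 (A : Matrix (Fin 4) (Fin 4) ℂ) :
   (24:ℂ) • (A*A*A*A) - (24 * A.trace) • (A*A*A) + (12 * (A.trace*A.trace - (A*A).trace)) • (A*A)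
   - (4 * (A.trace*A.trace*A.trace - 3 * (A.trace * (A*A).trace) + 2 * (A*A*A).trace)) • A
   + (A.trace*A.trace*A.trace*A.trace - 6 * (A.trace*A.trace*(A*A).trace) + 3 * ((A*A).trace * (A*A).trace) + 8 * (A.trace * (A*A*A).trace) - 6 * (A*A*A*A).trace) • (1 : Matrix (Fin 4) (Fin 4) ℂ) = 0 := by
  ext i j
  fin_cases i <;> fin_cases j <;> simp [Matrix.trace, Matrix.mul_apply, Fin.sum_univ_four] <;> ring

theorem pol4 {V : Type*} [AddCommGroup V] (q : V → V → V → V → ℂ)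
    (h1 : ∀ x y b c d, q (x + y) b c d = q x b c d + q y b c d)
    (h2 : ∀ x y a c d, q a (x + y) c d = q a x c d + q a y c d)
    (h3 : ∀ x y a b d, q a b (x + y) d = q a b x d + q a b y d)
    (h4 : ∀ x y a b c, q a b c (x + y) = q a b c x + q a b c y)
    (h : ∀ x, q x x x x = 0) (a b c d : V) :
  q a b c d + q a b d c + q a c b d + q a c d b + q a d b c + q a d c b
  + (q b a c d + q b a d c + q b c a d + q b c d a + q b d a c + q b d c a)
  + (q c a b d + q c a d b + q c b a d + q c b d a + q c d a b + q c d b a)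
  + (q d a b c + q d a c b + q d b a c + q d b c a + q d c a b + q d c b a) = 0 := by
  have k4 := h (a+b+c+d)
  have k31 := h (a+b+c)
  have k32 := h (a+b+d)
  have k33 := h (a+c+d)
  have k34 := h (b+c+d)
  have j1 := h (a+b)
  have j2 := h (a+c)
  have j3 := h (a+d)
  have j4 := h (b+c)
  have j5 := h (b+d)
  have j6 := h (c+d)
  have i1 := h a
  have i2 := h b
  have i3 := h c
  have i4 := h d
  simp only [h1,h2,h3,h4] at k4 k31 k32 k33 k34 j1 j2 j3 j4 j5 j6
  linear_combination k4 - k31 - k32 - k33 - k34 + j1 + j2 + j3 + j4 + j5 + j6 - i1 - i2 - i3 - i4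

namespace TS

theorem coreC (D : List Bool → ℂ) (hfin : (Set.range D).Finite)
    (hc : ∀ u v, D (u ++ v) = D (v ++ u)) (hP : Pol D) (hnil : D [] = 0)
    (hk : ∀ c ∈ knownCodes, D (dec c) = 0) (w : List Bool) : D w = 0 := by
  let N : Submodule ℤ ℂ := Submodule.span ℤ (Set.range D)
  have hN : N.FG := Submodule.fg_span hfin
  let I : Ideal ℤ := Ideal.span {5}
  let Q : Submodule ℤ ℂ := I • N
  have hD : ∀ w, D w ∈ N := fun w => Submodule.subset_span ⟨w, rfl⟩
  have h0 : ∀ w, Q.mkQ (D w) = 0 := by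
    intro w
    refine core (M := ℂ ⧸ Q) (fun w => Q.mkQ (D w)) ?_ ?_ ?_ ?_ ?_ w
    · intro w
      show 5 • Q.mkQ (D w) = 0
      rw [← map_nsmul, Submodule.mkQ_apply, Submodule.Quotient.mk_eq_zero]
      have : (5:ℕ) • D w = (5:ℤ) • D w := by simp
      rw [this]
      exact Submodule.smul_mem_smul (Ideal.mem_span_singleton_self 5) (hD w)
    · intro u v
      simp only [hc u v]
    · intro w1 w2 w3 w4 z a1 a2 a3 a4 a5
      have h := congrArg Q.mkQ (hP w1 w2 w3 w4 z a1 a2 a3 a4 a5)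
      rw [map_list_sum, List.map_map, map_zero] at h
      exact h
    · simp only [hnil, map_zero]
    · intro c hc
      simp only [hk c hc, map_zero]
  have hle : N ≤ I • N := by
    refine Submodule.span_le.2 ?_
    rintro _ ⟨w, rfl⟩
    have := h0 w
    rwa [Submodule.mkQ_apply, Submodule.Quotient.mk_eq_zero] at this
  obtain ⟨r, hr, hr2⟩ := Submodule.exists_sub_one_mem_and_smul_eq_zero_of_fg_of_le_smul I N hN hle
  have hr0 : r ≠ 0 := by
    rintro rfl
    have := Ideal.mem_span_singleton.1 hr
    omega
  have := hr2 (D w) (hD w)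
  rcases smul_eq_zero.1 this with h | h
  · exact absurd h hr0
  · exact h

abbrev M4 := Matrix (Fin 4) (Fin 4) ℂ

def wd (a : M4) (w : List Bool) : M4 := (w.map (fun l => cond l aᴴ a)).prod

theorem wd_append (a : M4) (u v : List Bool) : wd a (u ++ v) = wd a u * wd a v := by
  simp [wd]

theorem wd_cons (a : M4) (l : Bool) (v : List Bool) : wd a (l :: v) = cond l aᴴ a * wd a v := by
  simp [wd]

def star (w : List Bool) : List Bool := (w.map (fun l => !l)).reverse

theorem star_cons (l : Bool) (w : List Bool) : star (l :: w) = star w ++ [!l] := by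
  simp [star]

theorem wd_star (a : M4) (w : List Bool) : wd a (star w) = (wd a w)ᴴ := by
  induction w with
  | nil => simp [star, wd]
  | cons l w ih =>
    rw [star_cons, wd_append, wd_cons a l w, Matrix.conjTranspose_mul, ih]
    cases l <;> simp [wd]

def tw (a : M4) (w : List Bool) : ℂ := (wd a w).trace

theorem tw_star (a : M4) (w : List Bool) : tw a (star w) = (starRingEnd ℂ) (tw a w) := by
  rw [tw, wd_star, Matrix.trace_conjTranspose]; rfl

theorem tw_comm (a : M4) (u v : List Bool) : tw a (u ++ v) = tw a (v ++ u) := by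
  simp only [tw, wd_append]; exact Matrix.trace_mul_comm _ _

/-- The polarised form of the Cayley-Hamilton identity. -/
def q4 (Z A B C E : M4) : ℂ :=
  24 * (A * B * C * E * Z).trace - 24 * A.trace * (B * C * E * Z).trace
  + 12 * (A.trace * B.trace - (A * B).trace) * (C * E * Z).trace
  - 4 * (A.trace * B.trace * C.trace - 3 * (A.trace * (B * C).trace)
      + 2 * (A * B * C).trace) * (E * Z).trace
  + (A.trace * B.trace * C.trace * E.trace - 6 * (A.trace * B.trace * (C * E).trace)
      + 3 * ((A * B).trace * (C * E).trace) + 8 * (A.trace * (B * C * E).trace)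
      - 6 * (A * B * C * E).trace) * Z.trace

theorem q4_diag (Z A : M4) : q4 Z A A A A = 0 := by
  have h := congrArg (fun X => (X * Z).trace) (ch4 A)
  simp only [add_mul, sub_mul, Matrix.trace_add, Matrix.trace_sub, Matrix.smul_mul,
    Matrix.trace_smul, one_mul, zero_mul, Matrix.trace_zero, smul_eq_mul] at h
  rw [q4]
  linear_combination h

def lowr (a : M4) (u v w t z : List Bool) : ℂ :=
  - 24 * tw a u * tw a (v ++ w ++ t ++ z)
  + 12 * (tw a u * tw a v - tw a (u ++ v)) * tw a (w ++ t ++ z)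
  - 4 * (tw a u * tw a v * tw a w - 3 * (tw a u * tw a (v ++ w))
      + 2 * tw a (u ++ v ++ w)) * tw a (t ++ z)
  + (tw a u * tw a v * tw a w * tw a t - 6 * (tw a u * tw a v * tw a (w ++ t))
      + 3 * (tw a (u ++ v) * tw a (w ++ t)) + 8 * (tw a u * tw a (v ++ w ++ t))
      - 6 * tw a (u ++ v ++ w ++ t)) * tw a z

theorem q4_words (a : M4) (u v w t z : List Bool) :
    q4 (wd a z) (wd a u) (wd a v) (wd a w) (wd a t)
      = 24 * tw a (u ++ v ++ w ++ t ++ z) + lowr a u v w t z := by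
  simp only [q4, lowr, tw, wd_append]; ring

theorem lowr_eq (a b : M4) (u v w t z : List Bool)
    (hu : u ≠ []) (hv : v ≠ []) (hw : w ≠ []) (ht : t ≠ []) (hz : z ≠ []) 
    (h : ∀ s : List Bool, s.length < (u ++ v ++ w ++ t ++ z).length → tw a s = tw b s) :
    lowr a u v w t z = lowr b u v w t z := by
  rw [← List.length_pos_iff] at hu hv hw ht hz
  simp only [List.length_append] at h
  have k : ∀ s : List Bool, s.length < u.length + v.length + w.length + t.length + z.length →
    tw a s = tw b s := h
  simp only [lowr]
  rw [k u (by omega), k v (by omega), k w (by omega), k t (by omega), k z (by omega),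
    k (v ++ w ++ t ++ z) (by simp only [List.length_append]; omega),
    k (w ++ t ++ z) (by simp only [List.length_append]; omega),
    k (t ++ z) (by simp only [List.length_append]; omega),
    k (u ++ v) (by simp only [List.length_append]; omega),
    k (v ++ w) (by simp only [List.length_append]; omega),
    k (w ++ t) (by simp only [List.length_append]; omega),
    k (u ++ v ++ w) (by simp only [List.length_append]; omega),
    k (v ++ w ++ t) (by simp only [List.length_append]; omega),
    k (u ++ v ++ w ++ t) (by simp only [List.length_append]; omega)]

def qq (a b : M4) (z u v w t : List Bool) : ℂ :=
  q4 (wd a z) (wd a u) (wd a v) (wd a w) (wd a t) -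
  q4 (wd b z) (wd b u) (wd b v) (wd b w) (wd b t)

theorem q4_sum (Z a b c d : M4) :
    q4 Z a b c d + q4 Z a b d c + q4 Z a c b d + q4 Z a c d b + q4 Z a d b c + q4 Z a d c b
  + (q4 Z b a c d + q4 Z b a d c + q4 Z b c a d + q4 Z b c d a + q4 Z b d a c + q4 Z b d c a)
  + (q4 Z c a b d + q4 Z c a d b + q4 Z c b a d + q4 Z c b d a + q4 Z c d a b + q4 Z c d b a)
  + (q4 Z d a b c + q4 Z d a c b + q4 Z d b a c + q4 Z d b c a + q4 Z d c a b + q4 Z d c b a)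
    = 0 := by
  apply pol4 (q4 Z)
  · intro x y b c d; simp only [q4, add_mul, mul_add, Matrix.trace_add]; ring
  · intro x y b c d; simp only [q4, add_mul, mul_add, Matrix.trace_add]; ring
  · intro x y b c d; simp only [q4, add_mul, mul_add, Matrix.trace_add]; ring
  · intro x y b c d; simp only [q4, add_mul, mul_add, Matrix.trace_add]; ring
  · exact q4_diag Z

theorem all_eq (a b : M4) (hk : ∀ c ∈ knownCodes, tw a (dec c) = tw b (dec c))
    (n : ℕ) : ∀ w : List Bool, w.length < n → tw a w = tw b w := by
  induction n with
  | zero => intro w h; omega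
  | succ n ih =>
    let D : List Bool → ℂ := fun w => if w.length = n then tw a w - tw b w else 0
    have key : ∀ w, D w = 0 := by
      apply coreC
      · refine Set.Finite.subset (((List.finite_length_eq Bool n).image
          (fun w => tw a w - tw b w)).union (Set.finite_singleton 0)) ?_
        rintro _ ⟨w, rfl⟩
        by_cases h : w.length = n
        · left; exact ⟨w, h, by simp [D, h]⟩
        · right; simp [D, h]
      · intro u v
        simp only [D, List.length_append, add_comm u.length, tw_comm _ u v]
      · intro w1 w2 w3 w4 z h1 h2 h3 h4 hz
        by_cases hl : w1.length + w2.length + w3.length + w4.length + z.length = n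
        · have e : ∀ u v w t : List Bool, u ≠ [] → v ≠ [] → w ≠ [] → t ≠ [] →
              u.length + v.length + w.length + t.length + z.length = n →
              24 * D (u ++ v ++ w ++ t ++ z) = q4 (wd a z) (wd a u) (wd a v) (wd a w) (wd a t) -
                q4 (wd b z) (wd b u) (wd b v) (wd b w) (wd b t) := by
            intro u v w t hu hv hw ht hl
            rw [q4_words, q4_words, lowr_eq a b u v w t z hu hv hw ht hz
              (fun s hs => ih s (by simp only [List.length_append] at hs; omega))]
            simp only [D, List.length_append, hl, if_true]
            ring
          have f : ∀ u v w t : List Bool, u ≠ [] → v ≠ [] → w ≠ [] → t ≠ [] →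
              u.length + v.length + w.length + t.length + z.length = n →
              D (u ++ v ++ w ++ t ++ z) = (q4 (wd a z) (wd a u) (wd a v) (wd a w) (wd a t) -
                q4 (wd b z) (wd b u) (wd b v) (wd b w) (wd b t)) / 24 := by
            intro u v w t hu hv hw ht hl
            rw [← e u v w t hu hv hw ht hl]; ring
          have sa := q4_sum (wd a z) (wd a w1) (wd a w2) (wd a w3) (wd a w4)
          have sb := q4_sum (wd b z) (wd b w1) (wd b w2) (wd b w3) (wd b w4)
          simp only [P4, List.map_cons, List.map_nil, List.sum_cons, List.sum_nil]
          rw [f w1 w2 w3 w4 (by assumption) (by assumption) (by assumption) (by assumption) (by omega),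
            f w1 w2 w4 w3 (by assumption) (by assumption) (by assumption) (by assumption) (by omega),
            f w1 w3 w2 w4 (by assumption) (by assumption) (by assumption) (by assumption) (by omega),
            f w1 w3 w4 w2 (by assumption) (by assumption) (by assumption) (by assumption) (by omega),
            f w1 w4 w2 w3 (by assumption) (by assumption) (by assumption) (by assumption) (by omega),
            f w1 w4 w3 w2 (by assumption) (by assumption) (by assumption) (by assumption) (by omega),
            f w2 w1 w3 w4 (by assumption) (by assumption) (by assumption) (by assumption) (by omega),
            f w2 w1 w4 w3 (by assumption) (by assumption) (by assumption) (by assumption) (by omega),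
            f w2 w3 w1 w4 (by assumption) (by assumption) (by assumption) (by assumption) (by omega),
            f w2 w3 w4 w1 (by assumption) (by assumption) (by assumption) (by assumption) (by omega),
            f w2 w4 w1 w3 (by assumption) (by assumption) (by assumption) (by assumption) (by omega),
            f w2 w4 w3 w1 (by assumption) (by assumption) (by assumption) (by assumption) (by omega),
            f w3 w1 w2 w4 (by assumption) (by assumption) (by assumption) (by assumption) (by omega),
            f w3 w1 w4 w2 (by assumption) (by assumption) (by assumption) (by assumption) (by omega),
            f w3 w2 w1 w4 (by assumption) (by assumption) (by assumption) (by assumption) (by omega),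
            f w3 w2 w4 w1 (by assumption) (by assumption) (by assumption) (by assumption) (by omega),
            f w3 w4 w1 w2 (by assumption) (by assumption) (by assumption) (by assumption) (by omega),
            f w3 w4 w2 w1 (by assumption) (by assumption) (by assumption) (by assumption) (by omega),
            f w4 w1 w2 w3 (by assumption) (by assumption) (by assumption) (by assumption) (by omega),
            f w4 w1 w3 w2 (by assumption) (by assumption) (by assumption) (by assumption) (by omega),
            f w4 w2 w1 w3 (by assumption) (by assumption) (by assumption) (by assumption) (by omega),
            f w4 w2 w3 w1 (by assumption) (by assumption) (by assumption) (by assumption) (by omega),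
            f w4 w3 w1 w2 (by assumption) (by assumption) (by assumption) (by assumption) (by omega),
            f w4 w3 w2 w1 (by assumption) (by assumption) (by assumption) (by assumption) (by omega)]
          linear_combination (sa - sb) / 24
        · have f : ∀ u v w t : List Bool, 
              u.length + v.length + w.length + t.length + z.length ≠ n →
              D (u ++ v ++ w ++ t ++ z) = 0 := by
            intro u v w t h
            simp only [D, List.length_append]
            rw [if_neg h]
          apply List.sum_eq_zero
          intro x hx
          obtain ⟨y, hy, rfl⟩ := List.mem_map.1 hx
          simp only [P4, List.mem_cons, List.not_mem_nil, or_false] at hy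
          have hy2 : y.length = w1.length + w2.length + w3.length + w4.length := by
            rcases hy with h | h | h | h | h | h | h | h | h | h | h | h | h | h | h | h | h | h |
              h | h | h | h | h | h <;> rw [h] <;> simp only [List.length_append] <;> omega
          simp only [D, List.length_append, hy2]
          rw [if_neg hl]
      · simp [D, tw, wd]
      · intro c hc
        simp only [D, hk c hc, sub_self, ite_self]
    intro w hw
    rcases Nat.lt_succ_iff_lt_or_eq.1 hw with h | h
    · exact ih w h
    · have := key w
      simp only [D, h, if_true] at this
      exact sub_eq_zero.1 this

theorem wd_conj (a u : M4) (hu : uᴴ * u = 1) (w : List Bool) (hu2 : u * uᴴ = 1) :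
    wd (u * a * uᴴ) w = u * wd a w * uᴴ := by
  induction w with
  | nil => simp [wd, hu2]
  | cons l w ih =>
    have e : (cond l (u * a * uᴴ)ᴴ (u * a * uᴴ)) = u * (cond l aᴴ a) * uᴴ := by
      cases l <;> simp [Matrix.conjTranspose_mul, Matrix.mul_assoc]
    rw [wd_cons, wd_cons, ih, e]
    calc u * (cond l aᴴ a) * uᴴ * (u * wd a w * uᴴ)
        = u * (cond l aᴴ a) * (uᴴ * u) * (wd a w * uᴴ) := by simp only [Matrix.mul_assoc]
      _ = _ := by rw [hu]; simp only [Matrix.mul_assoc, Matrix.one_mul]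

theorem tw_conj (a u : M4) (hu : u * uᴴ = 1) (w : List Bool) :
    tw (u * a * uᴴ) w = tw a w := by
  have hu2 : uᴴ * u = 1 := mul_eq_one_comm.1 hu
  rw [tw, wd_conj a u hu2 w hu, Matrix.trace_mul_comm, ← Matrix.mul_assoc, hu2, Matrix.one_mul, tw]

def ws : Fin 20 → List Bool :=
  ![[false], [false, false], [false, true], [false, false, false], [false, false, true],
    [false, false, false, false], [false, false, false, true], [false, false, true, true],
    [false, true, false, true], [false, false, false, true, true],
    [false, false, true, false, false, true], [false, false, true, true, false, true],
    [true, true, false, false, true, false], [false, false, false, true, true, false, true],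
    [false, false, false, true, true, false, false, true],
    [false, false, false, true, true, true, false, true],
    [true, true, true, false, false, false, true, false],
    [false, false, false, true, false, false, true, false, true],
    [false, false, true, true, false, true, false, false, true],
    [false, false, false, true, true, true, false, false, true, true]]

theorem wordTraces_eq (a : M4) (i : Fin 20) : wordTraces a i = tw a (ws i) := by
  fin_cases i <;>
    simp [wordTraces, ws, tw, wd, pow_succ, Matrix.mul_assoc]

theorem known_ok : ∀ c ∈ knownCodes, ∃ i : Fin 20, dec c = ws i ∨ dec c = star (ws i) := by
  decide

theorem all_eq' (a b : M4) (h : ∀ i : Fin 20, wordTraces a i = wordTraces b i) (w : List Bool) :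
    tw a w = tw b w := by
  refine all_eq a b ?_ (w.length + 1) w (by omega)
  intro c hc
  obtain ⟨i, hi | hi⟩ := known_ok c hc
  · rw [hi, ← wordTraces_eq, ← wordTraces_eq, h]
  · rw [hi, tw_star, tw_star, ← wordTraces_eq, ← wordTraces_eq, h]

end TS
namespace TS

open scoped ComplexOrder

theorem exists_compl (V : Submodule ℂ M4) :
    ∃ W : Submodule ℂ M4, IsCompl V W ∧ ∀ X, X ∈ W ↔ ∀ Y ∈ V, (X * Yᴴ).trace = 0 := by
  let i1 : NormedAddCommGroup M4 := Matrix.toMatrixNormedAddCommGroup 1 Matrix.PosDef.one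
  let i2 : InnerProductSpace ℂ M4 :=
    Matrix.toMatrixInnerProductSpace 1 Matrix.PosSemidef.one
  refine ⟨Vᗮ, V.isCompl_orthogonal, ?_⟩
  intro X
  rw [Submodule.mem_orthogonal]
  have e : ∀ Y : M4, inner ℂ Y X = (X * Yᴴ).trace := by
    intro Y
    show (X * 1 * Yᴴ).trace = _
    rw [Matrix.mul_one]
  simp only [e]

def ph (a P : M4) : (List Bool →₀ ℂ) →ₗ[ℂ] M4 :=
  Finsupp.linearCombination ℂ (fun w => wd a w * P)

theorem ph_single (a P : M4) (w : List Bool) (c : ℂ) :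
    ph a P (Finsupp.single w c) = c • (wd a w * P) := by
  simp [ph]

theorem ph_shift (a P : M4) (l : Bool) (f : List Bool →₀ ℂ) :
    ph a P (Finsupp.lmapDomain ℂ ℂ (List.cons l) f) = cond l aᴴ a * ph a P f := by
  induction f using Finsupp.induction_linear with
  | zero => simp
  | add f g hf hg => rw [map_add, map_add, hf, hg, map_add, mul_add]
  | single w c =>
    rw [Finsupp.lmapDomain_apply, Finsupp.mapDomain_single, ph_single, ph_single, wd_cons,
      Matrix.mul_smul, Matrix.mul_assoc]

theorem ph_tr (a b P Q : M4) (hP : P * P = P) (hPh : Pᴴ = P) (hQ : Q * Q = Q) (hQh : Qᴴ = Q)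
    (h : ∀ w, (P * wd a w).trace = (Q * wd b w).trace) (f g : List Bool →₀ ℂ) :
    ((ph a P f)ᴴ * ph a P g).trace = ((ph b Q f)ᴴ * ph b Q g).trace := by
  induction f using Finsupp.induction_linear with
  | zero => simp
  | add f f' hf hf' =>
    simp only [map_add, Matrix.conjTranspose_add, add_mul, Matrix.trace_add, hf, hf']
  | single w c =>
    induction g using Finsupp.induction_linear with
    | zero => simp
    | add f f' hf hf' =>
      simp only [map_add, mul_add, Matrix.trace_add, hf, hf']
    | single w' c' =>
      have e : ∀ a P : M4, P * P = P → Pᴴ = P → ((wd a w * P)ᴴ * (wd a w' * P)).trace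
          = (P * wd a (star w ++ w')).trace := by
        intro a P h1 h2
        rw [Matrix.conjTranspose_mul, h2, ← wd_star, wd_append, ← Matrix.mul_assoc,
          Matrix.trace_mul_comm, ← Matrix.mul_assoc, ← Matrix.mul_assoc, h1, Matrix.mul_assoc]
      simp only [ph_single, Matrix.conjTranspose_smul, Matrix.smul_mul, Matrix.mul_smul,
        Matrix.trace_smul, e a P hP hPh, e b Q hQ hQh, h]

theorem exists_T (a b P Q : M4) (hP : P * P = P) (hPh : Pᴴ = P) (hQ : Q * Q = Q) (hQh : Qᴴ = Q)
    (h : ∀ w, (P * wd a w).trace = (Q * wd b w).trace) :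
    ∃ T : M4 →ₗ[ℂ] M4, T P = Q ∧ (∀ X, T (a * X) = b * T X) ∧ (∀ X, T (aᴴ * X) = bᴴ * T X) := by
  have hker : LinearMap.ker (ph a P) ≤ LinearMap.ker (ph b Q) := by
    intro f hf
    rw [LinearMap.mem_ker] at hf ⊢
    have := ph_tr a b P Q hP hPh hQ hQh h f f
    rw [hf, Matrix.mul_zero, Matrix.trace_zero] at this
    exact Matrix.trace_conjTranspose_mul_self_eq_zero_iff.1 this.symm
  obtain ⟨W, hW, hW2⟩ := exists_compl (LinearMap.range (ph a P))
  let T0 : LinearMap.range (ph a P) →ₗ[ℂ] M4 :=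
    (Submodule.liftQ _ (ph b Q) hker).comp (ph a P).quotKerEquivRange.symm.toLinearMap
  have hT0 : ∀ f, T0 ⟨ph a P f, ⟨f, rfl⟩⟩ = ph b Q f := by
    intro f
    have : (ph a P).quotKerEquivRange.symm ⟨ph a P f, ⟨f, rfl⟩⟩
        = (LinearMap.ker (ph a P)).mkQ f := by
      rw [LinearEquiv.symm_apply_eq]
      rfl
    show Submodule.liftQ _ (ph b Q) hker ((ph a P).quotKerEquivRange.symm ⟨ph a P f, ⟨f, rfl⟩⟩) = _
    rw [this]; rfl
  let T : M4 →ₗ[ℂ] M4 := LinearMap.ofIsCompl hW T0 0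
  have hT1 : ∀ f, T (ph a P f) = ph b Q f := by
    intro f
    rw [← hT0 f]
    exact LinearMap.ofIsCompl_apply_left hW ⟨ph a P f, ⟨f, rfl⟩⟩
  have hT2 : ∀ X ∈ W, T X = 0 := by
    intro X hX
    exact LinearMap.ofIsCompl_apply_right hW ⟨X, hX⟩
  have key : ∀ (l : Bool) X, T (cond l aᴴ a * X) = cond l bᴴ b * T X := by
    intro l X
    have hX : X ∈ LinearMap.range (ph a P) ⊔ W := by rw [hW.sup_eq_top]; trivial
    obtain ⟨_, ⟨f, rfl⟩, Y, hY, rfl⟩ := Submodule.mem_sup.1 hX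
    have hY' : cond l aᴴ a * Y ∈ W := by
      rw [hW2] at hY ⊢
      rintro _ ⟨g, rfl⟩
      have := hY (ph a P (Finsupp.lmapDomain ℂ ℂ (List.cons (!l)) g)) ⟨_, rfl⟩
      rw [ph_shift, Matrix.conjTranspose_mul, ← Matrix.mul_assoc, Matrix.trace_mul_comm,
        ← Matrix.mul_assoc] at this
      rw [← this]
      cases l <;> simp
    rw [mul_add, map_add, map_add, hT2 _ hY', hT2 _ hY, ← ph_shift, hT1, hT1, ph_shift, mul_add,
      mul_zero]
  refine ⟨T, ?_, key false, key true⟩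
  have := hT1 (Finsupp.single [] 1)
  rw [ph_single, ph_single] at this
  simpa [wd] using this

def ST (T : M4 →ₗ[ℂ] M4) (j k : Fin 4) : M4 := fun i l => T (Matrix.single l j 1) i k

theorem ST_mul (T : M4 →ₗ[ℂ] M4) (j k : Fin 4) (a b : M4) (h : ∀ X, T (a * X) = b * T X) :
    ST T j k * a = b * ST T j k := by
  ext i l
  have h1 : a * Matrix.single l j (1:ℂ) = ∑ m, a m l • Matrix.single m j (1:ℂ) := by
    ext p q
    rw [Matrix.sum_apply]
    simp [Matrix.mul_apply, Matrix.single_apply, ite_and, Finset.sum_ite_eq]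
  have h2 := congrFun (congrFun (h (Matrix.single l j 1)) i) k
  rw [h1, map_sum, Matrix.sum_apply, Matrix.mul_apply] at h2
  simp only [map_smul, Matrix.smul_apply, smul_eq_mul] at h2
  rw [Matrix.mul_apply, Matrix.mul_apply]
  rw [← show _ = ∑ m, b i m * ST T j k m l from h2]
  refine Finset.sum_congr rfl fun m _ => mul_comm _ _

theorem ST_zero (T : M4 →ₗ[ℂ] M4) (h : ∀ j k, ST T j k = 0) : T = 0 := by
  apply Matrix.ext_linearMap
  intro l j
  ext i k
  have := congrFun (congrFun (h j k) i) l
  simp only [ST, Matrix.zero_apply] at this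
  simp [this]

theorem exists_S (a b P Q : M4) (hP : P * P = P) (hPh : Pᴴ = P) (hQ : Q * Q = Q) (hQh : Qᴴ = Q)
    (h : ∀ w, (P * wd a w).trace = (Q * wd b w).trace)
    (ha : P * a = a * P) (ha' : P * aᴴ = aᴴ * P) (hb : Q * b = b * Q) (hb' : Q * bᴴ = bᴴ * Q)
    (hP0 : P ≠ 0) :
    ∃ S : M4, S ≠ 0 ∧ S * a = b * S ∧ S * aᴴ = bᴴ * S ∧ S * P = S ∧ Q * S = S := by
  have hQ0 : Q ≠ 0 := by
    rintro rfl
    have := h []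
    simp only [wd, List.map_nil, List.prod_nil, Matrix.mul_one, Matrix.trace_zero] at this
    apply hP0
    apply Matrix.trace_conjTranspose_mul_self_eq_zero_iff.1
    rw [hPh, hP, this]
  obtain ⟨T, hT, h1, h2⟩ := exists_T a b P Q hP hPh hQ hQh h
  let T' : M4 →ₗ[ℂ] M4 := (LinearMap.mulLeft ℂ Q).comp (T.comp (LinearMap.mulLeft ℂ P))
  have e : ∀ X, T' X = Q * T (P * X) := fun X => rfl
  have hT' : ¬ ∀ j k, ST T' j k = 0 := by
    intro hh
    have := ST_zero T' hh
    apply hQ0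
    have h3 := e P
    rw [this, hP, hT, hQ] at h3
    exact h3.symm
  push Not at hT'
  obtain ⟨j, k, hjk⟩ := hT'
  refine ⟨ST T' j k, hjk, ST_mul _ _ _ _ _ ?_, ST_mul _ _ _ _ _ ?_, ?_, ?_⟩
  · intro X
    rw [e, e, ← Matrix.mul_assoc, ha, Matrix.mul_assoc, h1, ← Matrix.mul_assoc, hb,
      Matrix.mul_assoc]
  · intro X
    rw [e, e, ← Matrix.mul_assoc, ha', Matrix.mul_assoc, h2, ← Matrix.mul_assoc, hb',
      Matrix.mul_assoc]
  · rw [ST_mul T' j k P 1, Matrix.one_mul]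
    intro X
    rw [e, e, ← Matrix.mul_assoc P, hP, Matrix.one_mul]
  · rw [← ST_mul T' j k 1 Q, Matrix.mul_one]
    intro X
    rw [e, e, ← Matrix.mul_assoc Q, hQ, Matrix.one_mul]

theorem exists_U' (a b P Q S : M4) (hPh : Pᴴ = P) (hS : S ≠ 0)
    (h1 : S * a = b * S) (h2 : S * aᴴ = bᴴ * S) (h3 : S * P = S) (h4 : Q * S = S) :
    ∃ U : M4, U ≠ 0 ∧ U * Uᴴ * U = U ∧ U * a = b * U ∧ U * aᴴ = bᴴ * U ∧ U * P = U ∧ Q * U = U := by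
  have h1' : Sᴴ * b = a * Sᴴ := by
    have := congrArg Matrix.conjTranspose h2
    simpa [Matrix.conjTranspose_mul] using this.symm
  have h2' : Sᴴ * bᴴ = aᴴ * Sᴴ := by
    have := congrArg Matrix.conjTranspose h1
    simpa [Matrix.conjTranspose_mul] using this.symm
  have h3' : P * Sᴴ = Sᴴ := by
    have := congrArg Matrix.conjTranspose h3
    simpa [Matrix.conjTranspose_mul, hPh] using this
  set H : M4 := Sᴴ * S with hH
  have hpsd : H.PosSemidef := Matrix.posSemidef_conjTranspose_mul_self S
  have hsa : IsSelfAdjoint H := hpsd.isHermitian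
  have c1 : Commute H a := by
    show Sᴴ * S * a = a * (Sᴴ * S)
    rw [Matrix.mul_assoc, h1, ← Matrix.mul_assoc, h1', Matrix.mul_assoc]
  have c2 : Commute H aᴴ := by
    show Sᴴ * S * aᴴ = aᴴ * (Sᴴ * S)
    rw [Matrix.mul_assoc, h2, ← Matrix.mul_assoc, h2', Matrix.mul_assoc]
  have c3 : Commute H P := by
    show Sᴴ * S * P = P * (Sᴴ * S)
    rw [Matrix.mul_assoc, h3, ← Matrix.mul_assoc, h3']
  have hspec : ∀ t ∈ spectrum ℝ H, 0 ≤ t := by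
    intro t ht
    rw [hpsd.isHermitian.spectrum_real_eq_range_eigenvalues] at ht
    obtain ⟨i, rfl⟩ := ht
    exact hpsd.eigenvalues_nonneg i
  have hcont : ∀ f : ℝ → ℝ, ContinuousOn f (spectrum ℝ H) := fun f =>
    (Matrix.finite_real_spectrum (A := H)).continuousOn f
  let g : ℝ → ℝ := fun t => (Real.sqrt t)⁻¹
  let G : M4 := cfc g H
  have hGsa : Gᴴ = G := (cfc_predicate g H : IsSelfAdjoint (cfc g H))
  have hid : cfc (fun t : ℝ => t) H = H := cfc_id' ℝ H
  have hGH : H * G = cfc (fun t : ℝ => t * g t) H := by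
    rw [cfc_mul (fun t : ℝ => t) g H (hcont _) (hcont _), hid]
  have hGHG : G * (H * G) = cfc (fun t : ℝ => g t * (t * g t)) H := by
    rw [hGH, ← cfc_mul _ _ H (hcont _) (hcont _)]
  refine ⟨S * G, ?_, ?_, ?_, ?_, ?_, ?_⟩
  · intro h0
    have : H * G * cfc Real.sqrt H = H := by
      rw [hGH, ← cfc_mul _ _ H (hcont _) (hcont _)]
      conv_rhs => rw [← hid]
      apply cfc_congr
      intro t ht
      have ht' := hspec t ht
      rcases eq_or_lt_of_le ht' with h | h
      · simp [← h]
      · have : Real.sqrt t ≠ 0 := (Real.sqrt_pos.2 h).ne'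
        simp only [g]
        field_simp
    rw [hH, Matrix.mul_assoc Sᴴ, h0, Matrix.mul_zero, Matrix.zero_mul] at this
    exact hS (Matrix.conjTranspose_mul_self_eq_zero.1 this.symm)
  · have : S * G * (S * G)ᴴ * (S * G) = S * (G * (G * (H * G))) := by
      rw [Matrix.conjTranspose_mul, hGsa, hH]; simp only [Matrix.mul_assoc]
    rw [this, hGHG]
    congr 1
    show cfc g H * _ = cfc g H
    rw [← cfc_mul _ _ H (hcont _) (hcont _)]
    apply cfc_congr
    intro t ht
    have ht' := hspec t ht
    rcases eq_or_lt_of_le ht' with h | h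
    · simp [← h, g]
    · have h5 : Real.sqrt t ≠ 0 := (Real.sqrt_pos.2 h).ne'
      have h6 := Real.mul_self_sqrt ht'
      simp only [g]
      field_simp
      nlinarith
  · rw [Matrix.mul_assoc, (c1.cfc_real g).eq, ← Matrix.mul_assoc, h1, Matrix.mul_assoc]
  · rw [Matrix.mul_assoc, (c2.cfc_real g).eq, ← Matrix.mul_assoc, h2, Matrix.mul_assoc]
  · rw [Matrix.mul_assoc, (c3.cfc_real g).eq, ← Matrix.mul_assoc, h3]
  · rw [← Matrix.mul_assoc, h4]

theorem inter_wd (a b U : M4) (h1 : U * a = b * U) (h2 : U * aᴴ = bᴴ * U) (w : List Bool) :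
    U * wd a w = wd b w * U := by
  induction w with
  | nil => simp [wd]
  | cons l w ih =>
    rw [wd_cons, wd_cons, Matrix.mul_assoc, ← ih, ← Matrix.mul_assoc, ← Matrix.mul_assoc]
    cases l
    · simp only [cond_false, h1]
    · simp only [cond_true, h2]

theorem specht (a b : M4) (h : ∀ w, tw a w = tw b w) :
    ∃ u : M4, u * uᴴ = 1 ∧ b = u * a * uᴴ := by
  let A : Set M4 := {U | U * Uᴴ * U = U ∧ U * a = b * U ∧ U * aᴴ = bᴴ * U}
  let R : M4 → Submodule ℂ M4 := fun U => LinearMap.range (LinearMap.mulLeft ℂ U)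
  obtain ⟨_, ⟨U, hU, rfl⟩, hmax⟩ := (wellFounded_gt (α := Submodule ℂ M4)).has_min (R '' A)
    ⟨_, 0, by simp [A], rfl⟩
  obtain ⟨u0, u1, u2⟩ := hU
  have u0' : Uᴴ * U * Uᴴ = Uᴴ := by
    have := congrArg Matrix.conjTranspose u0
    simpa [Matrix.conjTranspose_mul, Matrix.mul_assoc] using this
  have u1' : Uᴴ * b = a * Uᴴ := by
    have := congrArg Matrix.conjTranspose u2
    simpa [Matrix.conjTranspose_mul] using this.symm
  have u2' : Uᴴ * bᴴ = aᴴ * Uᴴ := by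
    have := congrArg Matrix.conjTranspose u1
    simpa [Matrix.conjTranspose_mul] using this.symm
  have ka : Uᴴ * U * a = a * (Uᴴ * U) := by
    rw [Matrix.mul_assoc, u1, ← Matrix.mul_assoc, u1', Matrix.mul_assoc]
  have ka' : Uᴴ * U * aᴴ = aᴴ * (Uᴴ * U) := by
    rw [Matrix.mul_assoc, u2, ← Matrix.mul_assoc, u2', Matrix.mul_assoc]
  have kb : U * Uᴴ * b = b * (U * Uᴴ) := by
    rw [Matrix.mul_assoc, u1', ← Matrix.mul_assoc, u1, Matrix.mul_assoc]
  have kb' : U * Uᴴ * bᴴ = bᴴ * (U * Uᴴ) := by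
    rw [Matrix.mul_assoc, u2', ← Matrix.mul_assoc, u2, Matrix.mul_assoc]
  by_cases hP0 : 1 - Uᴴ * U = 0
  · have e1 : Uᴴ * U = 1 := (sub_eq_zero.1 hP0).symm
    have e2 : U * Uᴴ = 1 := mul_eq_one_comm.1 e1
    exact ⟨U, e2, by rw [u1, Matrix.mul_assoc, e2, Matrix.mul_one]⟩
  exfalso
  have p1 : (1 - Uᴴ * U) * (1 - Uᴴ * U) = 1 - Uᴴ * U := by
    have : Uᴴ * U * (Uᴴ * U) = Uᴴ * U := by rw [← Matrix.mul_assoc, u0']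
    rw [sub_mul, mul_sub, mul_sub, this]; simp
  have q1 : (1 - U * Uᴴ) * (1 - U * Uᴴ) = 1 - U * Uᴴ := by
    have : U * Uᴴ * (U * Uᴴ) = U * Uᴴ := by rw [← Matrix.mul_assoc, u0]
    rw [sub_mul, mul_sub, mul_sub, this]; simp
  have p2 : (1 - Uᴴ * U)ᴴ = 1 - Uᴴ * U := by simp [Matrix.conjTranspose_mul]
  have q2 : (1 - U * Uᴴ)ᴴ = 1 - U * Uᴴ := by simp [Matrix.conjTranspose_mul]
  have ht : ∀ w, ((1 - Uᴴ * U) * wd a w).trace = ((1 - U * Uᴴ) * wd b w).trace := by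
    intro w
    have h1 := h w
    rw [tw, tw] at h1
    rw [sub_mul, sub_mul, Matrix.trace_sub, Matrix.trace_sub, Matrix.one_mul, Matrix.one_mul, h1,
      Matrix.mul_assoc, inter_wd a b U u1 u2, ← Matrix.mul_assoc, Matrix.trace_mul_comm,
      ← Matrix.mul_assoc]
  obtain ⟨S, s0, s1, s2, s3, s4⟩ := exists_S a b (1 - Uᴴ * U) (1 - U * Uᴴ) p1 p2 q1 q2 ht
    (by rw [sub_mul, mul_sub, ka]; simp) (by rw [sub_mul, mul_sub, ka']; simp)
    (by rw [sub_mul, mul_sub, kb]; simp) (by rw [sub_mul, mul_sub, kb']; simp) hP0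
  obtain ⟨V, v0, v1, v2, v3, v4, v5⟩ := exists_U' a b (1 - Uᴴ * U) (1 - U * Uᴴ) S p2 s0 s1 s2 s3 s4
  have z1 : Uᴴ * V = 0 := by
    rw [← v5, ← Matrix.mul_assoc, mul_sub, ← Matrix.mul_assoc, u0', Matrix.mul_one, sub_self,
      Matrix.zero_mul]
  have z2 : V * Uᴴ = 0 := by
    rw [← v4, Matrix.mul_assoc, sub_mul, u0', Matrix.one_mul, sub_self, Matrix.mul_zero]
  have z3 : Vᴴ * U = 0 := by
    have := congrArg Matrix.conjTranspose z1
    simpa [Matrix.conjTranspose_mul] using this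
  have z4 : U * Vᴴ = 0 := by
    have := congrArg Matrix.conjTranspose z2
    simpa [Matrix.conjTranspose_mul] using this
  have hmem : U + V ∈ A := by
    refine ⟨?_, ?_, ?_⟩
    · rw [Matrix.conjTranspose_add]
      simp only [add_mul, mul_add, z2, z4, u0, v1, Matrix.mul_assoc U, Matrix.mul_assoc V, z1, z3]
      simp
    · rw [add_mul, mul_add, u1, v2]
    · rw [add_mul, mul_add, u2, v3]
  apply hmax _ ⟨U + V, hmem, rfl⟩
  show R U < R (U + V)
  refine lt_of_le_of_ne ?_ ?_
  · rintro _ ⟨X, rfl⟩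
    refine ⟨Uᴴ * U * X, ?_⟩
    show (U + V) * (Uᴴ * U * X) = U * X
    rw [add_mul, ← Matrix.mul_assoc, ← Matrix.mul_assoc, u0, ← Matrix.mul_assoc,
      ← Matrix.mul_assoc, z2]; simp
  · intro he
    have : V ∈ R (U + V) := by
      refine ⟨Vᴴ * V, ?_⟩
      show (U + V) * (Vᴴ * V) = V
      rw [add_mul, ← Matrix.mul_assoc, ← Matrix.mul_assoc, z4, v1]; simp
    rw [← he] at this
    obtain ⟨X, hX⟩ := this
    have hX' : U * X = V := hX
    apply v0
    rw [← hX', ← u0, Matrix.mul_assoc, Matrix.mul_assoc, hX', z1, Matrix.mul_zero]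

end TS

/-- The 20 words `x; x², xy; x³, x²y; x⁴, x³y, x²y², xyxy; x³y²; (x²y)², x²y²xy, y²x²yx;
x³y²xy; x³y²x²y, x³y³xy, y³x³yx; x³yx²yxy, x²y²xyx²y; x³y³x²y²` form a test set for
`M₄(ℂ)`: two `4 × 4` complex matrices `a`, `b` are unitarily similar if and only if
`tr(w(a, a*)) = tr(w(b, b*))` for each of these words `w`. -/
theorem test_set_M4C (a b : Matrix (Fin 4) (Fin 4) ℂ) :
    (∃ u : Matrix (Fin 4) (Fin 4) ℂ, u * uᴴ = 1 ∧ b = u * a * uᴴ) ↔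
      ∀ i : Fin 20, wordTraces a i = wordTraces b i := by
  constructor
  · rintro ⟨u, hu, rfl⟩ i
    rw [TS.wordTraces_eq, TS.wordTraces_eq, TS.tw_conj a u hu]
  · intro h
    exact TS.specht a b (TS.all_eq' a b h)
end
end

section
/- The algebra C_{5,2} is generated, as a unital K-algebra, by its homogeneous elements of total degree at most 15; the same holds for the algebra C_{5,2}(0) of invariants of pairs of trace-zero 5×5 matrices. -/
open MvPolynomial Matrix

noncomputable section

/-- Index type for the entries of a pair of generic `n × n` matrices:
`Sum.inl (i,j)` indexes the `(i,j)` entry of `x`, `Sum.inr (i,j)` that of `y`. -/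
abbrev MatVar (n : ℕ) := (Fin n × Fin n) ⊕ (Fin n × Fin n)

/-- The substitution sending the variables to the entries of the pair `(A, B)`. -/
def pairSub {K : Type*} [CommSemiring K] {n : ℕ} (A B : Matrix (Fin n) (Fin n) K) :
    MatVar n → K
  | Sum.inl ij => A ij.1 ij.2
  | Sum.inr ij => B ij.1 ij.2

/-- A polynomial function on pairs of `n × n` matrices is `GLₙ`-invariant (for the action
by simultaneous conjugation). -/
def IsMatInvariant {K : Type*} [Field K] {n : ℕ} (f : MvPolynomial (MatVar n) K) : Prop :=
  ∀ (a : GL (Fin n) K) (A B : Matrix (Fin n) (Fin n) K),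
    MvPolynomial.eval
        (pairSub ((a : Matrix (Fin n) (Fin n) K) * A * ((a⁻¹ : GL (Fin n) K) : Matrix (Fin n) (Fin n) K))
          ((a : Matrix (Fin n) (Fin n) K) * B * ((a⁻¹ : GL (Fin n) K) : Matrix (Fin n) (Fin n) K))) f =
      MvPolynomial.eval (pairSub A B) f

/-- The weight giving the bidegree: entries of `x` have weight `(1,0)`,
those of `y` have weight `(0,1)`. -/
def bideg (n : ℕ) : MatVar n → ℕ × ℕ
  | Sum.inl _ => (1, 0)
  | Sum.inr _ => (0, 1)

/-- The bigraded component of bidegree `(p, q)` of the pure trace algebra `C_{n,2}`. -/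
def pureComponent (K : Type*) [Field K] (n p q : ℕ) : Set (MvPolynomial (MatVar n) K) :=
  {f | IsMatInvariant f ∧ f.IsWeightedHomogeneous (bideg n) (p, q)}

/-- `dim_K C_{n,2}^{(p,q)}`. -/
def pureDim (K : Type*) [Field K] (n p q : ℕ) : ℕ :=
  Set.finrank K (pureComponent K n p q)

/-- The bigraded Poincaré series `P(C_{n,2}; s, t)`, with `s` the variable `X 0` and
`t` the variable `X 1`. -/
def purePS2 (K : Type*) [Field K] (n : ℕ) : MvPowerSeries (Fin 2) ℚ :=
  fun d => (pureDim K n (d 0) (d 1) : ℚ)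

/-- abbreviation for the power series variable `s`. -/
def ps : MvPowerSeries (Fin 2) ℚ := MvPowerSeries.X 0

/-- abbreviation for the power series variable `t`. -/
def pt : MvPowerSeries (Fin 2) ℚ := MvPowerSeries.X 1


/-- The pure trace algebra `C_{n,2}`: the subalgebra of `GLₙ`-invariant polynomial
functions on pairs of `n × n` matrices. -/
def pureAlg (K : Type*) [Field K] (n : ℕ) : Subalgebra K (MvPolynomial (MatVar n) K) where
  carrier := {f | IsMatInvariant f}
  mul_mem' := fun hf hg a A B => by
    simp only [_root_.map_mul]
    rw [hf a A B, hg a A B]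
  add_mem' := fun hf hg a A B => by
    simp only [_root_.map_add]
    rw [hf a A B, hg a A B]
  algebraMap_mem' := fun c a A B => by
    simp [MvPolynomial.algebraMap_eq]
/-- The space `M_n(0)` of trace-zero `n × n` matrices. -/
def sl (K : Type*) [Field K] (n : ℕ) : Submodule K (Matrix (Fin n) (Fin n) K) :=
  LinearMap.ker (Matrix.traceLinearMap (Fin n) K K)

/-- Conjugation of a trace-zero matrix by an invertible matrix. -/
def glConj {K : Type*} [Field K] {n : ℕ} (a : GL (Fin n) K) (A : sl K n) : sl K n :=
  ⟨(a : Matrix (Fin n) (Fin n) K) * A.1 * ((a⁻¹ : GL (Fin n) K) : Matrix (Fin n) (Fin n) K), by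
    have hA : Matrix.trace A.1 = 0 := A.2
    have h1 : ((a⁻¹ : GL (Fin n) K) : Matrix (Fin n) (Fin n) K) * (a : Matrix (Fin n) (Fin n) K) = 1 :=
      a.inv_mul
    have h : Matrix.trace ((a : Matrix (Fin n) (Fin n) K) * A.1 *
        ((a⁻¹ : GL (Fin n) K) : Matrix (Fin n) (Fin n) K)) = Matrix.trace A.1 := by
      rw [Matrix.trace_mul_cycle, h1, one_mul]
    show _ ∈ sl K n
    simp only [sl, LinearMap.mem_ker, Matrix.traceLinearMap_apply]
    rw [h, hA]⟩

/-- A function on pairs of trace-zero matrices is a polynomial function if it is the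
restriction of a polynomial in the matrix entries. -/
def IsPolyFun0 {K : Type*} [Field K] {n : ℕ} (f : sl K n × sl K n → K) : Prop :=
  ∃ F : MvPolynomial (MatVar n) K, ∀ v : sl K n × sl K n,
    f v = MvPolynomial.eval (pairSub (v.1 : Matrix (Fin n) (Fin n) K)
      (v.2 : Matrix (Fin n) (Fin n) K)) F

/-- The algebra `C_{n,2}(0)` of `GLₙ`-invariant polynomial functions on pairs of
trace-zero `n × n` matrices, realized as a subalgebra of the algebra of `K`-valued
functions. -/
def pureAlg0 (K : Type*) [Field K] (n : ℕ) : Subalgebra K (sl K n × sl K n → K) where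
  carrier := {f | IsPolyFun0 f ∧ ∀ (a : GL (Fin n) K) (v : sl K n × sl K n),
    f (glConj a v.1, glConj a v.2) = f v}
  mul_mem' := by
    rintro f g ⟨⟨F, hF⟩, hfi⟩ ⟨⟨G, hG⟩, hgi⟩
    exact ⟨⟨F * G, fun v => by simp [Pi.mul_apply, hF v, hG v]⟩,
      fun a v => by simp only [Pi.mul_apply, hfi a v, hgi a v]⟩
  add_mem' := by
    rintro f g ⟨⟨F, hF⟩, hfi⟩ ⟨⟨G, hG⟩, hgi⟩
    exact ⟨⟨F + G, fun v => by simp [Pi.add_apply, hF v, hG v]⟩,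
      fun a v => by simp only [Pi.add_apply, hfi a v, hgi a v]⟩
  algebraMap_mem' := fun c =>
    ⟨⟨MvPolynomial.C c, fun v => by simp⟩, fun a v => rfl⟩

/-- A function on pairs of trace-zero matrices is bihomogeneous of bidegree `(p, q)`. -/
def BiHomogFun0 {K : Type*} [Field K] {n : ℕ} (f : sl K n × sl K n → K) (p q : ℕ) : Prop :=
  ∀ (c d : K) (v : sl K n × sl K n), f (c • v.1, d • v.2) = c ^ p * d ^ q * f v

/-- A function on pairs of trace-zero matrices is homogeneous of total degree `d`. -/
def HomogFun0 {K : Type*} [Field K] {n : ℕ} (f : sl K n × sl K n → K) (d : ℕ) : Prop :=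
  ∀ (c : K) (v : sl K n × sl K n), f (c • v.1, c • v.2) = c ^ d * f v

namespace CK

inductive Tr (α : Type) : Type where
  | o : Tr α
  | n : Nat → α → Tr α → Tr α → Tr α

/-- conditional -/
def bsel {α : Type} (b : Bool) (t e : α) : α := Bool.rec (motive := fun _ => α) e t b

/-- force a numeral -/
def fN {β : Type} (n : Nat) (k : Nat → β) : β :=
  Nat.rec (motive := fun _ => β) (k (nat_lit 0)) (fun m _ => k (Nat.succ m)) n

/-- force a list -/
def fl {β : Type} (l : List Nat) : (List Nat → β) → β :=
  List.rec (motive := fun _ => (List Nat → β) → β) (fun k => k [])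
    (fun h _ ih k => fN h (fun h' => ih (fun t' => k (h' :: t')))) l

/-- force a tree -/
def fT {α β : Type} (t : Tr α) (k : Tr α → β) : β :=
  Tr.rec (motive := fun _ => β) (k Tr.o) (fun a b l r _ _ => k (Tr.n a b l r)) t

def ax3 (a : Nat) (r : List Nat) (s : Nat) : List Nat :=
  Nat.rec (motive := fun _ => List Nat) r
    (fun _ _ => Nat.add (Nat.mul (Nat.div a (nat_lit 8)) (nat_lit 8)) s :: r) s

def axm (c a : Nat) : Nat :=
  Nat.add (Nat.mul (Nat.div a (nat_lit 8)) (nat_lit 8))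
    (Nat.mod (Nat.mul c (Nat.mod a (nat_lit 8))) (nat_lit 7))

def ax2 (c a : Nat) (ihp : List Nat → List Nat) (b : Nat) (q' ihq : List Nat) (t : Bool) :
    List Nat :=
  Bool.rec (motive := fun _ => List Nat) (b :: ihq)
    (ax3 a (ihp q') (Nat.mod (Nat.add (Nat.mul c (Nat.mod a (nat_lit 8)))
      (Nat.mod b (nat_lit 8))) (nat_lit 7))) t

def ax1 (c a : Nat) (ihp : List Nat → List Nat) (b : Nat) (q' ihq : List Nat) : List Nat :=
  Bool.rec (motive := fun _ => List Nat) (axm c a :: ihp (b :: q'))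
    (ax2 c a ihp b q' ihq (Nat.beq (Nat.div a (nat_lit 8)) (Nat.div b (nat_lit 8))))
    (Nat.ble (Nat.div a (nat_lit 8)) (Nat.div b (nat_lit 8)))

/-- `c * p + q` -/
def axpy (c : Nat) (p : List Nat) : List Nat → List Nat :=
  List.rec (motive := fun _ => List Nat → List Nat) (fun q => q)
    (fun a _ ihp q => List.rec (motive := fun _ => List Nat)
      (axm c a :: ihp []) (fun b q' ihq => ax1 c a ihp b q' ihq) q) p

def look {α : Type} (t : Tr α) (d : α) (k : Nat) : Nat → α :=
  Tr.rec (motive := fun _ => Nat → α) (fun _ => d)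
    (fun k' P _ _ ihl ihr s => Bool.rec (motive := fun _ => α)
      (Nat.rec (motive := fun _ => Nat → α) ihl (fun _ _ => ihr)
        (Nat.mod s (nat_lit 2)) (Nat.div s (nat_lit 2)))
      P (Nat.beq k k')) t

/-- insertion (replacing an old value) -/
def insT {α β : Type} (k : Nat) (P : α) (t : Tr α) : Nat → (Tr α → β) → β :=
  Tr.rec (motive := fun _ => Nat → (Tr α → β) → β) (fun _ kk => kk (Tr.n k P Tr.o Tr.o))
    (fun k' P' l r ihl ihr s kk =>
      Bool.rec (motive := fun _ => β)
        (Bool.rec (motive := fun _ => β)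
          (ihr (Nat.div s (nat_lit 2)) (fun r' => kk (Tr.n k' P' l r')))
          (ihl (Nat.div s (nat_lit 2)) (fun l' => kk (Tr.n k' P' l' r)))
          (Nat.beq (Nat.mod s (nat_lit 2)) (nat_lit 0)))
        (kk (Tr.n k P l r)) (Nat.beq k k')) t

/-- normal form of a word w.r.t. a block tree -/
def nf (t : Tr (List Nat)) (k : Nat) : List Nat :=
  look t [Nat.add (Nat.mul k (nat_lit 8)) (nat_lit 1)] k k

def red (T : Tr (List Nat)) (v : List Nat) : List Nat :=
  List.rec (motive := fun _ => List Nat) []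
    (fun e _ ih => axpy (Nat.mod e (nat_lit 8)) (nf T (Nat.div e (nat_lit 8))) ih) v

def mulr (T : Tr (List Nat)) (x : Nat) (v : List Nat) : List Nat :=
  List.rec (motive := fun _ => List Nat) []
    (fun e _ ih => axpy (Nat.mod e (nat_lit 8))
      (nf T (Nat.add (Nat.mul (nat_lit 2) (Nat.div e (nat_lit 8))) x)) ih) v

/-- the block tree of index `i` -/
def blk (T : Tr (Tr (List Nat))) (i : Nat) : Tr (List Nat) := look T Tr.o i i

/-- multiply `v`, living in block `i`, by a word, and pass the result on -/
def mulw {β : Type} (T : Tr (Tr (List Nat))) (fuel : Nat) :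
    Nat → Nat → List Nat → (Nat → List Nat → β) → β :=
  Nat.rec (motive := fun _ => Nat → Nat → List Nat → (Nat → List Nat → β) → β)
    (fun _ i v k => k i v)
    (fun _ ih a i v k => bsel (Nat.ble a (nat_lit 1)) (k i v)
      (fN (Nat.add i (Nat.add (nat_lit 16) (Nat.mod a (nat_lit 2)))) (fun i' =>
        fT (blk T i') (fun t => fl (mulr t (Nat.succ (Nat.mod a (nat_lit 2))) v)
          (fun v' => ih (Nat.div a (nat_lit 2)) i' v' k))))) fuel

def arr (T : Tr (Tr (List Nat))) (a b : Nat) (n : Nat) : Nat → Nat → List Nat → List Nat :=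
  Nat.rec (motive := fun _ => Nat → Nat → List Nat → List Nat) (fun _ _ v => v)
    (fun m ih j i v =>
      bsel (Nat.beq j (nat_lit 0)) (mulw T (nat_lit 12) a i v (fun i' v' => ih j i' v'))
        (bsel (Nat.ble j m)
          (axpy (nat_lit 1) (mulw T (nat_lit 12) a i v (fun i' v' => ih j i' v'))
            (mulw T (nat_lit 12) b i v (fun i' v' => ih (Nat.pred j) i' v')))
          (mulw T (nat_lit 12) b i v (fun i' v' => ih (Nat.pred j) i' v')))) n

def row (T : Tr (Tr (List Nat))) (r : Nat) : List Nat :=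
  bsel (Nat.ble (r / 262144 % 4096) 1) [] (bsel (Nat.ble (r / 1073741824 % 4096) 1) []
    (arr T (r / 262144 % 4096) (r / 1073741824 % 4096) (nat_lit 5) (r % 4) (r / 4398046511104)
      [(r / 4 % 65536) * 8 + 1]))

def norm7 (l : List Nat) : List Nat :=
  List.rec (motive := fun _ => List Nat) []
    (fun e _ _ => axpy ((6 * (Nat.mod e 8) ^ 5) % 7) l []) l

/-- echelon insertion -/
def insE {β : Type} (F : List (List Nat)) : List Nat → (List (List Nat) → β) → β :=
  List.rec (motive := fun _ => List Nat → (List (List Nat) → β) → β)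
    (fun r k => List.rec (motive := fun _ => β) (k []) (fun _ _ _ =>
      fl (norm7 r) (fun r' => k [r'])) r)
    (fun p F' ih r k => List.rec (motive := fun _ => β) (k (p :: F'))
      (fun e _ _ => List.rec (motive := fun _ => β) (k (p :: F'))
        (fun h _ _ => bsel (Nat.ble (Nat.div e (nat_lit 8)) (Nat.div h (nat_lit 8)))
          (bsel (Nat.beq (Nat.div e (nat_lit 8)) (Nat.div h (nat_lit 8)))
            (fl (axpy (Nat.mod e (nat_lit 8)) p r) (fun r' => ih r' (fun F'' => k (p :: F''))))
            (ih r (fun F'' => k (p :: F''))))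
          (fl (norm7 r) (fun r' => k (r' :: p :: F')))) p) r) F

/-- compute the echelon form of a block -/
def ech {β : Type} (T : Tr (Tr (List Nat))) (R : List Nat) :
    List (List Nat) → (List (List Nat) → β) → β :=
  List.rec (motive := fun _ => List (List Nat) → (List (List Nat) → β) → β)
    (fun F k => k F)
    (fun r _ ih F k => fl (row T r) (fun v => insE F v (fun F' => ih F' k))) R

/-- back substitution -/
def bs {β : Type} (F : List (List Nat)) : (Tr (List Nat) → β) → β :=
  List.rec (motive := fun _ => (Tr (List Nat) → β) → β) (fun k => k Tr.o)
    (fun p _ ih k => ih (fun T' => List.rec (motive := fun _ => β) (k T')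
      (fun e P _ => bsel (Nat.beq (Nat.mod e (nat_lit 8)) (nat_lit 6))
        (fl (red T' P) (fun P' => fN (Nat.div e (nat_lit 8)) (fun w => insT w P' T' w k)))
        (k T')) p)) F

def run {β : Type} (R : List (Nat × List Nat)) :
    Tr (Tr (List Nat)) → (Tr (Tr (List Nat)) → β) → β :=
  List.rec (motive := fun _ => Tr (Tr (List Nat)) → (Tr (Tr (List Nat)) → β) → β)
    (fun T k => k T)
    (fun b _ ih T k => Prod.rec (motive := fun _ => β) (fun i R' =>
      ech T R' [] (fun F => bs F (fun t => insT i t T i (fun T' => ih T' k)))) b) R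

def allB (l : List Nat) (k : Nat) : Bool :=
  List.rec (motive := fun _ => Bool) true
    (fun e _ ih => bsel (Nat.ble k (e / 8)) false
      (bsel (Nat.beq (Nat.log2 (k + 1)) (Nat.log2 (e / 8 + 1))) ih false)) l

def okT (T : Tr (List Nat)) : Bool :=
  Tr.rec (motive := fun _ => Bool) true
    (fun k P _ _ ihl ihr => bsel (allB P k) (bsel ihl ihr false) false) T

def okTT (T : Tr (Tr (List Nat))) : Bool :=
  Tr.rec (motive := fun _ => Bool) true
    (fun _ t _ _ ihl ihr => bsel (okT t) (bsel ihl ihr false) false) T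

/-- is `k` absent from the tree (as detected by `look`) -/
def absent (t : Tr (List Nat)) (k : Nat) : Nat → Bool :=
  Tr.rec (motive := fun _ => Nat → Bool) (fun _ => true)
    (fun k' _ _ _ ihl ihr s => bsel (Nat.beq k k') false
      (bsel (Nat.beq (s % 2) 0) (ihl (s / 2)) (ihr (s / 2)))) t

/-- every extension of the word `k` (in block `i`) by `m` letters meets the tree -/
def dead (T : Tr (Tr (List Nat))) (m : Nat) : Nat → Nat → Bool :=
  Nat.rec (motive := fun _ => Nat → Nat → Bool)
    (fun k i => bsel (absent (blk T i) k k) false true)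
    (fun _ ih k i => bsel (absent (blk T i) k k)
      (bsel (ih (2 * k + 1) (i + 16)) (ih (2 * k + 2) (i + 17)) false) true) m

def rels : List (Nat × List Nat) := [(80, [2148007936]),
  (81, [3221749761]),
  (82, [3221749762]),
  (83, [2148270082]),
  (84, [2148270081]),
  (85, [2148270080]),
  (97, [74768938696712]),
  (98, [7516717057, 74770012438537]),
  (99, [70370892447750]),
  (100, [70370892447749, 4295753729]),
  (101, [70370892447748]),
  (113, [145137682874384]),
  (114, [149535729385496, 13959168001, 145138756616209]),
  (115, [74774307405833, 16106651649, 140739636625422, 145138756616214, 4295753730]),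
  (116, [140739636625421, 70373039931397, 145137683136534, 8590721025, 7516717058]),
  (117, [140739636625420, 145137683136533, 10738204673]),
  (118, [145137683136532]),
  (129, [215506427052064]),
  (130, [219904473563184, 219904473563176, 26844069889, 215507500793889]),
  (131, [31139037185, 28991553537, 224302520074296, 145143051583505, 74780749856777, 211108380803102, 2149056514, 215507500793894, 219905547305009]),
  (132, [211108380803101, 140741784109069, 215506427314214, 33286520833, 74782897340425, 215506427314222, 70377334898693, 70376260894726]),
  (133, [211108380803100, 215506427314221, 215506427314213, 70379482382341, 145139830620181, 19328139265, 21475622913, 3222798338, 219904473825334]),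
  (134, [215506427314212, 215506427314220, 219904473825333, 23623106561]),
  (135, [219904473825332]),
  (145, [285875171229760]),
  (146, [290273217740880, 290273217740896, 290273217740872, 52613873665]),
  (147, [62277550081, 294671264251992, 61203808257, 70397735731205, 145149494034449, 215511795761185, 281477124980798, 290274291482705, 290274291482721, 285876244971590, 56908840961]),
  (148, [281477124980797, 2149056513, 211110528286749, 299069310763128, 2148794369, 145151641518097, 285875171491910, 65498775553, 140746079076365, 285875171491918, 63351291905, 74797929725961, 219909842272305, 140745005072398, 13959168002, 285875171491934, 74795782242313, 294672337993833, 149547540545561]),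
  (149, [281477124980796, 285875171491917, 285875171491909, 140748226560013, 215508574797861, 285875171491933, 3222798337, 74800077209609, 3222536193, 215508574797869, 70388072316933, 70390219800581, 149549688029209, 290273218003046, 290273218003030, 42950459393, 10738204674, 38655492097, 290273218003054]),
  (150, [285875171491908, 285875171491932, 285875171491916, 290273218003045, 290273218003029, 145146273071125, 70392367284229, 290273218003053, 47245426689, 45097943041, 40802975745]),
  (151, [290273218003052, 290273218003044, 290273218003028, 49392910337]),
  (152, [294671264514164]),
  (162, [360641961918624, 360641961918608, 360641961918600]),
  (163, [365040008429736, 365040008429720, 365040008429768, 365040008429744, 121333350401, 113817157633, 285880539938881, 360643035660433, 360643035660449, 215518238212129, 360643035660481, 112743415809]),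
  (164, [369438054940856, 281479272464445, 125628317697, 130997026817, 215520385695777, 123480834049, 145166673903637, 211114823254045, 145166673903633, 356243915669638, 290278586450001, 356243915669646, 211113749250078, 129923284993, 70382703345670, 74827994497033, 365041082171561, 356243915669662, 290278586450017, 145164526419985, 117038383105, 74823699529737, 365041082171593, 365041082171569]),
  (165, [356243915669637, 356243915669645, 356243915669661, 211116970737693, 285877318975557, 5370281985, 145168821387281, 285877318975565, 285877318975581, 140758963978253, 134218252289, 140756816494605, 6443761665, 360641962180774, 219918432206889, 219918432206897, 5370281986, 360641962180758, 360641962180806, 215512869765165, 132070768641, 70411694637061, 70407399669765, 70379482382342, 215511795761198, 74832289464329, 74830141980681, 119185866753, 360641962180782, 6443761666, 360641962180814, 77310197761, 149564720414745, 149562572931097]),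
  (166, [356243915669636, 356243915669644, 356243915669660, 360641962180773, 360641962180805, 360641962180757, 215515017248805, 140761111461901, 215515017248813, 360641962180813, 360641962180781, 145157010489365, 70415989604357, 70413842120709, 70409547153413, 290275365486693, 149566867898393, 290275365486701, 90195099649, 365040008691926, 94490066945, 81605165057, 88047616001, 365040008691942]),
  (167, [360641962180756, 360641962180812, 360641962180804, 360641962180780, 360641962180772, 365040008691925, 145159157973013, 70418137088005, 92342583297, 219913063759925, 96637550593, 98785034241]),
  (168, [365040008691940, 365040008691924, 365040008691892]),
  (178, [431010706096416, 431010706096448]),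
  (179, [435408752607528, 435408752607560, 435408752607568, 435408752607624, 435408752607536, 215822630913, 431011779838241, 431011779838225, 435408752607632, 224412565505]),
  (180, [439806799118648, 228707532801, 251256111105, 253403594753, 439806799118680, 246961143809, 285889129873473, 281482493427774, 215535418081313, 250182369281, 360647330627729, 426612659847438, 435409826349353, 145196738674705, 426612659847454, 215533270597665, 140751447523342, 70485782560773, 258772303873, 360647330627745, 435409826349393, 290285028900937, 220117598209, 26844069890, 285877318975582, 431011779838350, 226560049153, 74879534104585]),
  (181, [281485714915389, 426612659847437, 426612659847453, 70374114459653, 70375187939333, 356246063153285, 215537565564961, 356246063153309, 356246063153293, 211127708155933, 70502962429957, 211125560672285, 290287176384585, 431010706358566, 290287176384593, 267362238465, 140780438814733, 140776143847437, 254477336577, 365045377138857, 431010706358550, 12886212609, 264141012993, 431010706358598, 140748226560014, 145201033642001, 431010706358662, 285881613942877, 70374114459654, 9665249281, 290287176384609, 145198886158353, 431010706358670, 435409826349394, 70375187939334, 285880539938910, 263067271169, 431010706358574, 70446054375429, 219933464592433, 219931317108777, 230855016449, 439807872860585, 219931317108785, 260919787521, 74881681588233, 74896713973769, 21475622914]),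
  (182, [426612659847452, 426612659847436, 431010706358597, 431010706358549, 431010706358565, 431010706358661, 211129855639581, 285883761426501, 285883761426509, 431010706358669, 431010706358605, 431010706358573, 285883761426525, 360644109664421, 140782586298381, 215525754667045, 140778291331085, 140784733782029, 219935612076081, 215523607183397, 74885976555529, 15033696257, 360644109664453, 435408752869718, 360644109664429, 269509722113, 70448201859077, 265214754817, 74898861457417, 294685222895721, 74901008941065, 70458939277317, 70463234244613, 215525754667053, 360644109664461, 31139037186, 74772160970761, 70450349342725, 11812732929, 290278586450018, 149596932669465, 2150891522, 180389412865, 439807872860586, 435408752869734, 435408752869806, 145146273071126, 163209543681]),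
  (183, [431010706358668, 431010706358604, 431010706358596, 431010706358572, 431010706358564, 431010706358548, 435408752869717, 435408752869781, 215527902150693, 140786881265677, 215527902150701, 290281807937637, 435408752869805, 70461086760965, 145176337842197, 435408752869797, 290281807937621, 145182780293141, 70465381728261, 70467529211909, 145180632809493, 290281807937645, 193274314753, 197569282049, 191126831105, 23623106562, 165357027329, 294676632961138]),
  (184, [435408752869804, 435408752869796, 435408752869780, 435408752869732, 435408752869684, 435408752869716, 145184927776789, 195421798401, 219925948661813, 199716765697]),
  (185, [439806799380948, 439806799380916]),
  (194, [501379450274368]),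
  (195, [505777496785480, 505777496785544, 505777496785488, 505777496785696, 505777496785552, 501380524016193, 430570995713]),
  (196, [510175543296848, 510175543296600, 502511697921, 506806665217, 70615705321477, 285904162259009, 70598525452293, 431016074805521, 215565482852385, 215561187885089, 505778570527273, 285902014775361, 211120191701022, 431016074805537, 505778570527305, 510175543296808, 439160930305, 360653773078665, 466004475905, 490700537857, 499290472449, 464930734081, 501380524016270, 145248278282257]),
  (197, [496981404025373, 140742858637325, 426614807331101, 285906309742657, 426614807331085, 281494304849981, 281496452333629, 140871706607629, 360655920562313, 211144888025117, 70623221514245, 211149182992413, 435414121316649, 501379450536486, 360655920562321, 140869559123981, 501379450536518, 215569777819681, 534723952641, 70378409426949, 211116970737694, 215567630336033, 140742858637326, 360655920562337, 505778570527314, 533650210817, 140743932117006, 501379450536590, 501379450536494, 70631811448837, 140814798553101, 435414121316745, 501379450536718, 290300061286473, 215518238212134, 145252573249553, 494995505153, 525060276225, 145265458151441, 520765308929, 469225701377, 70390219800582, 501437956097, 12886212610, 215518238212142, 9665249282, 290302208770145, 510176617038633, 74986908286985]),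
  (198, [496981404025372, 281498599817277, 501379450536485, 501379450536517, 356252505604229, 356252505604237, 501379450536493, 501379450536525, 501379450536717, 501379450536589, 431012853842213, 211151330476061, 211153477959709, 211147035508765, 285894498844741, 356252505604253, 145254720733201, 290304356253777, 285892351361093, 365053967073449, 431012853842221, 140816946036749, 290304356253793, 70633958932485, 431012853842317, 505777497047638, 145267605635089, 140827683454989, 285894498844765, 140831978422285, 431012853842245, 510027890689, 431012853842253, 140741785157646, 537945178113, 30066081793, 285894498844749, 365053967073481, 505777497047830, 285892351361117, 70399883214854, 75021268025353, 505777497047702, 219965676847145, 529355243521, 70549133590533, 505777497047718, 74989055770633, 505777497047654, 439812167827881, 505777497047726, 75027710476297, 352188104705, 215515017248814, 505777497047854]),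
  (199, [501379450536588, 501379450536484, 501379450536524, 501379450536516, 501379450536492, 505777497047701, 505777497047637, 505777497047829, 211155625443357, 285896646328389, 285896646328397, 360650552115365, 285896646328413, 505777497047717, 360650552115349, 140829830938637, 140834125905933, 140836273389581, 505777497047725, 32213565441, 215549376987173, 215545082019877, 75023415509001, 540092661761, 215551524470821, 505777497047845, 360650552115397, 319975849985, 75036300410889, 294702402764905, 360650552115373, 70566313459717, 70562018492421, 215545082019885, 215549376987181, 70559871008773, 505777497047853, 435410900353453, 149661357178905, 70392367284230, 510175543558998, 290292545355877, 386547843073, 335008235521, 330713268225, 354335588353, 382252875777, 15033696258, 514574663549802]),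
  (200, [505777497047636, 505777497047852, 505777497047844, 505777497047604, 505777497047652, 505777497047700, 505777497047716, 505777497047724, 215553671954469, 215553671954477, 510175543558997, 70564165976069, 290294692839509, 290294692839525, 70568460943365, 145227877449749, 365048598626517, 145234319900693, 510175543559013, 388695326721, 332860751873, 390842810369, 399432744961, 290294692839533]),
  (201, [510175543558996, 510175543559012, 510175543558964, 510175543558868, 510175543558836, 401580228609, 219951718465589]),
  (202, [514573590070196]),
  (211, [576146240963872, 576146240963720, 576146240963728]),
  (212, [281540475486269, 1013612806145, 1005022871553, 211221123432477, 211236155818013, 285929932062785, 932008427521, 140987670724621, 281488935878718, 501384818983489, 285934227030081, 877247594497, 431022517256481, 980326809601, 215617022459937]),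
  (213, [141005924335629, 496983551509021, 211111602815005, 281511484719165, 70877698326533, 1056562479105, 281485714915390, 431024664740113, 1069447380993, 505782865494569, 140747153604621, 285938521997377, 571748194714694, 431024664740129, 285936374513729, 1052267511809, 211112676294686, 571748194714766, 576147314705490, 211183542730781, 211111602815006, 505782865494601, 42951245825, 360668805464201, 1050120028161, 1040456351745, 285886982389830, 505782865494609, 215634202329121, 1015760289793, 360670952947905, 1049046286337, 140758963978254, 881542561793, 1014686547969, 70381630390278, 576147314705966]),
  (214, [571748194714693, 281520074653757, 426621249782029, 571748194714701, 571748194714765, 281522222137405, 501381598020133, 426621249782045, 356263243022469, 215623464910881, 435422711251241, 360673100431497, 360673100431505, 211185690214429, 501381598020141, 501381598020237, 141002703110157, 501381598020165, 211196427632669, 211200722599965, 215636349812769, 501381598020173, 576146241225814, 356263243022477, 435422711251273, 211110529335326, 435422711251337, 576146241225878, 501381598020365, 145390012203025, 140768627392526, 1058709962753, 290330126057545, 60130852865, 140913582800909, 576146241225894, 145396454653969, 356261095538845, 954557005825, 70695162478597, 576146241225902, 576146241225830, 435422711251281, 1074816090113, 576146241226286, 1044751319041, 1018981515265, 290336568508513,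 55835885569, 431016074805646, 435422711251345, 285883761426510, 576146241226278, 290330126057569, 576146241226030, 285883761426526]),
  (215, [571748194714764, 571748194714756, 571748194714700, 576146241225877, 576146241225813, 356265390506125, 356265390506117, 431019296293157, 576146241225893, 431019296293141, 211205017567261, 211198575116317, 211202870083613, 576146241225901, 285918121164869, 285913826197573, 145392159686673, 356265390506141, 576146241226285, 285920268648517, 431019296293189, 576146241226277, 145405044588561, 576146241226021, 70688720027653, 365071146942633, 285918121164877, 431019296293165, 140930762670093, 64425820161, 576146241226029, 365071146942665, 431019296293253, 140928615186445, 505779644531477, 285920268648541, 75229573939209, 1027571449857, 285913826197581, 140761111461902, 285918121164893, 365071146942673, 1061931188225, 594853756929, 576146241226309, 360659142049957, 580544287737174, 431019296293261, 75263933677577, 1059783704577, 220030101356593, 145166673903634, 764504965121, 435414121316754, 697932972033, 580544287737518]),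
  (216, [576146241225812, 576146241226020, 576146241225900, 576146241225892, 576146241225876, 576146241225828, 576146241226028, 285922416132165, 285922416132173, 140932910153741, 580544287737173, 360663437017237, 215596621627429, 75306883350537, 140937205121037, 360663437017253, 215603064078373, 435417342804309, 215600916594725, 70759586988037, 149798796132377, 149803091099673, 70757439504389, 70768176922629, 70701604929541, 360663437017285, 63352078337, 215603064078381, 215596621627437, 580544287737429, 215600916594733, 580544287737517, 360663437017293, 798864703489, 781684834305, 65498775554, 145159157973014]),
  (217, [580544287737044, 580544287737140, 580544287737012, 580544287737188, 580544287737172, 580544287737428, 580544287737444, 145330956664853, 70770324406277, 290320462643285, 290320462643301, 365061483528405, 145335251632149, 745177612289, 803159670785]),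
  (218, [584942334248628, 584942334248660, 584942334248372]),
  (227, [646514985142432]),
  (228, [650913031653544, 281589867610173, 650913031653680, 141229262635021, 501391261434401, 285985766637633, 1804960530433]),
  (229, [2113124433921, 71438191558661, 211360709869597, 211369299804189, 281480346992702, 281552286908477, 501393408918049, 281481420472382, 141262548631565, 70411695423493, 576151609672777, 642116938893582, 576151609672785, 211127708155934, 2011118960641, 431039697125665, 505789307945545]),
  (230, [642116938893453, 496989993959965, 571750342198413, 281554434392125, 71429601624069, 571750342198349, 571750342198341, 281565171810365, 505791455429193, 426629839716621, 505791455429161, 286005093990465, 646514985404566, 426629839716637, 215758756380705, 141266843598861, 211254409691165, 360698870235273, 211137371570206, 211269442076701, 646514985404582, 215765198831649, 646514985404590, 2105608241153, 71387725692933, 580549656183977, 2139967979521, 646514985404718]),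
  (231, [642116938893580, 646514985404565, 426634134683917, 281571614261309, 501388040471077, 646514985404581, 646514985404589, 356282570375301, 356286865342597, 501388040471109, 426634134683933, 576148388709461, 215760903864353, 356286865342605, 646514985404709, 435439891120425, 141057464205325, 2041183731713, 215773788766241, 211299506847773, 646514985404717, 435439891120457, 71447855235077, 356282570375309, 211129855639582, 431027886227749, 70963597934597, 650913031915862, 2157147848705, 290405287985233, 145664890109969, 2047626182657, 215535418081314]),
  (232, [646514985404564, 646514985404996, 646514985404708, 646514985404716, 356291160309893, 356291160309901, 211301654331421, 650913031915861, 431032181195029, 285965365805125, 211305949298717, 145675627528209, 431032181195045, 505786086982229, 2124935593985, 285969660772421, 285971808256069, 141126183682061, 141128331165709, 141136921100301, 505786086982293, 75828721877001, 220167540310057, 75710610276361, 220158950375473, 285969660772445, 215527902150694, 1348620517377]),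
  (233, [650913031915828, 650913031915732, 650913031915860, 650913031916116, 650913031915876, 141139068583949, 360689206821013, 215699700842533, 655311078427349, 360689206821029, 119186653185, 215703995809829, 71113921789957, 215699700842541, 215703995809837, 510184133493589, 1571958816769]),
  (234, [655311078427348, 655311078427316, 655311078427860, 655311078427956, 365087253332181, 145537115095061, 1501091856385]),
  (235, [659709124939188]),
  (244, [721281775833440]),
  (245, [141755396128781, 141779018448909, 501408441303585, 4003983785985]),
  (246, [642119086377101, 4234838278145, 496998583894557, 281623153868861, 576160199607369, 286127500558401, 4210142216193]),
  (247, [571756784649285, 716883729584421, 426655609520397, 281640333738045, 4316442656769, 426651314553101, 141332342112269, 4081293197313, 216033634287649]),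
  (248, [716883729584428, 721281776095573, 356334109982853, 501400925372965, 4246649438209, 211439093284893, 211497075343389, 576154831160469, 146214645923857]),
  (249, [721281776095636, 721281776095828, 286068445020229, 725679822607061, 431057950998821, 286072739987525, 2705830182913]),
  (250, [725679822607028, 725679822607060, 435455997509973, 3002182926337]),
  (251, [730077869120308])]

theorem bsel_true {α : Type} (t e : α) : bsel true t e = t := rfl
theorem bsel_false {α : Type} (t e : α) : bsel false t e = e := rfl

theorem fN_eq {β : Type} (n : Nat) (k : Nat → β) : fN n k = k n := by
  cases n <;> rfl

theorem fl_eq {β : Type} (l : List Nat) : ∀ k : List Nat → β, fl l k = k l := by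
  induction l with
  | nil => intro k; rfl
  | cons h t ih =>
    intro k
    show fN h (fun h' => fl t (fun t' => k (h' :: t'))) = _
    rw [fN_eq, ih]

theorem fT_eq {α β : Type} (t : Tr α) (k : Tr α → β) : fT t k = k t := by
  cases t <;> rfl

/-- decoding of words -/
def dec : ℕ → List Bool
  | 0 => []
  | k + 1 => dec (k / 2) ++ [k % 2 == 1]
decreasing_by omega

theorem dec_one (k : ℕ) : dec (2 * k + 1) = dec k ++ [false] := by
  rw [dec]
  have h1 : 2 * k / 2 = k := by omega
  have h2 : 2 * k % 2 = 0 := by omega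
  rw [h1, h2]; rfl

theorem dec_two (k : ℕ) : dec (2 * k + 2) = dec k ++ [true] := by
  rw [dec]
  have h1 : (2 * k + 1) / 2 = k := by omega
  have h2 : (2 * k + 1) % 2 = 1 := by omega
  rw [h1, h2]; rfl

section
variable {G : Type*} [AddCommGroup G]

/-- shift by a word -/
def sh (w : List Bool) (h : List Bool → G) : List Bool → G := fun q => h (w ++ q)

theorem sh_add (w : List Bool) (h g : List Bool → G) : sh w (h + g) = sh w h + sh w g := rfl
theorem sh_zero (w : List Bool) : sh w (0 : List Bool → G) = 0 := rfl
theorem sh_nsmul (w : List Bool) (n : ℕ) (h : List Bool → G) : sh w (n • h) = n • sh w h := rfl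
theorem sh_nil (h : List Bool → G) : sh [] h = h := rfl
theorem sh_sh (u w : List Bool) (h : List Bool → G) : sh w (sh u h) = sh (u ++ w) h := by
  funext q; simp [sh]

/-- the element attached to a word -/
def E (f : List Bool → G) (k : ℕ) : List Bool → G := sh (dec k) f

/-- evaluation of a coded linear combination -/
def ev (f : List Bool → G) : List Nat → (List Bool → G)
  | [] => 0
  | e :: l => (e % 8) • E f (e / 8) + ev f l

/-- sum over arrangements of `m - j` copies of `A` and `j` copies of `B` -/
def Arr (A B : List Bool) : ℕ → ℕ → (List Bool → G) → (List Bool → G)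
  | 0, _, h => h
  | m + 1, j, h =>
    if j = 0 then Arr A B m j (sh A h)
    else if j ≤ m then Arr A B m j (sh A h) + Arr A B m (j - 1) (sh B h)
    else Arr A B m (j - 1) (sh B h)

variable {f : List Bool → G} (h7 : ∀ w, (7 : ℕ) • f w = 0)

include h7 in
theorem E_mod (n k : ℕ) : (n % 7) • E f k = n • E f k := by
  conv_rhs => rw [← Nat.mod_add_div n 7, add_smul, mul_comm, mul_smul]
  have : (7 : ℕ) • E f k = 0 := by funext q; exact h7 _
  rw [this, smul_zero, add_zero]

include h7 in
theorem ev_axm (c a : ℕ) (r : List Nat) :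
    ev f (axm c a :: r) = c • ((a % 8) • E f (a / 8)) + ev f r := by
  have e : axm c a = a / 8 * 8 + (c * (a % 8)) % 7 := rfl
  have h1 : axm c a / 8 = a / 8 := by omega
  have h2 : axm c a % 8 = (c * (a % 8)) % 7 := by omega
  rw [ev, h1, h2, E_mod h7, mul_smul]

include h7 in
theorem ev_axpy (c : ℕ) (p : List Nat) : ∀ q, ev f (axpy c p q) = c • ev f p + ev f q := by
  induction p with
  | nil => intro q; show ev f q = _; simp [ev]
  | cons a p ihp =>
    intro q
    induction q with
    | nil =>
      show ev f (axm c a :: axpy c p []) = _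
      rw [ev_axm h7, ihp]
      simp only [ev, smul_add]; abel
    | cons b q ihq =>
      show ev f (ax1 c a (axpy c p) b q (axpy c (a :: p) q)) = _
      unfold ax1
      cases hle : Nat.ble (Nat.div a 8) (Nat.div b 8) with
      | false =>
        show ev f (axm c a :: axpy c p (b :: q)) = _
        rw [ev_axm h7, ihp]
        simp only [ev, smul_add]; abel
      | true =>
        show ev f (ax2 c a (axpy c p) b q (axpy c (a :: p) q) _) = _
        unfold ax2
        cases heq : Nat.beq (Nat.div a 8) (Nat.div b 8) with
        | false =>
          show ev f (b :: axpy c (a :: p) q) = _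
          rw [ev, ihq]
          simp only [ev, smul_add]; abel
        | true =>
          have hab : a / 8 = b / 8 := Nat.eq_of_beq_eq_true heq
          show ev f (ax3 a (axpy c p q) ((c * (a % 8) + b % 8) % 7)) = _
          have key : ((c * (a % 8) + b % 8) % 7) • E f (a / 8)
              = c • ((a % 8) • E f (a / 8)) + (b % 8) • E f (b / 8) := by
            rw [E_mod h7, add_smul, mul_smul, hab]
          have hlt : (c * (a % 8) + b % 8) % 7 < 7 := Nat.mod_lt _ (by norm_num)
          generalize (c * (a % 8) + b % 8) % 7 = s at key hlt
          cases s with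
          | zero =>
            show ev f (axpy c p q) = _
            rw [ihp]
            rw [zero_smul] at key
            simp only [ev, smul_add]
            calc c • ev f p + ev f q = 0 + (c • ev f p + ev f q) := by rw [zero_add]
              _ = _ := by rw [key]; abel
          | succ s =>
            show ev f ((a / 8 * 8 + (s + 1)) :: axpy c p q) = _
            have h1 : (a / 8 * 8 + (s + 1)) / 8 = a / 8 := by omega
            have h2 : (a / 8 * 8 + (s + 1)) % 8 = s + 1 := by omega
            rw [ev, h1, h2, key, ihp]
            simp only [ev, smul_add]; abel

/-- all nodes of a tree satisfy a property -/
def AllT {α : Type} (Q : ℕ → α → Prop) : Tr α → Prop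
  | Tr.o => True
  | Tr.n k P l r => Q k P ∧ AllT Q l ∧ AllT Q r

theorem look_prop {α : Type} (Q : ℕ → α → Prop) (d : α) (k : ℕ) (hd : Q k d) (t : Tr α) :
    ∀ s, AllT Q t → Q k (look t d k s) := by
  induction t with
  | o => intro s _; exact hd
  | n k' P l r ihl ihr =>
    intro s ht
    show Q k (Bool.rec (motive := fun _ => α)
      (Nat.rec (motive := fun _ => Nat → α) (look l d k) (fun _ _ => look r d k)
        (Nat.mod s 2) (Nat.div s 2)) P (Nat.beq k k'))
    cases hk : Nat.beq k k' with
    | true =>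
      have : k = k' := Nat.eq_of_beq_eq_true hk
      subst this; exact ht.1
    | false =>
      cases Nat.mod s 2 with
      | zero => exact ihl _ ht.2.1
      | succ _ => exact ihr _ ht.2.2

theorem insT_prop {α β : Type} (Q : ℕ → α → Prop) (k : ℕ) (P : α) (hP : Q k P) (t : Tr α) :
    ∀ (s : ℕ) (kk : Tr α → β), AllT Q t → ∃ t', AllT Q t' ∧ insT k P t s kk = kk t' := by
  induction t with
  | o => intro s kk _; exact ⟨Tr.n k P Tr.o Tr.o, ⟨hP, trivial, trivial⟩, rfl⟩
  | n k' P' l r ihl ihr =>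
    intro s kk ht
    show ∃ t', AllT Q t' ∧ Bool.rec (motive := fun _ => β)
        (Bool.rec (motive := fun _ => β)
          (insT k P r (Nat.div s 2) (fun r' => kk (Tr.n k' P' l r')))
          (insT k P l (Nat.div s 2) (fun l' => kk (Tr.n k' P' l' r)))
          (Nat.beq (Nat.mod s 2) 0))
        (kk (Tr.n k P l r)) (Nat.beq k k') = kk t'
    cases Nat.beq k k' with
    | true => exact ⟨Tr.n k P l r, ⟨hP, ht.2⟩, rfl⟩
    | false =>
      cases Nat.beq (Nat.mod s 2) 0 with
      | true =>
        obtain ⟨t', h1, h2⟩ := ihl (Nat.div s 2) (fun l' => kk (Tr.n k' P' l' r)) ht.2.1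
        exact ⟨Tr.n k' P' t' r, ⟨ht.1, h1, ht.2.2⟩, h2⟩
      | false =>
        obtain ⟨t', h1, h2⟩ := ihr (Nat.div s 2) (fun r' => kk (Tr.n k' P' l r')) ht.2.2
        exact ⟨Tr.n k' P' l t', ⟨ht.1, ht.2.1, h1⟩, h2⟩

/-- soundness of a block tree -/
def Snd (f : List Bool → G) (t : Tr (List Nat)) : Prop := AllT (fun k P => ev f P = E f k) t

/-- soundness of the table -/
def SndT (f : List Bool → G) (t : Tr (Tr (List Nat))) : Prop := AllT (fun _ P => Snd f P) t

theorem ev_self (k : ℕ) : ev f [Nat.add (Nat.mul k 8) 1] = E f k := by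
  have h1 : (k * 8 + 1) / 8 = k := by omega
  have h2 : (k * 8 + 1) % 8 = 1 := by omega
  show ev f [k * 8 + 1] = _
  rw [ev, h1, h2, ev]; simp

theorem nf_snd {t : Tr (List Nat)} (ht : Snd f t) (k : ℕ) : ev f (nf t k) = E f k :=
  look_prop (fun k P => ev f P = E f k) _ k (ev_self k) t k ht

theorem blk_snd {T : Tr (Tr (List Nat))} (hT : SndT f T) (i : ℕ) : Snd f (blk T i) :=
  look_prop (fun _ P => Snd f P) Tr.o i trivial T i hT

include h7 in
theorem red_snd {t : Tr (List Nat)} (ht : Snd f t) (v : List Nat) : ev f (red t v) = ev f v := by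
  induction v with
  | nil => rfl
  | cons e v ih =>
    show ev f (axpy (e % 8) (nf t (e / 8)) (red t v)) = _
    rw [ev_axpy h7, nf_snd ht, ih, ev]

theorem E_child (k x : ℕ) (hx : x < 2) :
    E f (2 * k + (x + 1)) = sh [x == 1] (E f k) := by
  unfold E
  rw [sh_sh]
  interval_cases x
  · rw [dec_one]; rfl
  · rw [dec_two]; rfl

include h7 in
theorem mulr_snd {t : Tr (List Nat)} (ht : Snd f t) (x : ℕ) (hx : x < 2) (v : List Nat) :
    ev f (mulr t (Nat.succ x) v) = sh [x == 1] (ev f v) := by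
  induction v with
  | nil => rfl
  | cons e v ih =>
    show ev f (axpy (e % 8) (nf t (2 * (e / 8) + (x + 1))) (mulr t (Nat.succ x) v)) = _
    rw [ev_axpy h7, nf_snd ht, ih, ev, E_child _ _ hx]; rfl

/-- word of a multiplier code -/
def wd : ℕ → ℕ → List Bool
  | 0, _ => []
  | n + 1, a => if a ≤ 1 then [] else (a % 2 == 1) :: wd n (a / 2)

theorem ble_iff (a b : ℕ) : (Nat.ble a b = true) ↔ a ≤ b := by rw [Nat.ble_eq]

include h7 in
theorem mulw_snd {β : Type} {T : Tr (Tr (List Nat))} (hT : SndT f T) (n : ℕ) :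
    ∀ (a i : ℕ) (v : List Nat) (k : Nat → List Nat → β),
      ∃ i' v', mulw T n a i v k = k i' v' ∧ ev f v' = sh (wd n a) (ev f v) := by
  induction n with
  | zero => intro a i v k; exact ⟨i, v, rfl, rfl⟩
  | succ n ih =>
    intro a i v k
    have hstep : mulw T (n + 1) a i v k = bsel (Nat.ble a 1) (k i v)
      (fN (Nat.add i (Nat.add 16 (Nat.mod a 2))) (fun i' =>
        fT (blk T i') (fun t => fl (mulr t (Nat.succ (Nat.mod a 2)) v)
          (fun v' => mulw T n (Nat.div a 2) i' v' k)))) := rfl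
    rw [hstep, wd]
    cases hb : Nat.ble a 1 with
    | true =>
      rw [if_pos ((ble_iff _ _).1 hb)]
      exact ⟨i, v, rfl, rfl⟩
    | false =>
      rw [if_neg (fun h => by rw [(ble_iff _ _).2 h] at hb; cases hb), bsel_false, fN_eq, fT_eq,
        fl_eq]
      obtain ⟨i', v', h1, h2⟩ := ih (Nat.div a 2) (Nat.add i (Nat.add 16 (Nat.mod a 2)))
        (mulr (blk T (Nat.add i (Nat.add 16 (Nat.mod a 2)))) (Nat.succ (Nat.mod a 2)) v) k
      refine ⟨i', v', h1, ?_⟩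
      have hx : Nat.mod a 2 < 2 := Nat.mod_lt _ (by norm_num)
      rw [h2, mulr_snd h7 (blk_snd hT _) _ hx, sh_sh]
      rfl

include h7 in
theorem arr_snd {T : Tr (Tr (List Nat))} (hT : SndT f T) (a b n : ℕ) :
    ∀ (j i : ℕ) (v : List Nat),
      ev f (arr T a b n j i v) = Arr (wd 12 a) (wd 12 b) n j (ev f v) := by
  induction n with
  | zero => intro j i v; rfl
  | succ m ih =>
    intro j i v
    have hstep : arr T a b (m + 1) j i v =
      bsel (Nat.beq j 0) (mulw T 12 a i v (fun i' v' => arr T a b m j i' v'))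
        (bsel (Nat.ble j m)
          (axpy 1 (mulw T 12 a i v (fun i' v' => arr T a b m j i' v'))
            (mulw T 12 b i v (fun i' v' => arr T a b m (Nat.pred j) i' v')))
          (mulw T 12 b i v (fun i' v' => arr T a b m (Nat.pred j) i' v'))) := rfl
    rw [hstep, Arr]
    obtain ⟨i1, v1, e1, e1'⟩ := mulw_snd h7 hT 12 a i v (fun i' v' => arr T a b m j i' v')
    obtain ⟨i2, v2, e2, e2'⟩ := mulw_snd h7 hT 12 b i v (fun i' v' => arr T a b m (Nat.pred j) i' v')
    rw [e1, e2]
    cases hj : Nat.beq j 0 with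
    | true =>
      rw [if_pos (Nat.eq_of_beq_eq_true hj), bsel_true, ih, e1']
    | false =>
      rw [if_neg (Nat.ne_of_beq_eq_false hj), bsel_false]
      cases hb : Nat.ble j m with
      | true =>
        rw [if_pos ((ble_iff _ _).1 hb), bsel_true, ev_axpy h7, ih, ih, e1', e2', one_smul]; rfl
      | false =>
        rw [if_neg (fun h => by rw [(ble_iff _ _).2 h] at hb; cases hb), bsel_false, ih, e2']; rfl

theorem wd_ne {n a : ℕ} (ha : Nat.ble a 1 = false) : wd (n + 1) a ≠ [] := by
  rw [wd, if_neg (fun h => by rw [(ble_iff _ _).2 h] at ha; cases ha)]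
  simp

variable (hA : ∀ (p A B : List Bool) (j : ℕ), A ≠ [] → B ≠ [] → j ≤ 5 → Arr A B 5 j (sh p f) = 0)

include h7 hA in
theorem row_snd {T : Tr (Tr (List Nat))} (hT : SndT f T) (r : ℕ) : ev f (row T r) = 0 := by
  unfold row
  cases h1 : Nat.ble (r / 262144 % 4096) 1 with
  | true => rfl
  | false =>
    cases h2 : Nat.ble (r / 1073741824 % 4096) 1 with
    | true => rfl
    | false =>
      rw [bsel_false, bsel_false, arr_snd h7 hT]
      have := ev_self (f := f) (r / 4 % 65536)
      have e : ev f [r / 4 % 65536 * 8 + 1] = E f (r / 4 % 65536) := this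
      rw [e]
      exact hA _ _ _ _ (wd_ne h1) (wd_ne h2) (by omega)

include h7 in
theorem norm7_snd (l : List Nat) (hl : ev f l = 0) : ev f (norm7 l) = 0 := by
  cases l with
  | nil => rfl
  | cons e l =>
    show ev f (axpy _ (e :: l) []) = 0
    rw [ev_axpy h7, hl]; simp [ev]

include h7 in
theorem insE_snd {β : Type} (F : List (List Nat)) :
    ∀ (r : List Nat) (k : List (List Nat) → β), (∀ p ∈ F, ev f p = 0) → ev f r = 0 →
      ∃ F', (∀ p ∈ F', ev f p = 0) ∧ insE F r k = k F' := by
  induction F with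
  | nil =>
    intro r k _ hr
    cases r with
    | nil => exact ⟨[], by simp, rfl⟩
    | cons e r =>
      refine ⟨[norm7 (e :: r)], ?_, ?_⟩
      · simp [norm7_snd h7 _ hr]
      · show fl (norm7 (e :: r)) (fun r' => k [r']) = _
        rw [fl_eq]
  | cons p F ih =>
    intro r k hF hr
    have hp : ev f p = 0 := hF p (by simp)
    have hF' : ∀ p ∈ F, ev f p = 0 := fun q hq => hF q (by simp [hq])
    cases r with
    | nil => exact ⟨p :: F, hF, rfl⟩
    | cons e r =>
      cases p with
      | nil => exact ⟨[] :: F, hF, rfl⟩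
      | cons h p =>
        have hstep : insE ((h :: p) :: F) (e :: r) k =
          bsel (Nat.ble (Nat.div e 8) (Nat.div h 8))
          (bsel (Nat.beq (Nat.div e 8) (Nat.div h 8))
            (fl (axpy (Nat.mod e 8) (h :: p) (e :: r))
              (fun r' => insE F r' (fun F'' => k ((h :: p) :: F''))))
            (insE F (e :: r) (fun F'' => k ((h :: p) :: F''))))
          (fl (norm7 (e :: r)) (fun r' => k (r' :: (h :: p) :: F))) := rfl
        rw [hstep]
        cases Nat.ble (Nat.div e 8) (Nat.div h 8) with
        | false =>
          refine ⟨norm7 (e :: r) :: (h :: p) :: F, ?_, ?_⟩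
          · intro q hq
            rcases List.mem_cons.1 hq with rfl | hq
            · exact norm7_snd h7 _ hr
            · exact hF q hq
          · rw [bsel_false, fl_eq]
        | true =>
          rw [bsel_true]
          cases Nat.beq (Nat.div e 8) (Nat.div h 8) with
          | false =>
            rw [bsel_false]
            obtain ⟨F', h1, h2⟩ := ih (e :: r) (fun F'' => k ((h :: p) :: F'')) hF' hr
            refine ⟨(h :: p) :: F', ?_, h2⟩
            intro q hq
            rcases List.mem_cons.1 hq with rfl | hq
            · exact hp
            · exact h1 q hq
          | true =>
            rw [bsel_true, fl_eq]
            obtain ⟨F', h1, h2⟩ := ih (axpy (Nat.mod e 8) (h :: p) (e :: r))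
              (fun F'' => k ((h :: p) :: F'')) hF' (by rw [ev_axpy h7, hp, hr]; simp)
            refine ⟨(h :: p) :: F', ?_, h2⟩
            intro q hq
            rcases List.mem_cons.1 hq with rfl | hq
            · exact hp
            · exact h1 q hq

include h7 hA in
theorem ech_snd {β : Type} {T : Tr (Tr (List Nat))} (hT : SndT f T) (R : List Nat) :
    ∀ (F : List (List Nat)) (k : List (List Nat) → β), (∀ p ∈ F, ev f p = 0) →
      ∃ F', (∀ p ∈ F', ev f p = 0) ∧ ech T R F k = k F' := by
  induction R with
  | nil => intro F k hF; exact ⟨F, hF, rfl⟩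
  | cons r R ih =>
    intro F k hF
    obtain ⟨F1, h1, e1⟩ := insE_snd h7 F (row T r) (fun F' => ech T R F' k) hF
      (row_snd h7 hA hT r)
    obtain ⟨F2, h2, e2⟩ := ih F1 k h1
    refine ⟨F2, h2, ?_⟩
    show fl (row T r) (fun v => insE F v (fun F' => ech T R F' k)) = _
    rw [fl_eq, e1, e2]

include h7 in
theorem bs_snd {β : Type} (F : List (List Nat)) :
    ∀ (k : Tr (List Nat) → β), (∀ p ∈ F, ev f p = 0) → ∃ t, Snd f t ∧ bs F k = k t := by
  induction F with
  | nil => intro k _; exact ⟨Tr.o, trivial, rfl⟩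
  | cons p F ih =>
    intro k hF
    have hp : ev f p = 0 := hF p (by simp)
    have hF' : ∀ p ∈ F, ev f p = 0 := fun q hq => hF q (by simp [hq])
    cases p with
    | nil =>
      obtain ⟨t, ht, e⟩ := ih (fun T' => k T') hF'
      exact ⟨t, ht, e⟩
    | cons e P =>
      have hstep : bs ((e :: P) :: F) k = bs F (fun T' => bsel (Nat.beq (Nat.mod e 8) 6)
        (fl (red T' P) (fun P' => fN (Nat.div e 8) (fun w => insT w P' T' w k)))
        (k T')) := rfl
      rw [hstep]
      obtain ⟨t, ht, e1⟩ := ih (fun T' => bsel (Nat.beq (Nat.mod e 8) 6)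
        (fl (red T' P) (fun P' => fN (Nat.div e 8) (fun w => insT w P' T' w k)))
        (k T')) hF'
      rw [e1]
      cases h6 : Nat.beq (Nat.mod e 8) 6 with
      | false => exact ⟨t, ht, rfl⟩
      | true =>
        have h6' : e % 8 = 6 := Nat.eq_of_beq_eq_true h6
        rw [bsel_true, fl_eq, fN_eq]
        have hQ : ev f (red t P) = E f (e / 8) := by
          rw [red_snd h7 ht]
          rw [ev, h6'] at hp
          have h7' : (7 : ℕ) • E f (e / 8) = 0 := by funext q; exact h7 _
          have : (7 : ℕ) • E f (e / 8) = 6 • E f (e / 8) + E f (e / 8) := by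
            rw [← succ_nsmul]
          rw [this] at h7'
          exact add_left_cancel (hp.trans h7'.symm)
        obtain ⟨t', h1, h2⟩ := insT_prop (fun k P => ev f P = E f k) (Nat.div e 8) (red t P) hQ t
          (Nat.div e 8) k ht
        exact ⟨t', h1, h2⟩

include h7 hA in
theorem run_snd {β : Type} (R : List (Nat × List Nat)) :
    ∀ (T : Tr (Tr (List Nat))) (k : Tr (Tr (List Nat)) → β), SndT f T →
      ∃ T', SndT f T' ∧ run R T k = k T' := by
  induction R with
  | nil => intro T k hT; exact ⟨T, hT, rfl⟩
  | cons b R ih =>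
    intro T k hT
    obtain ⟨i, R'⟩ := b
    have hstep : run ((i, R') :: R) T k =
      ech T R' [] (fun F => bs F (fun t => insT i t T i (fun T' => run R T' k))) := rfl
    obtain ⟨F, hF, e1⟩ := ech_snd h7 hA hT R' []
      (fun F => bs F (fun t => insT i t T i (fun T' => run R T' k))) (by simp)
    obtain ⟨t, ht, e2⟩ := bs_snd h7 F (fun t => insT i t T i (fun T' => run R T' k)) hF
    obtain ⟨T1, hT1, e3⟩ := insT_prop (fun _ P => Snd f P) i t ht T i (fun T' => run R T' k) hT
    obtain ⟨T2, hT2, e4⟩ := ih T1 k hT1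
    exact ⟨T2, hT2, by rw [hstep, e1, e2, e3, e4]⟩

theorem len_dec (k : ℕ) : (dec k).length = Nat.log2 (k + 1) := by
  induction k using Nat.strong_induction_on with
  | _ k ih =>
    cases k with
    | zero => rw [dec]; decide
    | succ k =>
      rw [dec, List.length_append, ih (k / 2) (by omega)]
      rw [Nat.log2_def (k + 1 + 1), if_pos (by omega)]
      have : (k + 1 + 1) / 2 = k / 2 + 1 := by omega
      rw [this]; rfl

theorem dec_surj (w : List Bool) : ∃ k, dec k = w := by
  induction w using List.reverseRecOn with
  | nil => exact ⟨0, by simp [dec]⟩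
  | append_singleton w b ih =>
    obtain ⟨k, rfl⟩ := ih
    cases b with
    | false => exact ⟨2 * k + 1, dec_one k⟩
    | true => exact ⟨2 * k + 2, dec_two k⟩

theorem allB_spec (k : ℕ) (l : List Nat) (h : allB l k = true) :
    ∀ e ∈ l, e / 8 < k ∧ Nat.log2 (e / 8 + 1) = Nat.log2 (k + 1) := by
  induction l with
  | nil => simp
  | cons e l ih =>
    have hs : allB (e :: l) k = bsel (Nat.ble k (e / 8)) false
      (bsel (Nat.beq (Nat.log2 (k + 1)) (Nat.log2 (e / 8 + 1))) (allB l k) false) := rfl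
    rw [hs] at h
    cases h1 : Nat.ble k (e / 8) with
    | true => rw [h1] at h; cases h
    | false =>
      rw [h1, bsel_false] at h
      cases h2 : Nat.beq (Nat.log2 (k + 1)) (Nat.log2 (e / 8 + 1)) with
      | false => rw [h2] at h; cases h
      | true =>
        rw [h2, bsel_true] at h
        intro e' he'
        rcases List.mem_cons.1 he' with rfl | he'
        · refine ⟨?_, (Nat.eq_of_beq_eq_true h2).symm⟩
          by_contra hc
          rw [(ble_iff _ _).2 (not_lt.1 hc)] at h1; cases h1
        · exact ih h e' he'

theorem okT_spec (t : Tr (List Nat)) (h : okT t = true) :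
    AllT (fun k P => allB P k = true) t := by
  induction t with
  | o => trivial
  | n k P l r ihl ihr =>
    have hs : okT (Tr.n k P l r) = bsel (allB P k) (bsel (okT l) (okT r) false) false := rfl
    rw [hs] at h
    cases h1 : allB P k with
    | false => rw [h1] at h; cases h
    | true =>
      cases h2 : okT l with
      | false => rw [h1, h2] at h; cases h
      | true =>
        rw [h1, h2] at h
        exact ⟨h1, ihl h2, ihr h⟩

theorem okTT_spec (t : Tr (Tr (List Nat))) (h : okTT t = true) :
    AllT (fun _ P => okT P = true) t := by
  induction t with
  | o => trivial
  | n k P l r ihl ihr =>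
    have hs : okTT (Tr.n k P l r) = bsel (okT P) (bsel (okTT l) (okTT r) false) false := rfl
    rw [hs] at h
    cases h1 : okT P with
    | false => rw [h1] at h; cases h
    | true =>
      cases h2 : okTT l with
      | false => rw [h1, h2] at h; cases h
      | true =>
        rw [h1, h2] at h
        exact ⟨h1, ihl h2, ihr h⟩

theorem absent_spec (Q : ℕ → List Nat → Prop) (t : Tr (List Nat)) (k : ℕ) : ∀ s, AllT Q t →
    absent t k s = false → ∃ P, Q k P := by
  induction t with
  | o => intro s _ h; cases h
  | n k' P l r ihl ihr =>
    intro s ht h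
    have hs : absent (Tr.n k' P l r) k s = bsel (Nat.beq k k') false
      (bsel (Nat.beq (s % 2) 0) (absent l k (s / 2)) (absent r k (s / 2))) := rfl
    rw [hs] at h
    cases hk : Nat.beq k k' with
    | true =>
      have : k = k' := Nat.eq_of_beq_eq_true hk
      subst this; exact ⟨P, ht.1⟩
    | false =>
      rw [hk, bsel_false] at h
      cases h2 : Nat.beq (s % 2) 0 with
      | true => rw [h2, bsel_true] at h; exact ihl _ ht.2.1 h
      | false => rw [h2, bsel_false] at h; exact ihr _ ht.2.2 h

theorem AllT_and {α : Type} {Q Q' : ℕ → α → Prop} (t : Tr α) (h : AllT Q t) (h' : AllT Q' t) :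
    AllT (fun k P => Q k P ∧ Q' k P) t := by
  induction t with
  | o => trivial
  | n k P l r ihl ihr => exact ⟨⟨h.1, h'.1⟩, ihl h.2.1 h'.2.1, ihr h.2.2 h'.2.2⟩

/-- a word with a rule -/
def HasRule (f : List Bool → G) (k : ℕ) : Prop :=
  ∃ P, ev f P = E f k ∧ ∀ e ∈ P, e / 8 < k ∧ Nat.log2 (e / 8 + 1) = Nat.log2 (k + 1)

/-- all extensions by exactly `m` letters meet rules -/
def Dead (f : List Bool → G) : ℕ → ℕ → Prop
  | 0, k => HasRule f k
  | m + 1, k => HasRule f k ∨ (Dead f m (2 * k + 1) ∧ Dead f m (2 * k + 2))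

theorem dead_spec (T : Tr (Tr (List Nat))) (hT : SndT f T) (hok : okTT T = true) (m : ℕ) :
    ∀ k i, dead T m k i = true → Dead f m k := by
  have hrule : ∀ k i, absent (blk T i) k k = false → HasRule f k := by
    intro k i h
    have h1 : okT (blk T i) = true :=
      look_prop (fun _ P => okT P = true) _ i rfl T i (okTT_spec T hok)
    obtain ⟨P, hP, hP'⟩ := absent_spec _ (blk T i) k k
      (AllT_and _ (blk_snd hT i) (okT_spec _ h1)) h
    exact ⟨P, hP, allB_spec k P hP'⟩
  induction m with
  | zero =>
    intro k i h
    have hs : dead T 0 k i = bsel (absent (blk T i) k k) false true := rfl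
    rw [hs] at h
    cases ha : absent (blk T i) k k with
    | true => rw [ha] at h; cases h
    | false => exact hrule k i ha
  | succ m ih =>
    intro k i h
    have hs : dead T (m + 1) k i = bsel (absent (blk T i) k k)
      (bsel (dead T m (2 * k + 1) (i + 16)) (dead T m (2 * k + 2) (i + 17)) false) true := rfl
    rw [hs] at h
    cases ha : absent (blk T i) k k with
    | false => exact Or.inl (hrule k i ha)
    | true =>
      rw [ha, bsel_true] at h
      cases hb : dead T m (2 * k + 1) (i + 16) with
      | false => rw [hb] at h; cases h
      | true =>
        rw [hb, bsel_true] at h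
        exact Or.inr ⟨ih _ _ hb, ih _ _ h⟩

/-- normal words of length `d` -/
def Nm (f : List Bool → G) : ℕ → ℕ → Prop
  | 0, k => k = 0 ∧ ¬ HasRule f k
  | d + 1, k => ¬ HasRule f k ∧ ∃ s, Nm f d s ∧ (k = 2 * s + 1 ∨ k = 2 * s + 2)

theorem Nm_dead (m : ℕ) (h : Dead f m 0) : ∀ d s, d ≤ m → Nm f d s → Dead f (m - d) s := by
  intro d
  induction d with
  | zero => rintro s _ ⟨rfl, _⟩; exact h
  | succ d ih =>
    rintro k hd ⟨hk, s, hs, hks⟩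
    have h1 := ih s (by omega) hs
    have h2 : m - d = (m - (d + 1)) + 1 := by omega
    rw [h2] at h1
    have hns : ¬ HasRule f s := by
      cases d with
      | zero => exact hs.1 ▸ hs.2
      | succ d => exact hs.1
    rcases h1 with h1 | h1
    · exact absurd h1 hns
    · rcases hks with rfl | rfl
      · exact h1.1
      · exact h1.2

theorem Nm_empty (m : ℕ) (h : Dead f m 0) (s : ℕ) : ¬ Nm f m s := by
  intro hs
  have h1 := Nm_dead m h m s le_rfl hs
  rw [Nat.sub_self] at h1
  cases m with
  | zero => exact hs.2 h1
  | succ d => exact hs.1 h1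

theorem ev_mem (S : AddSubgroup (List Bool → G)) (l : List Nat) (h : ∀ e ∈ l, E f (e / 8) ∈ S) :
    ev f l ∈ S := by
  induction l with
  | nil => exact S.zero_mem
  | cons e l ih =>
    rw [ev]
    exact S.add_mem (S.nsmul_mem (h e (by simp)) _) (ih (fun e' he' => h e' (by simp [he'])))

/-- shift as an additive map -/
def shHom (w : List Bool) : (List Bool → G) →+ (List Bool → G) where
  toFun := sh w
  map_zero' := rfl
  map_add' _ _ := rfl

theorem span_Nm (d : ℕ) : ∀ k, Nat.log2 (k + 1) = d →
    E f k ∈ AddSubgroup.closure {g | ∃ s, Nm f d s ∧ s ≤ k ∧ g = E f s} := by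
  induction d with
  | zero =>
    intro k hk
    have hk0 : k = 0 := by
      have h := Nat.lt_log2_self (n := k + 1)
      rw [hk] at h; omega
    subst hk0
    by_cases hr : HasRule f 0
    · obtain ⟨P, h1, h2⟩ := hr
      rw [← h1]
      exact ev_mem _ _ (fun e he => absurd (h2 e he).1 (Nat.not_lt_zero _))
    · exact AddSubgroup.subset_closure ⟨0, ⟨rfl, hr⟩, le_rfl, rfl⟩
  | succ d ihd =>
    intro k
    induction k using Nat.strong_induction_on with
    | _ k ih =>
      intro hk
      obtain ⟨k0, x, hx, rfl⟩ : ∃ k0 x, x < 2 ∧ k = 2 * k0 + (x + 1) := by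
        refine ⟨(k - 1) / 2, (k - 1) % 2, Nat.mod_lt _ (by norm_num), ?_⟩
        have : k ≠ 0 := by
          rintro rfl
          have h1 : Nat.log2 (0 + 1) = 0 := by decide
          omega
        omega
      have hk0 : Nat.log2 (k0 + 1) = d := by
        rw [Nat.log2_def, if_pos (by omega)] at hk
        have : (2 * k0 + (x + 1) + 1) / 2 = k0 + 1 := by omega
        rw [this] at hk; omega
      rw [E_child _ _ hx]
      have h1 : shHom [x == 1] (E f k0) ∈ (AddSubgroup.closure
          {g | ∃ s, Nm f d s ∧ s ≤ k0 ∧ g = E f s}).map (shHom [x == 1]) :=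
        AddSubgroup.mem_map_of_mem _ (ihd k0 hk0)
      rw [AddMonoidHom.map_closure] at h1
      refine (AddSubgroup.closure_le _).2 ?_ h1
      rintro _ ⟨_, ⟨s, hs, hsk, rfl⟩, rfl⟩
      show sh [x == 1] (E f s) ∈ _
      rw [← E_child _ _ hx]
      by_cases hr : HasRule f (2 * s + (x + 1))
      · obtain ⟨P, hP1, hP2⟩ := hr
        rw [← hP1]
        refine ev_mem _ _ (fun e he => ?_)
        obtain ⟨e1, e2⟩ := hP2 e he
        have hlog : Nat.log2 (s + 1) = d := by
          clear ih ihd h1 hP1 hP2 e2 hk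
          clear P he e1 hk0 hsk hx
          induction d generalizing s with
          | zero => rw [hs.1]; decide
          | succ d ihd =>
            obtain ⟨_, s', hs', h⟩ := hs
            rw [Nat.log2_def, if_pos (by omega)]
            have : (s + 1) / 2 = s' + 1 := by omega
            rw [this, ihd s' hs']
        have hlog2 : Nat.log2 (2 * s + (x + 1) + 1) = d + 1 := by
          rw [Nat.log2_def, if_pos (by omega)]
          have : (2 * s + (x + 1) + 1) / 2 = s + 1 := by omega
          rw [this, hlog]
        refine AddSubgroup.closure_mono ?_ (ih (e / 8) (by omega) (e2.trans hlog2))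
        rintro _ ⟨s', h1, h2, rfl⟩
        exact ⟨s', h1, by omega, rfl⟩
      · refine AddSubgroup.subset_closure ⟨2 * s + (x + 1), ⟨hr, s, hs, ?_⟩, by omega, rfl⟩
        omega

include h7 hA in
theorem comp_main (hchk : run rels Tr.o (fun T => bsel (okTT T) (dead T 15 0 0) false) = true) (w : List Bool) (hw : w.length = 15) : f w = 0 := by
  obtain ⟨T, hT, hr⟩ := run_snd h7 hA rels Tr.o
    (fun T => bsel (okTT T) (dead T 15 0 0) false) trivial
  have hc := hr.symm.trans hchk
  cases hok : okTT T with
  | false => simp only [hok] at hc; cases hc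
  | true =>
    simp only [hok] at hc
    have hd := dead_spec T hT hok 15 0 0 hc
    obtain ⟨k, rfl⟩ := dec_surj w
    rw [len_dec] at hw
    have h1 := span_Nm (f := f) 15 k hw
    have h2 : {g | ∃ s, Nm f 15 s ∧ s ≤ k ∧ g = E f s} = ∅ := by
      ext g; constructor
      · rintro ⟨s, hs, _⟩; exact absurd hs (Nm_empty 15 hd s)
      · rintro ⟨⟩
    rw [h2, AddSubgroup.closure_empty, AddSubgroup.mem_bot] at h1
    have h3 := congrFun h1 []
    simpa [E, sh] using h3
end

section trp
variable {R : Type*} [CommRing R] {n : ℕ}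

/-- `tr_σ(Z)` -/
def trperm {ι : Type*} [Fintype ι] [DecidableEq ι] (σ : Equiv.Perm ι)
    (Z : ι → Matrix (Fin n) (Fin n) R) : R :=
  ∑ I : ι → Fin n, ∏ k, Z k (I (σ k)) (I k)

theorem trperm_equiv {ι κ : Type*} [Fintype ι] [Fintype κ] [DecidableEq ι] [DecidableEq κ]
    (e : ι ≃ κ) (σ : Equiv.Perm ι) (Z : κ → Matrix (Fin n) (Fin n) R) :
    trperm (e.permCongr σ) Z = trperm σ (Z ∘ e) := by
  unfold trperm
  refine Fintype.sum_equiv (Equiv.arrowCongr e.symm (Equiv.refl (Fin n))) _ _ (fun I => ?_)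
  refine Fintype.prod_equiv e.symm _ _ (fun k => ?_)
  simp [Equiv.permCongr_apply]

variable {α : Type*} [Fintype α] [DecidableEq α]

theorem sum_option (F : (Option α → Fin n) → R) :
    ∑ I, F I = ∑ I : α → Fin n, ∑ a : Fin n, F (fun o => o.elim a I) := by
  rw [Finset.sum_comm, ← Fintype.sum_prod_type']
  refine Fintype.sum_equiv (Equiv.piOptionEquivProd (α := α) (β := fun _ => Fin n)) _ _ (fun I => ?_)
  congr 1
  funext o
  cases o <;> rfl

theorem trperm_none (τ : Equiv.Perm α) (Z : Option α → Matrix (Fin n) (Fin n) R) :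
    trperm (Equiv.Perm.decomposeOption.symm (none, τ)) Z
      = (Z none).trace * trperm τ (Z ∘ some) := by
  unfold trperm
  rw [sum_option, Finset.mul_sum]
  refine Finset.sum_congr rfl (fun I _ => ?_)
  simp [Fintype.prod_option, Matrix.trace, Finset.sum_mul]

theorem trperm_some (τ : Equiv.Perm α) (j : α) (Z : Option α → Matrix (Fin n) (Fin n) R) :
    trperm (Equiv.Perm.decomposeOption.symm (some j, τ)) Z
      = trperm τ (Function.update (Z ∘ some) (τ.symm j) (Z none * Z (some (τ.symm j)))) := by
  unfold trperm
  rw [sum_option]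
  refine Finset.sum_congr rfl (fun I _ => ?_)
  obtain ⟨k0, rfl⟩ := τ.surjective j
  rw [Equiv.symm_apply_apply]
  rw [← Finset.mul_prod_erase _ _ (Finset.mem_univ k0), Function.update_self, Matrix.mul_apply,
    Finset.sum_mul]
  refine Finset.sum_congr rfl (fun a _ => ?_)
  rw [Fintype.prod_option, ← Finset.mul_prod_erase _ _ (Finset.mem_univ k0), mul_assoc]
  simp only [Equiv.Perm.decomposeOption_symm_apply, Equiv.Perm.coe_mul, Function.comp_apply,
    Equiv.optionCongr_apply, Option.map_none, Option.map_some, Equiv.swap_apply_left,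
    Equiv.swap_apply_right, Option.elim]
  congr 2
  refine Finset.prod_congr rfl (fun k hk => ?_)
  have hk' : k ≠ k0 := (Finset.mem_erase.1 hk).1
  rw [Function.update_of_ne hk', Equiv.swap_apply_of_ne_of_ne (by simp) (by simpa using hk')]
  rfl

/-- the fundamental trace expression -/
def Phi {ι : Type*} [Fintype ι] [DecidableEq ι] (Z : ι → Matrix (Fin n) (Fin n) R) : R :=
  ∑ σ : Equiv.Perm ι, ((Equiv.Perm.sign σ : ℤ) : R) * trperm σ Z

theorem Phi_equiv {ι κ : Type*} [Fintype ι] [Fintype κ] [DecidableEq ι] [DecidableEq κ]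
    (e : ι ≃ κ) (Z : κ → Matrix (Fin n) (Fin n) R) : Phi Z = Phi (Z ∘ e) := by
  unfold Phi
  refine (Fintype.sum_equiv e.permCongr _ _ (fun σ => ?_)).symm
  rw [trperm_equiv, Equiv.Perm.sign_permCongr]

theorem Phi_eq_zero {ι : Type*} [Fintype ι] [DecidableEq ι] (hι : n < Fintype.card ι)
    (Z : ι → Matrix (Fin n) (Fin n) R) : Phi Z = 0 := by
  have : Phi Z = ∑ I : ι → Fin n, Matrix.det (Matrix.of fun k l => Z l (I k) (I l)) := by
    simp only [Phi, trperm, Finset.mul_sum, Matrix.det_apply']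
    rw [Finset.sum_comm]
    rfl
  rw [this]
  refine Finset.sum_eq_zero (fun I _ => ?_)
  obtain ⟨k, k', hne, h⟩ := Fintype.exists_ne_map_eq_of_card_lt I (by simpa using hι)
  refine Matrix.det_zero_of_row_eq hne ?_
  funext l
  simp [h]

theorem Phi_option (Z : Option α → Matrix (Fin n) (Fin n) R) :
    Phi Z = (Z none).trace * Phi (Z ∘ some)
      - ∑ k, Phi (Function.update (Z ∘ some) k (Z none * Z (some k))) := by
  unfold Phi
  rw [Fintype.sum_equiv (Equiv.Perm.decomposeOption (α := α)) _
    (fun p => ((Equiv.Perm.sign (Equiv.Perm.decomposeOption.symm p) : ℤ) : R) *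
      trperm (Equiv.Perm.decomposeOption.symm p) Z) (fun σ => by simp)]
  rw [Fintype.sum_prod_type, Fintype.sum_option, sub_eq_add_neg]
  congr 1
  · rw [Finset.mul_sum]
    refine Finset.sum_congr rfl (fun τ _ => ?_)
    rw [trperm_none]
    simp; ring
  · rw [Finset.sum_comm, Finset.sum_comm (s := Finset.univ) (t := Finset.univ)
      (f := fun k (σ : Equiv.Perm α) => _), ← Finset.sum_neg_distrib]
    refine Finset.sum_congr rfl (fun τ _ => ?_)
    rw [← Finset.sum_neg_distrib]
    refine (Fintype.sum_equiv τ _ _ (fun k => ?_)).symm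
    rw [trperm_some]
    simp [Equiv.Perm.decomposeOption_symm_sign]

/-- the iterated reduction -/
theorem Phi_cons (m : ℕ) (Y : Matrix (Fin n) (Fin n) R) (u : Fin (m + 1) → Matrix (Fin n) (Fin n) R) :
    Phi (fun o : Option (Fin (m + 1)) => o.elim Y u) = Y.trace * Phi u
      - ∑ k, Phi (fun o : Option (Fin m) => o.elim (Y * u k) (u ∘ k.succAbove)) := by
  rw [Phi_option]
  congr 1
  refine Finset.sum_congr rfl (fun k _ => ?_)
  rw [Phi_equiv (finSuccEquiv' k).symm]
  congr 1
  funext o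
  cases o with
  | none => simp
  | some i => simp

end trp

section redn
variable {K : Type*} [Field K] {R : Type*} [CommRing R] [Algebra K R] {n : ℕ}

/-- the value of a word in two matrices -/
def wm (X : Bool → Matrix (Fin n) (Fin n) R) (w : List Bool) : Matrix (Fin n) (Fin n) R :=
  (w.map X).prod

/-- trace of a word -/
def tw (X : Bool → Matrix (Fin n) (Fin n) R) (w : List Bool) : R := (wm X w).trace

theorem wm_append (X : Bool → Matrix (Fin n) (Fin n) R) (v w : List Bool) :
    wm X (v ++ w) = wm X v * wm X w := by simp [wm]

theorem tw_comm (X : Bool → Matrix (Fin n) (Fin n) R) (v w : List Bool) :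
    tw X (v ++ w) = tw X (w ++ v) := by
  rw [tw, wm_append, Matrix.trace_mul_comm, ← wm_append, tw]

theorem trperm_mem (X : Bool → Matrix (Fin n) (Fin n) R) (S : Subalgebra K R)
    (ι : Type) [Fintype ι] : ∀ [DecidableEq ι] (σ : Equiv.Perm ι) (ws : ι → List Bool),
      (∀ w : List Bool, w.length ≤ ∑ k, (ws k).length → tw X w ∈ S) →
      trperm σ (fun k => wm X (ws k)) ∈ S := by
  refine Fintype.induction_empty_option (P := fun (ι : Type) _ =>
    ∀ [DecidableEq ι] (σ : Equiv.Perm ι) (ws : ι → List Bool),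
      (∀ w : List Bool, w.length ≤ ∑ k, (ws k).length → tw X w ∈ S) →
      trperm σ (fun k => wm X (ws k)) ∈ S) ?_ ?_ ?_ ι
  · intro α β _ e ih _ σ ws h
    classical
    letI := Fintype.ofEquiv β e.symm
    obtain ⟨τ, rfl⟩ := e.permCongr.surjective σ
    rw [trperm_equiv]
    have := ih τ (ws ∘ e) (fun w hw => h w (hw.trans (le_of_eq ?_)))
    · exact this
    · exact Fintype.sum_equiv e _ _ (fun _ => rfl)
  · intro _ σ ws _
    have : trperm σ (fun k => wm X (ws k)) = 1 := by simp [trperm]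
    rw [this]; exact S.one_mem
  · intro α _ ih i0 σ ws h
    letI := Classical.decEq α
    rw [Fintype.sum_option] at h
    obtain ⟨⟨o, τ⟩, rfl⟩ := Equiv.Perm.decomposeOption.symm.surjective σ
    obtain rfl : i0 = (fun a b => @Option.instDecidableEq α (Classical.decEq α) a b) := Subsingleton.elim _ _
    cases o with
    | none =>
      rw [trperm_none]
      refine S.mul_mem (h _ (by omega)) (ih τ (fun k => ws (some k)) (fun w hw => h w (by omega)))
    | some j =>
      rw [trperm_some]
      have := ih τ (Function.update (fun k => ws (some k)) (τ.symm j)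
        (ws none ++ ws (some (τ.symm j)))) (fun w hw => h w (hw.trans (le_of_eq ?_)))
      · convert this using 2
        funext k
        by_cases hk : k = τ.symm j
        · subst hk; simp [wm_append]
        · simp [Function.update_of_ne hk]
      · rw [← Finset.add_sum_erase _ _ (Finset.mem_univ (τ.symm j)),
          ← Finset.add_sum_erase _ (fun k => (ws (some k)).length) (Finset.mem_univ (τ.symm j)),
          Function.update_self, List.length_append, add_assoc]
        congr 2
        refine Finset.sum_congr rfl (fun k hk => ?_)
        rw [Function.update_of_ne (Finset.mem_erase.1 hk).1]

theorem Phi_mem (X : Bool → Matrix (Fin n) (Fin n) R) (S : Subalgebra K R)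
    (ι : Type) [Fintype ι] [DecidableEq ι] (ws : ι → List Bool)
    (h : ∀ w : List Bool, w.length ≤ ∑ k, (ws k).length → tw X w ∈ S) :
    Phi (fun k => wm X (ws k)) ∈ S := by
  refine S.sum_mem (fun σ _ => S.mul_mem ?_ (trperm_mem X S ι σ ws h))
  exact S.intCast_mem _

/-- iterated sum -/
def PsiH {G : Type*} [AddCommGroup G] : (m : ℕ) → (Fin m → List Bool) → (List Bool → G) → G
  | 0, _, h => h []
  | m + 1, u, h => ∑ k, PsiH m (u ∘ k.succAbove) (sh (u k) h)

theorem Phi_red (X : Bool → Matrix (Fin n) (Fin n) R) (S : Subalgebra K R) (d : ℕ)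
    (hS : ∀ w : List Bool, w.length < d → tw X w ∈ S) :
    ∀ (m : ℕ) (u : Fin m → List Bool) (y : List Bool), y ≠ [] → (∀ k, u k ≠ []) →
      y.length + ∑ k, (u k).length ≤ d →
      Phi (fun o : Option (Fin m) => o.elim (wm X y) (fun k => wm X (u k)))
        - (-1) ^ m * PsiH m u (fun q => tw X (y ++ q)) ∈ S := by
  intro m
  induction m with
  | zero =>
    intro u y _ _ _
    have : Phi (fun o : Option (Fin 0) => o.elim (wm X y) (fun k => wm X (u k))) = tw X y := by
      rw [Phi_option]
      simp [Phi, trperm, tw]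
    rw [this]
    simp [PsiH]
  | succ m ih =>
    intro u y hy hu hl
    rw [Phi_cons]
    have hu0 := List.length_pos_iff.2 (hu 0)
    have hy0 := List.length_pos_iff.2 hy
    have h1 : (wm X y).trace * Phi (fun k => wm X (u k)) ∈ S := by
      refine S.mul_mem (hS y ?_) (Phi_mem X S _ u (fun w hw => hS w (by omega)))
      rw [Fin.sum_univ_succ] at hl
      omega
    have h2 : ∀ k : Fin (m + 1), 
        Phi (fun o : Option (Fin m) => o.elim (wm X y * wm X (u k))
            ((fun k => wm X (u k)) ∘ k.succAbove)) 
          - (-1) ^ m * PsiH m (u ∘ k.succAbove) (sh (u k) (fun q => tw X (y ++ q))) ∈ S := by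
      intro k
      have := ih (u ∘ k.succAbove) (y ++ u k) (by simp [hy]) (fun _ => hu _) (by
        rw [Fin.sum_univ_succAbove _ k] at hl
        simp only [List.length_append, Function.comp]
        omega)
      rw [wm_append] at this
      have e : (sh (u k) fun q => tw X (y ++ q)) = fun q => tw X (y ++ u k ++ q) := by
        funext q
        simp [sh]
      rw [e]
      exact this
    have h3 := S.sub_mem h1 (S.sum_mem (fun k (_ : k ∈ Finset.univ) => h2 k))
    convert h3 using 1
    simp only [PsiH, Finset.sum_sub_distrib, Finset.mul_sum, pow_succ]
    simp only [mul_neg, mul_one, neg_mul, Finset.sum_neg_distrib]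
    ring

/-- number of `true` values -/
def cnt {m : ℕ} (c : Fin m → Bool) : ℕ := ∑ k, (c k).toNat

theorem cnt_le {m : ℕ} (c : Fin m → Bool) : cnt c ≤ m := by
  refine (Finset.sum_le_card_nsmul _ _ 1 (fun k _ => ?_)).trans (by simp)
  exact Bool.toNat_le _

theorem sum_cond {G : Type*} [AddCommMonoid G] {m : ℕ} (c : Fin m → Bool) (x y : G) :
    ∑ k, (if c k then x else y) = cnt c • x + (m - cnt c) • y := by
  have h1 : cnt c = (Finset.univ.filter (fun k => c k = true)).card := by
    rw [Finset.card_filter, cnt]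
    refine Finset.sum_congr rfl (fun k _ => ?_)
    cases c k <;> rfl
  have h2 := Finset.card_filter_add_card_filter_not (s := (Finset.univ : Finset (Fin m)))
    (p := fun k => c k = true)
  rw [Finset.sum_ite, Finset.sum_const, Finset.sum_const, h1]
  congr 2
  simp only [Finset.card_univ, Fintype.card_fin] at h2
  omega

theorem PsiH_col {G : Type*} [AddCommGroup G] (A B : List Bool) :
    ∀ (m : ℕ) (c : Fin m → Bool) (h : List Bool → G),
      PsiH m (fun k => if c k then B else A) h
        = ((m - cnt c).factorial * (cnt c).factorial) • Arr A B m (cnt c) h [] := by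
  intro m
  induction m with
  | zero => intro c h; simp [PsiH, cnt, Arr]
  | succ m ih =>
    intro c h
    have hc : ∀ k, cnt c = (c k).toNat + cnt (c ∘ k.succAbove) := fun k => by
      rw [cnt, Fin.sum_univ_succAbove _ k]; rfl
    have hle := cnt_le c
    have key : ∀ k, PsiH m ((fun k => if c k then B else A) ∘ k.succAbove)
          (sh (if c k then B else A) h)
        = if c k then ((m + 1 - cnt c).factorial * (cnt c - 1).factorial) •
              Arr A B m (cnt c - 1) (sh B h) []
          else ((m - cnt c).factorial * (cnt c).factorial) • Arr A B m (cnt c) (sh A h) [] := by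
      intro k
      have := ih (c ∘ k.succAbove) (sh (if c k then B else A) h)
      rw [show ((fun k => if c k then B else A) ∘ k.succAbove)
        = fun i => if (c ∘ k.succAbove) i then B else A from rfl, this]
      have h1 := hc k
      cases hk : c k with
      | true =>
        rw [hk] at h1
        simp only [Bool.toNat_true] at h1
        rw [show cnt (c ∘ k.succAbove) = cnt c - 1 by omega,
          show m - (cnt c - 1) = m + 1 - cnt c by omega]
        simp
      | false =>
        rw [hk] at h1
        simp only [Bool.toNat_false, zero_add] at h1
        rw [← h1]
        simp
    simp only [PsiH]
    rw [Finset.sum_congr rfl (fun k _ => key k), sum_cond, Arr]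
    rcases Nat.eq_zero_or_pos (cnt c) with h0 | h0
    · simp [h0, ← mul_smul, Nat.factorial_succ]
    · obtain ⟨j, hj⟩ : ∃ j, cnt c = j + 1 := ⟨cnt c - 1, by omega⟩
      rw [hj] at hle ⊢
      rw [if_neg (by omega)]
      simp only [Nat.add_sub_cancel, Nat.add_sub_add_right]
      by_cases hm : j + 1 ≤ m
      · obtain ⟨i, rfl⟩ := Nat.exists_eq_add_of_le hm
        rw [if_pos hm]
        simp only [Pi.add_apply, smul_add, ← mul_smul]
        rw [add_comm]
        have e1 : j + 1 + i - (j + 1) = i := by omega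
        have e2 : j + 1 + i - j = i + 1 := by omega
        rw [e1, e2]
        congr 2
        · simp only [Nat.factorial_succ]; ring
        · simp only [Nat.factorial_succ]; ring
      · have : j = m := by omega
        subst this
        rw [if_neg hm]
        simp [← mul_smul, Nat.factorial_succ]

theorem Arr_congr {G : Type*} [AddCommGroup G] (A B : List Bool) :
    ∀ (m j : ℕ) (h h' : List Bool → G) (q q' : List Bool), j ≤ m →
      (∀ w, w.length = (m - j) * A.length + j * B.length → h (w ++ q) = h' (w ++ q')) →
      Arr A B m j h q = Arr A B m j h' q' := by
  intro m
  induction m with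
  | zero =>
    intro j h h' q q' hj hw
    obtain rfl : j = 0 := by omega
    simpa [Arr] using hw [] (by simp)
  | succ m ih =>
    intro j h h' q q' hj hw
    have hA : j ≤ m → Arr A B m j (sh A h) q = Arr A B m j (sh A h') q' := fun hj => by
      refine ih j _ _ _ _ hj (fun w hl => ?_)
      have := hw (A ++ w) (by
        rw [List.length_append, hl, show m + 1 - j = (m - j) + 1 by omega]; ring)
      simpa [sh] using this
    have hB : 0 < j → Arr A B m (j - 1) (sh B h) q = Arr A B m (j - 1) (sh B h') q' := fun hj0 => by
      refine ih (j - 1) _ _ _ _ (by omega) (fun w hl => ?_)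
      have := hw (B ++ w) (by
        obtain ⟨i, rfl⟩ : ∃ i, j = i + 1 := ⟨j - 1, by omega⟩
        rw [List.length_append, hl]
        simp only [Nat.add_sub_cancel, Nat.add_sub_add_right]; ring)
      simpa [sh] using this
    simp only [Arr]
    split_ifs with h1 h2
    · exact hA (by omega)
    · rw [Pi.add_apply, Pi.add_apply, hA h2, hB (by omega)]
    · exact hB (by omega)

theorem Arr_map {G H : Type*} [AddCommGroup G] [AddCommGroup H] (φ : G →+ H) (A B : List Bool) :
    ∀ (m j : ℕ) (h : List Bool → G) (q : List Bool),
      Arr A B m j (fun w => φ (h w)) q = φ (Arr A B m j h q) := by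
  intro m
  induction m with
  | zero => intro j h q; rfl
  | succ m ih =>
    intro j h q
    have e : ∀ A, sh A (fun w => φ (h w)) = fun w => φ (sh A h w) := fun A => rfl
    simp only [Arr]
    split_ifs with h1 h2
    · rw [e, ih]
    · rw [Pi.add_apply, Pi.add_apply, e, e, ih, ih, map_add]
    · rw [e, ih]

theorem Arr_zero {G : Type*} [AddCommGroup G] (A B : List Bool) (m j : ℕ) (q : List Bool) :
    Arr A B m j (fun _ => (0 : G)) q = 0 := by
  have := Arr_map (0 : G →+ G) A B m j (fun _ => 0) q
  simpa using this

theorem Arr_mem [CharZero K] (X : Bool → Matrix (Fin 5) (Fin 5) R) (S : Subalgebra K R) (d : ℕ)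
    (hS : ∀ w : List Bool, w.length < d → tw X w ∈ S) (A B : List Bool) (hA : A ≠ []) (hB : B ≠ [])
    (j : ℕ) (hj : j ≤ 5) (y : List Bool) (hy : y ≠ [])
    (hl : y.length + ((5 - j) * A.length + j * B.length) ≤ d) :
    Arr A B 5 j (fun q => tw X (y ++ q)) [] ∈ S := by
  obtain ⟨c, hc⟩ : ∃ c : Fin 5 → Bool, cnt c = j := by
    refine ⟨fun k => decide (k.1 < j), ?_⟩
    interval_cases j <;> rfl
  have h := Phi_red X S d hS 5 (fun k => if c k then B else A) y hy
    (fun k => by split_ifs <;> assumption) (by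
      have := sum_cond c B.length A.length
      rw [hc, smul_eq_mul, smul_eq_mul] at this
      simp only [apply_ite List.length]
      rw [this]
      omega)
  rw [Phi_eq_zero (by simp), PsiH_col, hc] at h
  have h2 := S.neg_mem h
  set r := Arr A B 5 j (fun q => tw X (y ++ q)) [] with hr
  have h3 : ((((5 - j).factorial * j.factorial : ℕ)) : K) • r ∈ S := by
    rw [Nat.cast_smul_eq_nsmul]
    convert h using 1
    ring
  have h4 : ((((5 - j).factorial * j.factorial : ℕ)) : K) ≠ 0 := by
    have := Nat.factorial_ne_zero (5 - j)
    have := Nat.factorial_ne_zero j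
    positivity
  have := S.smul_mem h3 ((((5 - j).factorial * j.factorial : ℕ)) : K)⁻¹
  rwa [smul_smul, inv_mul_cancel₀ h4, one_smul] at this

end redn

section nakk
variable {K : Type*} [Field K] [CharZero K]

theorem nak {Q : Type*} [AddCommGroup Q] [Module K Q] (f : List Bool → Q)
    (hfin : (Set.range f).Finite)
    (hA : ∀ (p A B : List Bool) (j : ℕ), A ≠ [] → B ≠ [] → j ≤ 5 → Arr A B 5 j (sh p f) = 0)
    (hz : ∀ w, w.length ≠ 15 → f w = 0)
    (hchk : run rels Tr.o (fun T => bsel (okTT T) (dead T 15 0 0) false) = true)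
    (w : List Bool) : f w = 0 := by
  set G0 : Submodule ℤ Q := Submodule.span ℤ (Set.range f) with hG0
  have hfg : G0.FG := Submodule.fg_span hfin
  set I : Ideal ℤ := Ideal.span {7} with hI
  set N : Submodule ℤ Q := I • G0 with hN
  let φ : Q →+ Q ⧸ N := N.mkQ.toAddMonoidHom
  have hmem : ∀ w, f w ∈ G0 := fun w => Submodule.subset_span ⟨w, rfl⟩
  have hle : G0 ≤ I • G0 := by
    rw [hG0, Submodule.span_le]
    rintro _ ⟨w, rfl⟩
    by_cases hw : w.length = 15
    · have h := comp_main (f := fun w => φ (f w)) (fun w => ?_) (fun p A B j h1 h2 h3 => ?_) hchk w hw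
      · exact (Submodule.Quotient.mk_eq_zero N).1 h
      · rw [← map_nsmul]
        refine (Submodule.Quotient.mk_eq_zero N).2 ?_
        have := Submodule.smul_mem_smul (I := I) (r := 7) (Ideal.mem_span_singleton_self 7) (hmem w)
        rw [← Nat.cast_smul_eq_nsmul ℤ]
        exact this
      · funext q
        have := Arr_map φ A B 5 j (sh p f) q
        rw [hA p A B j h1 h2 h3, Pi.zero_apply, map_zero] at this
        exact this
    · rw [hz w hw]
      exact Submodule.zero_mem _
  obtain ⟨r, hr, h0⟩ := Submodule.exists_sub_one_mem_and_smul_eq_zero_of_fg_of_le_smul I G0 hfg hle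
  have hr0 : r ≠ 0 := by
    rintro rfl
    rw [hI, Ideal.mem_span_singleton] at hr
    norm_num at hr
  have h1 := h0 _ (hmem w)
  rw [← Int.cast_smul_eq_zsmul K] at h1
  exact (smul_eq_zero.1 h1).resolve_left (by exact_mod_cast hr0)

theorem tw_mem {R : Type*} [CommRing R] [Algebra K R]
    (hchk : run rels Tr.o (fun T => bsel (okTT T) (dead T 15 0 0) false) = true)
    (X : Bool → Matrix (Fin 5) (Fin 5) R) (S : Subalgebra K R)
    (hS : ∀ w : List Bool, w.length ≤ 15 → tw X w ∈ S) :
    ∀ w : List Bool, tw X w ∈ S := by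
  suffices H : ∀ d : ℕ, ∀ w : List Bool, w.length = d → tw X w ∈ S from fun w => H _ w rfl
  intro d
  induction d using Nat.strong_induction_on with
  | _ d ih =>
  intro w hw
  by_cases hd : d ≤ 15
  · exact hS w (by omega)
  set z := w.take (d - 15) with hz
  set v := w.drop (d - 15) with hv
  have hzl : z.length = d - 15 := by rw [hz, List.length_take]; omega
  have hvl : v.length = 15 := by rw [hv, List.length_drop]; omega
  have hwz : w = z ++ v := (List.take_append_drop _ _).symm
  let Q := R ⧸ (Subalgebra.toSubmodule S)
  let φ : R →+ Q := (Subalgebra.toSubmodule S).mkQ.toAddMonoidHom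
  have hφ : ∀ r, φ r = 0 ↔ r ∈ S := fun r => by
    exact (Submodule.Quotient.mk_eq_zero (Subalgebra.toSubmodule S))
  let f : List Bool → Q := fun w => if w.length = 15 then φ (tw X (z ++ w)) else 0
  have key := nak (K := K) f ?_ ?_ ?_ hchk v
  · simp only [f, if_pos hvl] at key
    rw [hφ] at key
    rwa [hwz]
  · have h1 : ({w : List Bool | w.length = 15}).Finite := List.finite_length_eq Bool 15
    refine ((h1.image f).union (Set.finite_singleton 0)).subset ?_
    rintro _ ⟨w, rfl⟩
    by_cases h : w.length = 15
    · exact Or.inl ⟨w, h, rfl⟩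
    · exact Or.inr (by simp [f, h])
  · intro p A B j hA hB hj
    funext q
    by_cases hl : p.length + ((5 - j) * A.length + j * B.length) + q.length = 15
    · have h1 : Arr A B 5 j (sh p f) q =
          Arr A B 5 j (fun w => φ (tw X ((q ++ z ++ p) ++ w))) [] := by
        refine Arr_congr A B 5 j _ _ _ _ hj (fun w hw => ?_)
        have hl' : (p ++ (w ++ q)).length = 15 := by simp only [List.length_append]; omega
        simp only [sh, f, if_pos hl', List.append_nil]
        rw [show z ++ (p ++ (w ++ q)) = (z ++ p ++ w) ++ q by simp, tw_comm]
        simp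
      rw [h1, Arr_map, Pi.zero_apply, hφ]
      refine Arr_mem X S d (fun w hw => ih _ hw w rfl) A B hA hB j hj _ ?_ ?_
      · intro h
        have := congrArg List.length h
        simp only [List.length_append, List.length_nil] at this
        omega
      · simp only [List.length_append]; omega
    · have h1 : Arr A B 5 j (sh p f) q = Arr A B 5 j (fun w => 0) [] := by
        refine Arr_congr A B 5 j _ _ _ _ hj (fun w hw => ?_)
        have hl' : (p ++ (w ++ q)).length ≠ 15 := by simp only [List.length_append]; omega
        simp only [sh, f, if_neg hl']
      rw [h1, Arr_zero]; rfl
  · intro w h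
    simp [f, h]

end nakk

section dcc
variable {K : Type*} [Field K] [CharZero K]

theorem double_comm {N : Type*} [Fintype N] [DecidableEq N] {G : Type*} [Group G] [Fintype G]
    (P : G →* Matrix N N K) (D : Matrix N N K)
    (hD : ∀ C : Matrix N N K, (∀ g, P g * C = C * P g) → D * C = C * D) :
    D ∈ Submodule.span K (Set.range P) := by
  classical
  set A := Submodule.span K (Set.range P) with hA
  have hmul : ∀ g, ∀ M ∈ A, P g * M ∈ A := by
    intro g M hM
    induction hM using Submodule.span_induction with
    | mem x hx =>
      obtain ⟨h, rfl⟩ := hx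
      rw [← map_mul]
      exact Submodule.subset_span ⟨_, rfl⟩
    | zero => simp
    | add x y _ _ h1 h2 => rw [mul_add]; exact A.add_mem h1 h2
    | smul a x _ h => rw [Matrix.mul_smul]; exact A.smul_mem a h
  obtain ⟨π0, hπ0⟩ := LinearMap.exists_leftInverse_of_injective A.subtype (by simp)
  have hπ1 : ∀ M ∈ A, (π0 M : Matrix N N K) = M := fun M hM => by
    have := LinearMap.congr_fun hπ0 ⟨M, hM⟩
    exact congrArg Subtype.val this
  let π : Matrix N N K →ₗ[K] Matrix N N K :=
    (Fintype.card G : K)⁻¹ • ∑ g : G, (LinearMap.mulLeft K (P g⁻¹)) ∘ₗ A.subtype ∘ₗ π0 ∘ₗ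
      (LinearMap.mulLeft K (P g))
  have hπ : ∀ M, π M = (Fintype.card G : K)⁻¹ • ∑ g : G, P g⁻¹ * (π0 (P g * M) : Matrix N N K) := by
    intro M
    simp [π, LinearMap.sum_apply]
  have hcard : (Fintype.card G : K) ≠ 0 := by exact_mod_cast Fintype.card_ne_zero
  have hmem : ∀ M, π M ∈ A := fun M => by
    rw [hπ]
    exact A.smul_mem _ (A.sum_mem (fun g _ => hmul _ _ (π0 _).2))
  have h1 : π 1 = 1 := by
    rw [hπ]
    have : ∀ g : G, P g⁻¹ * (π0 (P g * 1) : Matrix N N K) = 1 := fun g => by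
      rw [hπ1 _ (hmul _ _ (Submodule.subset_span ⟨1, map_one P⟩)), mul_one, ← map_mul,
        inv_mul_cancel, map_one]
    rw [Finset.sum_congr rfl (fun g _ => this g), Finset.sum_const, Finset.card_univ,
      ← Nat.cast_smul_eq_nsmul K, smul_smul, inv_mul_cancel₀ hcard, one_smul]
  have hcomm : ∀ h M, π (P h * M) = P h * π M := by
    intro h M
    rw [hπ, hπ, Matrix.mul_smul, Finset.mul_sum]
    congr 1
    refine Fintype.sum_equiv (Equiv.mulRight h) _ _ (fun g => ?_)
    simp only [Equiv.coe_mulRight, ← mul_assoc, ← map_mul]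
    simp
  let C : N → N → Matrix N N K := fun j l => Matrix.of fun i i' => π (Matrix.single i' l 1) i j
  have hC : ∀ M i i' j l, π (M * Matrix.single i' l 1) i j = (C j l * M) i i' := by
    intro M i i' j l
    have e : M * Matrix.single i' l 1 = ∑ a, M a i' • Matrix.single a l (1 : K) := by
      ext x y
      simp [Matrix.mul_apply, Matrix.single_apply, Matrix.sum_apply, ite_and, Finset.sum_ite_eq]
    rw [e, map_sum, Matrix.sum_apply, Matrix.mul_apply]
    refine Finset.sum_congr rfl (fun a _ => ?_)
    rw [map_smul, Matrix.smul_apply, smul_eq_mul, mul_comm]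
    rfl
  have hCc : ∀ j l g, P g * C j l = C j l * P g := by
    intro j l g
    ext i i'
    rw [← hC, hcomm, Matrix.mul_apply, Matrix.mul_apply]
    rfl
  have hfin : π D = D := by
    have e1 : (1 : Matrix N N K) = ∑ l, Matrix.single l l 1 := by
      ext x y
      simp [Matrix.sum_apply, Matrix.single_apply, Matrix.one_apply, ite_and]
    have e2 : π D = D * π 1 := by
      conv_lhs => rw [← mul_one D, e1, Finset.mul_sum, map_sum]
      rw [e1, map_sum, Finset.mul_sum]
      refine Finset.sum_congr rfl (fun l _ => ?_)
      ext i j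
      rw [hC, ← hD _ (hCc j l), Matrix.mul_apply, Matrix.mul_apply]
      rfl
    rw [e2, h1, mul_one]
  rw [← hfin]
  exact hmem D

end dcc

section symm
variable {K : Type*} [Field K] [CharZero K] {V : Type*} [Fintype V] [DecidableEq V] {m : ℕ}

/-- exponent vector of the monomial of a sequence of variables -/
def mon (s : Fin m → V) : V →₀ ℕ := ∑ k, Finsupp.single (s k) 1

theorem mon_apply (s : Fin m → V) (v : V) : mon s v = Fintype.card {k // s k = v} := by
  rw [mon, Finsupp.finsetSum_apply, Fintype.card_subtype, Finset.card_filter]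
  exact Finset.sum_congr rfl (fun k _ => Finsupp.single_apply)

theorem mon_eq {s s' : Fin m → V} (h : mon s = mon s') :
    ∃ σ : Equiv.Perm (Fin m), s' ∘ σ = s := by
  have h1 : ∀ v, Nonempty ({k // s k = v} ≃ {k // s' k = v}) := fun v => by
    refine ⟨Fintype.equivOfCardEq ?_⟩
    rw [← mon_apply, ← mon_apply, h]
  have e := fun v => (h1 v).some
  exact ⟨Equiv.ofFiberEquiv e, funext fun k => Equiv.ofFiberEquiv_map e k⟩

theorem mon_comp (s : Fin m → V) (σ : Equiv.Perm (Fin m)) : mon (s ∘ σ) = mon s :=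
  Fintype.sum_equiv σ _ _ (fun _ => rfl)

theorem mon_surj (μ : V →₀ ℕ) (h : μ.degree = m) : ∃ s : Fin m → V, mon s = μ := by
  subst h
  have h1 : Fintype.card (Σ v, Fin (μ v)) = μ.degree := by
    rw [Fintype.card_sigma, Finsupp.degree_eq_sum]
    simp
  let e := (Fintype.equivFinOfCardEq h1)
  refine ⟨fun k => (e.symm k).1, ?_⟩
  ext v
  rw [mon_apply]
  have h2 : {k // (e.symm k).1 = v} ≃ Fin (μ v) :=
    (e.symm.subtypeEquiv (q := fun x => x.1 = v) (fun k => Iff.rfl)).trans (Equiv.sigmaSubtype v)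
  rw [Fintype.card_congr h2, Fintype.card_fin]

theorem prod_X_eq (s : Fin m → V) :
    ∏ k, (X (s k) : MvPolynomial V K) = monomial (mon s) 1 := by
  rw [mon, MvPolynomial.monomial_sum_one]
  rfl

/-- polynomial of a tensor -/
def FF (c : (Fin m → V) → K) : MvPolynomial V K := ∑ s, C (c s) * ∏ k, X (s k)

theorem eval_FF (c : (Fin m → V) → K) (x : V → K) :
    eval x (FF c) = ∑ s, c s * ∏ k, x (s k) := by
  simp [FF, map_sum, map_prod]

theorem coeff_FF (c : (Fin m → V) → K) (μ : V →₀ ℕ) :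
    coeff μ (FF c) = ∑ s with mon s = μ, c s := by
  simp only [FF, prod_X_eq, MvPolynomial.coeff_sum, MvPolynomial.coeff_C_mul,
    MvPolynomial.coeff_monomial, mul_ite, mul_one, mul_zero]
  rw [Finset.sum_filter]

theorem FF_inj {c c' : (Fin m → V) → K} (hc : ∀ s (σ : Equiv.Perm (Fin m)), c (s ∘ σ) = c s)
    (hc' : ∀ s (σ : Equiv.Perm (Fin m)), c' (s ∘ σ) = c' s) (h : FF c = FF c') : c = c' := by
  funext s
  have key : ∀ c : (Fin m → V) → K, (∀ s (σ : Equiv.Perm (Fin m)), c (s ∘ σ) = c s) → 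
      coeff (mon s) (FF c) = ((Finset.univ.filter (fun s' : Fin m → V => mon s' = mon s)).card : K) 
        * c s := by
    intro c hc
    rw [coeff_FF, Finset.sum_congr rfl (g := fun _ => c s), Finset.sum_const, nsmul_eq_mul]
    intro s' hs'
    obtain ⟨σ, hσ⟩ := mon_eq (Finset.mem_filter.1 hs').2
    rw [← hσ, hc]
  have h1 := key c hc
  rw [h, key c' hc'] at h1
  refine (mul_left_cancel₀ ?_ h1).symm
  have : 0 < (Finset.univ.filter (fun s' : Fin m → V => mon s' = mon s)).card :=
    Finset.card_pos.2 ⟨s, by simp⟩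
  exact_mod_cast this.ne'

theorem FF_surj (f : MvPolynomial V K) (hf : f.IsHomogeneous m) :
    ∃ c : (Fin m → V) → K, (∀ s (σ : Equiv.Perm (Fin m)), c (s ∘ σ) = c s) ∧ FF c = f := by
  refine ⟨fun s => ((Finset.univ.filter (fun s' : Fin m → V => mon s' = mon s)).card : K)⁻¹ *
    coeff (mon s) f, fun s σ => by simp only [mon_comp], ?_⟩
  ext μ
  rw [coeff_FF]
  by_cases hμ : ∃ s : Fin m → V, mon s = μ
  · obtain ⟨s, rfl⟩ := hμ
    have : 0 < (Finset.univ.filter (fun s' : Fin m → V => mon s' = mon s)).card :=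
      Finset.card_pos.2 ⟨s, by simp⟩
    rw [Finset.sum_congr rfl (g := fun _ =>
      ((Finset.univ.filter (fun s' : Fin m → V => mon s' = mon s)).card : K)⁻¹ * coeff (mon s) f),
      Finset.sum_const, nsmul_eq_mul, ← mul_assoc, mul_inv_cancel₀, one_mul]
    · exact_mod_cast this.ne'
    · intro s' hs'
      rw [(Finset.mem_filter.1 hs').2]
  · rw [Finset.sum_eq_zero]
    · symm
      by_contra h
      refine hμ (mon_surj μ ?_)
      rw [Finsupp.degree_eq_weight_one]
      exact hf h
    · intro s hs
      exact absurd ⟨s, (Finset.mem_filter.1 hs).2⟩ hμ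

end symm

section fft
variable {K : Type*} [Field K] [CharZero K] {n m : ℕ}

/-- tensor product of matrices -/
def TT {R : Type*} [CommRing R] (Z : Fin m → Matrix (Fin n) (Fin n) R) :
    Matrix (Fin m → Fin n) (Fin m → Fin n) R :=
  Matrix.of fun I J => ∏ k, Z k (I k) (J k)

theorem TT_mul {R : Type*} [CommRing R] (Z W : Fin m → Matrix (Fin n) (Fin n) R) :
    TT (fun k => Z k * W k) = TT Z * TT W := by
  ext I J
  simp only [TT, Matrix.of_apply, Matrix.mul_apply, ← Finset.prod_mul_distrib]
  rw [Finset.prod_univ_sum, Fintype.piFinset_univ]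

theorem TT_one {R : Type*} [CommRing R] :
    TT (fun _ : Fin m => (1 : Matrix (Fin n) (Fin n) R)) = 1 := by
  ext I J
  simp only [TT, Matrix.of_apply, Matrix.one_apply, Finset.prod_ite_zero, Finset.prod_const_one,
    funext_iff]
  simp

/-- permutation matrices -/
def PP : Equiv.Perm (Fin m) →* Matrix (Fin m → Fin n) (Fin m → Fin n) K where
  toFun σ := Matrix.of fun J I => if I = J ∘ σ then 1 else 0
  map_one' := by
    ext J I
    simp [Matrix.one_apply, eq_comm]
  map_mul' σ τ := by
    ext J I
    simp only [Matrix.of_apply, Matrix.mul_apply, ite_mul, one_mul, zero_mul]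
    rw [Finset.sum_ite_eq' Finset.univ (J ∘ σ)]
    rw [if_pos (Finset.mem_univ _)]
    rfl

theorem PP_comm {C : Matrix (Fin m → Fin n) (Fin m → Fin n) K}
    (hC : ∀ σ : Equiv.Perm (Fin m), PP σ * C = C * PP σ) (σ : Equiv.Perm (Fin m))
    (I J : Fin m → Fin n) : C (I ∘ σ) (J ∘ σ) = C I J := by
  have h := congrFun (congrFun (hC σ) I) (J ∘ σ)
  simp only [PP, MonoidHom.coe_mk, OneHom.coe_mk, Matrix.of_apply, Matrix.mul_apply, ite_mul,
    one_mul, zero_mul, mul_ite, mul_one, mul_zero] at h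
  rw [Finset.sum_ite_eq' Finset.univ (I ∘ σ)] at h
  have e : ∀ x : Fin m → Fin n, (J ∘ σ = x ∘ σ) = (J = x) := fun x =>
    propext (σ.surjective.injective_comp_right.eq_iff)
  simp only [e] at h
  rw [Finset.sum_ite_eq Finset.univ J] at h
  simpa using h

theorem schur_weyl (D : Matrix (Fin m → Fin n) (Fin m → Fin n) K)
    (hD : ∀ g : GL (Fin n) K, D * TT (fun _ => (g : Matrix (Fin n) (Fin n) K))
      = TT (fun _ => (g : Matrix (Fin n) (Fin n) K)) * D) :
    D ∈ Submodule.span K (Set.range (PP (K := K) (n := n) (m := m))) := by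
  classical
  refine double_comm _ _ (fun E hE => ?_)
  have hE' := PP_comm hE
  set GX := Matrix.mvPolynomialX (Fin n) (Fin n) K with hGX
  have hpoly : ∀ I L, ∑ J, D I J • TT (fun _ => GX) J L = ∑ J, D J L • TT (fun _ => GX) I J := by
    intro I L
    rw [← sub_eq_zero]
    set p := ∑ J, D I J • TT (fun _ => GX) J L - ∑ J, D J L • TT (fun _ => GX) I J with hp
    have h0 : GX.det * p = 0 := by
      refine MvPolynomial.funext (fun x => ?_)
      set g : Matrix (Fin n) (Fin n) K := Matrix.of fun i j => x (i, j) with hg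
      have hx : x = fun p => g p.1 p.2 := rfl
      have hT : ∀ I J, eval x (TT (fun _ : Fin m => GX) I J) = TT (fun _ => g) I J := by
        intro I J
        simp [TT, hGX, hg, map_prod, Matrix.mvPolynomialX]
      rw [map_mul, map_zero, RingHom.map_det]
      have hg' : (eval x).mapMatrix GX = g := by
        ext i j
        simp [hGX, hg, Matrix.mvPolynomialX]
      rw [hg']
      by_cases hdet : g.det = 0
      · rw [hdet, zero_mul]
      · have hh : D * TT (fun _ : Fin m => g) = TT (fun _ : Fin m => g) * D :=
          hD (Matrix.GeneralLinearGroup.mkOfDetNeZero g hdet)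
        have h := congrFun (congrFun hh I) L
        rw [hp, map_sub, map_sum, map_sum]
        simp only [MvPolynomial.smul_eval, hT]
        rw [Matrix.mul_apply, Matrix.mul_apply] at h
        rw [h, mul_eq_zero, sub_eq_zero]
        right
        exact Finset.sum_congr rfl (fun J _ => mul_comm _ _)
    exact (mul_eq_zero.1 h0).resolve_left (Matrix.det_mvPolynomialX_ne_zero (Fin n) K)
  let lam : MvPolynomial (Fin n × Fin n) K →ₗ[K] K :=
    (MvPolynomial.basisMonomials (Fin n × Fin n) K).constr K (fun μ =>
      if h : ∃ s : Fin m → Fin n × Fin n, mon s = μ then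
        E (fun k => (h.choose k).1) (fun k => (h.choose k).2) else 0)
  have hlam : ∀ I J, lam (TT (fun _ : Fin m => GX) I J) = E I J := by
    intro I J
    have e1 : TT (fun _ : Fin m => GX) I J
        = MvPolynomial.basisMonomials (Fin n × Fin n) K (mon (fun k => (I k, J k))) := by
      rw [MvPolynomial.coe_basisMonomials]
      exact prod_X_eq (fun k => (I k, J k))
    rw [e1, Module.Basis.constr_basis]
    have h : ∃ s : Fin m → Fin n × Fin n, mon s = mon (fun k => (I k, J k)) := ⟨_, rfl⟩
    rw [dif_pos h]
    obtain ⟨σ, hσ⟩ := mon_eq h.choose_spec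
    rw [← hσ]
    exact hE' σ I J
  ext I L
  have h := congrArg lam (hpoly I L)
  simp only [map_sum, map_smul, hlam, smul_eq_mul] at h
  rw [Matrix.mul_apply, Matrix.mul_apply, h]
  exact Finset.sum_congr rfl (fun J _ => mul_comm _ _)

/-- variables -/
def var (b : Bool) (i j : Fin n) : MatVar n := cond b (Sum.inr (i, j)) (Sum.inl (i, j))

/-- type, row, column of a variable -/
def unv : MatVar n → Bool × Fin n × Fin n
  | Sum.inl p => (false, p)
  | Sum.inr p => (true, p)

theorem unv_var (b : Bool) (i j : Fin n) : unv (var b i j) = (b, i, j) := by cases b <;> rfl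
theorem var_unv (v : MatVar n) : var (unv v).1 (unv v).2.1 (unv v).2.2 = v := by
  rcases v with ⟨i, j⟩ | ⟨i, j⟩ <;> rfl

/-- sequences of variables -/
def sq (β : Fin m → Bool) (I J : Fin m → Fin n) : Fin m → MatVar n :=
  fun k => var (β k) (I k) (J k)

/-- decomposition of sequences of variables -/
def sqE : ((Fin m → Bool) × (Fin m → Fin n) × (Fin m → Fin n)) ≃ (Fin m → MatVar n) where
  toFun p := sq p.1 p.2.1 p.2.2
  invFun s := (fun k => (unv (s k)).1, fun k => (unv (s k)).2.1, fun k => (unv (s k)).2.2)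
  left_inv p := by simp [sq, unv_var]
  right_inv s := by funext k; simp [sq, var_unv]

theorem sum_sq {R : Type*} [AddCommMonoid R] (g : (Fin m → MatVar n) → R) :
    ∑ s, g s = ∑ β, ∑ I, ∑ J, g (sq β I J) := by
  rw [← Fintype.sum_equiv (sqE (n := n) (m := m)) (fun p => g (sq p.1 p.2.1 p.2.2)) g (fun _ => rfl),
    Fintype.sum_prod_type]
  exact Finset.sum_congr rfl (fun β _ => Fintype.sum_prod_type _)

/-- matrices of a tensor -/
def DD (c : (Fin m → MatVar n) → K) (β : Fin m → Bool) :
    Matrix (Fin m → Fin n) (Fin m → Fin n) K := Matrix.of fun J I => c (sq β I J)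

/-- matrices from a substitution -/
def MM {S : Type*} (x : MatVar n → S) (b : Bool) : Matrix (Fin n) (Fin n) S :=
  Matrix.of fun i j => x (var b i j)

theorem aeval_FF {S : Type*} [CommRing S] [Algebra K S] (c : (Fin m → MatVar n) → K)
    (x : MatVar n → S) :
    aeval x (FF c) = ∑ β, ∑ J, ∑ I, DD c β J I • TT (fun k => MM x (β k)) I J := by
  have : aeval x (FF c) = ∑ s, c s • ∏ k, x (s k) := by
    simp [FF, map_sum, map_prod, Algebra.smul_def]
  rw [this, sum_sq]
  refine Finset.sum_congr rfl (fun β _ => ?_)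
  rw [Finset.sum_comm]
  rfl

theorem span_mem (X : Bool → Matrix (Fin n) (Fin n) (MvPolynomial (MatVar n) K))
    (S : Subalgebra K (MvPolynomial (MatVar n) K))
    (hS : ∀ w, tw X w ∈ S) (E : Matrix (Fin m → Fin n) (Fin m → Fin n) K)
    (hE : E ∈ Submodule.span K (Set.range (PP (K := K) (n := n) (m := m)))) (β : Fin m → Bool) :
    ∑ J, ∑ I, E J I • TT (fun k => X (β k)) I J ∈ S := by
  induction hE using Submodule.span_induction with
  | mem x hx =>
    obtain ⟨σ, rfl⟩ := hx
    have := trperm_mem X S (Fin m) σ (fun k => [β k]) (fun w _ => hS w)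
    convert this using 1
    simp only [trperm, PP, MonoidHom.coe_mk, OneHom.coe_mk, Matrix.of_apply, ite_smul, one_smul,
      zero_smul]
    refine Finset.sum_congr rfl (fun J _ => ?_)
    rw [Finset.sum_ite_eq' Finset.univ (J ∘ σ)]
    simp [TT, wm]
  | zero => simp
  | add x y _ _ h1 h2 =>
    simp only [Matrix.add_apply, add_smul, Finset.sum_add_distrib]
    exact S.add_mem h1 h2
  | smul a x _ h =>
    simp only [Matrix.smul_apply, smul_assoc, ← Finset.smul_sum]
    exact S.smul_mem h a

/-- symmetric families -/
def SymF (E : (Fin m → Bool) → Matrix (Fin m → Fin n) (Fin m → Fin n) K) : Prop :=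
  ∀ (σ : Equiv.Perm (Fin m)) β I J, E (β ∘ σ) (I ∘ σ) (J ∘ σ) = E β I J

omit [CharZero K] in
theorem SymF.mul {E F : (Fin m → Bool) → Matrix (Fin m → Fin n) (Fin m → Fin n) K}
    (hE : SymF E) (hF : SymF F) : SymF (fun β => E β * F β) := by
  intro σ β I J
  simp only [Matrix.mul_apply]
  refine (Fintype.sum_equiv (Equiv.arrowCongr σ.symm (Equiv.refl (Fin n))) _ _ (fun L => ?_)).symm
  have : (Equiv.arrowCongr σ.symm (Equiv.refl (Fin n))) L = L ∘ σ := by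
    funext k; simp
  rw [this, hE, hF]

omit [CharZero K] in
theorem SymF.const (g : Matrix (Fin n) (Fin n) K) :
    SymF (fun _ : Fin m → Bool => TT (fun _ : Fin m => g)) := by
  intro σ β I J
  exact Fintype.prod_equiv σ _ _ (fun _ => rfl)

/-- generic matrices -/
def gX : Bool → Matrix (Fin n) (Fin n) (MvPolynomial (MatVar n) K) := MM MvPolynomial.X

theorem fft_homog (f : MvPolynomial (MatVar n) K) (hf : IsMatInvariant f) (hm : f.IsHomogeneous m)
    (S : Subalgebra K (MvPolynomial (MatVar n) K)) (hS : ∀ w, tw gX w ∈ S) : f ∈ S := by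
  obtain ⟨c, hc, rfl⟩ := FF_surj f hm
  have hX := aeval_FF c (MvPolynomial.X : MatVar n → MvPolynomial (MatVar n) K)
  rw [MvPolynomial.aeval_X_left_apply] at hX
  rw [hX]
  refine S.sum_mem (fun β _ => span_mem gX S hS _ (schur_weyl _ (fun g => ?_)) β)
  set T : Matrix (Fin m → Fin n) (Fin m → Fin n) K :=
    TT (fun _ => (g : Matrix (Fin n) (Fin n) K)) with hT
  set T' : Matrix (Fin m → Fin n) (Fin m → Fin n) K :=
    TT (fun _ => ((g⁻¹ : GL (Fin n) K) : Matrix (Fin n) (Fin n) K)) with hT'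
  have hTT : T * T' = 1 := by
    rw [hT, hT', ← TT_mul, ← TT_one]
    congr 1
    funext _
    exact g.mul_inv
  let c' : (Fin m → MatVar n) → K := fun s =>
    (T' * DD c (fun k => (unv (s k)).1) * T) (fun k => (unv (s k)).2.2) (fun k => (unv (s k)).2.1)
  have hDD : ∀ β, DD c' β = T' * DD c β * T := by
    intro β
    ext J I
    simp [DD, c', sq, unv_var]
  have hDs : SymF (DD c) := fun σ β I J => hc (sq β J I) σ
  have hS1 : SymF (fun _ : Fin m → Bool => T') := SymF.const _
  have hS2 : SymF (fun _ : Fin m → Bool => T) := SymF.const _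
  have hS3 : SymF (fun β => T' * DD c β * T) := (hS1.mul hDs).mul hS2
  have hc' : ∀ s (σ : Equiv.Perm (Fin m)), c' (s ∘ σ) = c' s := fun s σ =>
    hS3 σ (fun k => (unv (s k)).1) (fun k => (unv (s k)).2.2) (fun k => (unv (s k)).2.1)
  have key : FF c' = FF c := by
    refine MvPolynomial.funext (fun x => ?_)
    have h := hf g (MM x false) (MM x true)
    have hx : pairSub (MM x false) (MM x true) = x := by
      funext v
      rcases v with ⟨i, j⟩ | ⟨i, j⟩ <;> rfl
    rw [hx] at h
    rw [← h]
    rw [← MvPolynomial.coe_aeval_eq_eval, ← MvPolynomial.coe_aeval_eq_eval]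
    simp only [RingHom.coe_coe]
    rw [aeval_FF, aeval_FF]
    refine Finset.sum_congr rfl (fun β _ => ?_)
    have e : ∀ (E : Matrix (Fin m → Fin n) (Fin m → Fin n) K) F, ∑ J, ∑ I, E J I • F I J
        = (E * F).trace := fun E F => by
      simp [Matrix.trace, Matrix.mul_apply]
    rw [e, e, hDD]
    have e2 : TT (fun k => MM (pairSub ((g : Matrix (Fin n) (Fin n) K) * MM x false *
        ((g⁻¹ : GL (Fin n) K) : Matrix (Fin n) (Fin n) K))
          ((g : Matrix (Fin n) (Fin n) K) * MM x true *
            ((g⁻¹ : GL (Fin n) K) : Matrix (Fin n) (Fin n) K))) (β k))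
        = T * TT (fun k => MM x (β k)) * T' := by
      rw [hT, hT', ← TT_mul, ← TT_mul]
      congr 1
      funext k
      cases β k <;> rfl
    rw [e2]
    rw [Matrix.mul_assoc T', Matrix.mul_assoc T', Matrix.trace_mul_comm T']
    simp only [Matrix.mul_assoc]
  have hcc := FF_inj hc' hc key
  have h := hDD β
  rw [hcc] at h
  have h2 := congrArg (fun M => T * M) h
  simp only [← Matrix.mul_assoc, hTT, Matrix.one_mul] at h2
  exact h2.symm

theorem fft (f : MvPolynomial (MatVar n) K) (hf : IsMatInvariant f)
    (S : Subalgebra K (MvPolynomial (MatVar n) K)) (hS : ∀ w, tw gX w ∈ S) : f ∈ S := by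
  rw [← MvPolynomial.sum_homogeneousComponent f]
  refine S.sum_mem (fun d _ => fft_homog _ ?_ (homogeneousComponent_isHomogeneous d f) S hS)
  intro a A B
  -- conjugation as a substitution
  let L : MatVar n → MvPolynomial (MatVar n) K := 
    pairSub ((a : Matrix (Fin n) (Fin n) K).map C * gX false *
      ((a⁻¹ : GL (Fin n) K) : Matrix (Fin n) (Fin n) K).map C)
     ((a : Matrix (Fin n) (Fin n) K).map C * gX true *
      ((a⁻¹ : GL (Fin n) K) : Matrix (Fin n) (Fin n) K).map C)
  have hL1 : ∀ v, (L v).IsHomogeneous 1 := by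
    have : ∀ b i j, (((a : Matrix (Fin n) (Fin n) K).map C * gX b *
      ((a⁻¹ : GL (Fin n) K) : Matrix (Fin n) (Fin n) K).map C : 
        Matrix (Fin n) (Fin n) (MvPolynomial (MatVar n) K)) i j).IsHomogeneous 1 := by
      intro b i j
      simp only [Matrix.mul_apply, Finset.sum_mul]
      refine MvPolynomial.IsHomogeneous.sum _ _ _ (fun k _ =>
        MvPolynomial.IsHomogeneous.sum _ _ _ (fun l _ => ?_))
      have := ((isHomogeneous_C (MatVar n) ((a : Matrix (Fin n) (Fin n) K) i l)).mul
        (isHomogeneous_X K (var b l k))).mul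
        (isHomogeneous_C (MatVar n) (((a⁻¹ : GL (Fin n) K) : Matrix (Fin n) (Fin n) K) k j))
      rw [show (gX b l k : MvPolynomial (MatVar n) K) = MvPolynomial.X (var b l k) from rfl]
      simpa using this
    rintro (⟨i, j⟩ | ⟨i, j⟩)
    · exact this false i j
    · exact this true i j
  have hL2 : ∀ (A B : Matrix (Fin n) (Fin n) K) (p : MvPolynomial (MatVar n) K),
      eval (pairSub A B) (aeval L p) = eval (pairSub ((a : Matrix (Fin n) (Fin n) K) * A *
        ((a⁻¹ : GL (Fin n) K) : Matrix (Fin n) (Fin n) K))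
        ((a : Matrix (Fin n) (Fin n) K) * B *
        ((a⁻¹ : GL (Fin n) K) : Matrix (Fin n) (Fin n) K))) p := by
    intro A B p
    have h1 : ((eval (pairSub A B)).comp (aeval L).toRingHom) = eval (pairSub 
        ((a : Matrix (Fin n) (Fin n) K) * A *
        ((a⁻¹ : GL (Fin n) K) : Matrix (Fin n) (Fin n) K))
        ((a : Matrix (Fin n) (Fin n) K) * B *
        ((a⁻¹ : GL (Fin n) K) : Matrix (Fin n) (Fin n) K))) := by
      refine MvPolynomial.ringHom_ext (fun r => ?_) (fun v => ?_)
      · simp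
      · rcases v with ⟨i, j⟩ | ⟨i, j⟩ <;>
        simp [L, pairSub, Matrix.mul_apply, gX, MM, var]
    exact RingHom.congr_fun h1 p
  have hLf : aeval L f = f := by
    refine MvPolynomial.funext (fun x => ?_)
    have hx : pairSub (MM x false) (MM x true) = x := by
      funext v
      rcases v with ⟨i, j⟩ | ⟨i, j⟩ <;> rfl
    rw [← hx, hL2]
    exact hf a _ _
  have hcomp : aeval L (homogeneousComponent d f) = homogeneousComponent d f := by
    have h1 : ∀ i, (aeval L (homogeneousComponent i f)).IsHomogeneous i := fun i => by
      have := (homogeneousComponent_isHomogeneous i f).aeval L hL1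
      simpa using this
    have h2 : homogeneousComponent d (aeval L f) = aeval L (homogeneousComponent d f) := by
      conv_lhs => rw [← MvPolynomial.sum_homogeneousComponent f, map_sum, map_sum]
      rw [Finset.sum_congr rfl (fun i _ => homogeneousComponent_of_mem
        ((mem_homogeneousSubmodule i _).2 (h1 i)))]
      rw [Finset.sum_ite_eq]
      rw [if_pos (by assumption)]
    rw [← h2, hLf]
  rw [← hL2, hcomp]

end fft

section fin
variable {K : Type*} [Field K] [CharZero K] {n : ℕ}

theorem map_tw {R S : Type*} [CommRing R] [CommRing S] (φ : R →+* S)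
    (X : Bool → Matrix (Fin n) (Fin n) R) (w : List Bool) :
    φ (tw X w) = tw (fun b => (X b).map φ) w := by
  have h : (wm X w).map φ = wm (fun b => (X b).map φ) w := by
    induction w with
    | nil => simp [wm]
    | cons b w ih =>
      have e : ∀ Y : Bool → Matrix (Fin n) (Fin n) R, wm Y (b :: w) = Y b * wm Y w := by
        intro Y; simp [wm]
      rw [e, Matrix.map_mul, ih]
      simp [wm]
  rw [tw, tw, ← h, AddMonoidHom.map_trace φ]

theorem wm_conj (X : Bool → Matrix (Fin n) (Fin n) K) (a : GL (Fin n) K) (w : List Bool) :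
    wm (fun b => (a : Matrix (Fin n) (Fin n) K) * X b *
      ((a⁻¹ : GL (Fin n) K) : Matrix (Fin n) (Fin n) K)) w
    = (a : Matrix (Fin n) (Fin n) K) * wm X w *
      ((a⁻¹ : GL (Fin n) K) : Matrix (Fin n) (Fin n) K) := by
  have h1 : ((a⁻¹ : GL (Fin n) K) : Matrix (Fin n) (Fin n) K) * (a : Matrix (Fin n) (Fin n) K) = 1 :=
    a.inv_mul
  have h2 : (a : Matrix (Fin n) (Fin n) K) * ((a⁻¹ : GL (Fin n) K) : Matrix (Fin n) (Fin n) K) = 1 :=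
    a.mul_inv
  induction w with
  | nil =>
    simp only [wm, List.map_nil, List.prod_nil, mul_one]
    exact h2.symm
  | cons b w ih =>
    have e : ∀ Y : Bool → Matrix (Fin n) (Fin n) K, wm Y (b :: w) = Y b * wm Y w := by
      intro Y; simp [wm]
    rw [e, e, ih]
    generalize ((a⁻¹ : GL (Fin n) K) : Matrix (Fin n) (Fin n) K) = u at *
    calc _ = (a : Matrix (Fin n) (Fin n) K) * X b * (u * (a : Matrix (Fin n) (Fin n) K)) *
          wm X w * u := by simp only [mul_assoc]
      _ = _ := by rw [h1, mul_one]; simp only [mul_assoc]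

theorem tw_inv (w : List Bool) : IsMatInvariant (tw (gX (K := K) (n := n)) w) := by
  intro a A B
  have e : ∀ A B : Matrix (Fin n) (Fin n) K, eval (pairSub A B) (tw gX w)
      = tw (fun b => cond b B A) w := by
    intro A B
    rw [map_tw]
    congr 1
    funext b
    cases b <;> (ext i j; simp [gX, MM, var, pairSub])
  rw [e, e]
  have h := wm_conj (fun b => cond b B A) a w
  have e2 : (fun b => (a : Matrix (Fin n) (Fin n) K) * (cond b B A) *
      ((a⁻¹ : GL (Fin n) K) : Matrix (Fin n) (Fin n) K)) = fun b => cond b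
        ((a : Matrix (Fin n) (Fin n) K) * B * ((a⁻¹ : GL (Fin n) K) : Matrix (Fin n) (Fin n) K))
        ((a : Matrix (Fin n) (Fin n) K) * A * ((a⁻¹ : GL (Fin n) K) : Matrix (Fin n) (Fin n) K)) := by
    funext b; cases b <;> rfl
  rw [e2] at h
  have h1 : ((a⁻¹ : GL (Fin n) K) : Matrix (Fin n) (Fin n) K) * (a : Matrix (Fin n) (Fin n) K) = 1 :=
    a.inv_mul
  rw [tw, h, Matrix.trace_mul_cycle, h1, one_mul, tw]

theorem tw_homog (w : List Bool) : (tw (gX (K := K) (n := n)) w).IsHomogeneous w.length := by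
  have h : ∀ i j, (wm (gX (K := K) (n := n)) w i j).IsHomogeneous w.length := by
    induction w with
    | nil =>
      intro i j
      simp only [wm, List.map_nil, List.prod_nil, Matrix.one_apply, List.length_nil]
      split_ifs
      · exact isHomogeneous_one _ _
      · exact isHomogeneous_zero _ _ _
    | cons b w ih =>
      intro i j
      have e : wm (gX (K := K) (n := n)) (b :: w) = gX b * wm gX w := by simp [wm]
      rw [e, Matrix.mul_apply, List.length_cons, add_comm]
      exact MvPolynomial.IsHomogeneous.sum _ _ _ (fun k _ =>
        (isHomogeneous_X K (var b i k)).mul (ih k j))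
  exact MvPolynomial.IsHomogeneous.sum _ _ _ (fun i _ => h i i)

/-- the generators -/
def gens (K : Type*) [Field K] (n d0 : ℕ) : Set (MvPolynomial (MatVar n) K) :=
  {f | f ∈ pureAlg K n ∧ ∃ d ≤ d0, f.IsHomogeneous d}

theorem part1 (hchk : run rels Tr.o (fun T => bsel (okTT T) (dead T 15 0 0) false) = true) :
    Algebra.adjoin K (gens K 5 15) = pureAlg K 5 := by
  apply le_antisymm
  · exact Algebra.adjoin_le (fun f hf => hf.1)
  · intro f hf
    refine fft f hf _ (tw_mem hchk gX _ (fun w hw => ?_))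
    exact Algebra.subset_adjoin ⟨tw_inv w, _, hw, tw_homog w⟩

theorem eval_hom {σ : Type*} (f : MvPolynomial σ K) (d : ℕ) (hf : f.IsHomogeneous d) (c : K)
    (x : σ → K) : eval (fun v => c * x v) f = c ^ d * eval x f := by
  rw [MvPolynomial.eval_eq, MvPolynomial.eval_eq, Finset.mul_sum]
  refine Finset.sum_congr rfl (fun μ hμ => ?_)
  have h := hf (MvPolynomial.mem_support_iff.1 hμ)
  rw [← h, Finsupp.weight_apply]
  simp only [Pi.one_apply, smul_eq_mul, mul_one, Finsupp.sum, mul_pow, Finset.prod_mul_distrib,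
    Finset.prod_pow_eq_pow_sum]
  ring

/-- restriction to trace zero -/
def res (K : Type*) [Field K] (n : ℕ) : MvPolynomial (MatVar n) K →ₐ[K] (sl K n × sl K n → K) :=
  AlgHom.pi (fun v => aeval (pairSub (v.1 : Matrix (Fin n) (Fin n) K)
      (v.2 : Matrix (Fin n) (Fin n) K)))

theorem res_apply (F : MvPolynomial (MatVar n) K) (v : sl K n × sl K n) :
    res K n F v = eval (pairSub (v.1 : Matrix (Fin n) (Fin n) K)
      (v.2 : Matrix (Fin n) (Fin n) K)) F := by
  simp [res, MvPolynomial.coe_aeval_eq_eval]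

/-- trace-zero part -/
def tz (hn : (n : K) ≠ 0) (A : Matrix (Fin n) (Fin n) K) : sl K n :=
  ⟨A - ((n : K)⁻¹ * A.trace) • 1, by
    simp only [sl, LinearMap.mem_ker, Matrix.traceLinearMap_apply]
    rw [Matrix.trace_sub, Matrix.trace_smul, Matrix.trace_one, Fintype.card_fin, smul_eq_mul]
    field_simp
    ring⟩

/-- trace-zero substitution -/
def tzs (K : Type*) [Field K] (n : ℕ) : MatVar n → MvPolynomial (MatVar n) K :=
  fun v => MvPolynomial.X v - 
    (if (unv v).2.1 = (unv v).2.2 then C ((n : K)⁻¹) * (gX (unv v).1).trace else 0)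

theorem eval_tzs (hn : (n : K) ≠ 0) (A B : Matrix (Fin n) (Fin n) K)
    (F : MvPolynomial (MatVar n) K) :
    eval (pairSub A B) (aeval (tzs K n) F) = eval (pairSub (tz hn A).1 (tz hn B).1) F := by
  have h1 : ((eval (pairSub A B)).comp (aeval (tzs K n)).toRingHom)
      = eval (pairSub (tz hn A).1 (tz hn B).1) := by
    refine MvPolynomial.ringHom_ext (fun r => ?_) (fun v => ?_)
    · simp
    · rcases v with ⟨i, j⟩ | ⟨i, j⟩ <;> by_cases hij : i = j <;>
      simp [tzs, tz, pairSub, unv, gX, MM, var, Matrix.trace, hij, Matrix.one_apply]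
  exact RingHom.congr_fun h1 F

theorem tz_conj (hn : (n : K) ≠ 0) (a : GL (Fin n) K) (A : Matrix (Fin n) (Fin n) K) :
    tz hn ((a : Matrix (Fin n) (Fin n) K) * A * ((a⁻¹ : GL (Fin n) K) : Matrix (Fin n) (Fin n) K))
      = glConj a (tz hn A) := by
  have h1 : ((a⁻¹ : GL (Fin n) K) : Matrix (Fin n) (Fin n) K) * (a : Matrix (Fin n) (Fin n) K) = 1 :=
    a.inv_mul
  have h2 : (a : Matrix (Fin n) (Fin n) K) * ((a⁻¹ : GL (Fin n) K) : Matrix (Fin n) (Fin n) K) = 1 :=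
    a.mul_inv
  apply Subtype.ext
  simp only [tz, glConj]
  rw [Matrix.trace_mul_cycle, h1, one_mul, mul_sub, sub_mul, Matrix.mul_smul, Matrix.smul_mul,
    mul_one, h2]

theorem tz_self (hn : (n : K) ≠ 0) (A : sl K n) : tz hn A.1 = A := by
  have hA : Matrix.trace A.1 = 0 := A.2
  apply Subtype.ext
  simp [tz, hA]

theorem part2 (hchk : run rels Tr.o (fun T => bsel (okTT T) (dead T 15 0 0) false) = true) :
    Algebra.adjoin K {f : sl K 5 × sl K 5 → K |
        f ∈ pureAlg0 K 5 ∧ ∃ d ≤ 15, HomogFun0 f d} = pureAlg0 K 5 := by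
  apply le_antisymm
  · exact Algebra.adjoin_le (fun f hf => hf.1)
  · rintro f ⟨⟨F, hF⟩, hinv⟩
    have hn : ((5 : ℕ) : K) ≠ 0 := by norm_num
    have hev : ∀ A B, eval (pairSub A B) (aeval (tzs K 5) F) = f (tz hn A, tz hn B) := by
      intro A B
      rw [eval_tzs hn, hF]
    have hI : IsMatInvariant (aeval (tzs K 5) F) := by
      intro a A B
      rw [hev, hev, tz_conj, tz_conj]
      exact hinv a (tz hn A, tz hn B)
    have hf : f = res K 5 (aeval (tzs K 5) F) := by
      funext v
      rw [res_apply, hev, tz_self, tz_self]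
    have hmem : aeval (tzs K 5) F ∈ Algebra.adjoin K (gens K 5 15) := by
      rw [part1 hchk]; exact hI
    rw [hf]
    have h2 : res K 5 (aeval (tzs K 5) F) ∈ (Algebra.adjoin K (gens K 5 15)).map (res K 5) :=
      ⟨_, hmem, rfl⟩
    rw [AlgHom.map_adjoin] at h2
    refine Algebra.adjoin_mono ?_ h2
    rintro _ ⟨h, ⟨hh, d, hd, hdh⟩, rfl⟩
    refine ⟨⟨⟨h, fun v => res_apply h v⟩, fun a v => ?_⟩, d, hd, fun c v => ?_⟩
    · rw [res_apply, res_apply]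
      exact hh a v.1.1 v.2.1
    · rw [res_apply, res_apply, ← eval_hom h d hdh]
      have e : pairSub ((c • v.1 : sl K 5) : Matrix (Fin 5) (Fin 5) K)
          ((c • v.2 : sl K 5) : Matrix (Fin 5) (Fin 5) K)
          = fun x => c * pairSub (v.1 : Matrix (Fin 5) (Fin 5) K)
            (v.2 : Matrix (Fin 5) (Fin 5) K) x := by
        funext x
        rcases x with ⟨i, j⟩ | ⟨i, j⟩ <;> simp [pairSub]
      exact congrArg (fun y => eval y h) e

end fin

set_option maxRecDepth 100000 in
theorem main_chk : run rels Tr.o (fun T => bsel (okTT T) (dead T 15 0 0) false) = true := by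
  decide +kernel

end CK

/-- The algebra `C_{5,2}` is generated, as a unital `K`-algebra, by its homogeneous
elements of total degree at most 15, and the same holds for the algebra `C_{5,2}(0)` of
invariants of pairs of trace-zero `5 × 5` matrices. -/
theorem generated_in_degree_le_15 (K : Type*) [Field K] [CharZero K] :
    Algebra.adjoin K {f : MvPolynomial (MatVar 5) K |
        f ∈ pureAlg K 5 ∧ ∃ d ≤ 15, f.IsHomogeneous d} = pureAlg K 5 ∧
    Algebra.adjoin K {f : sl K 5 × sl K 5 → K |
        f ∈ pureAlg0 K 5 ∧ ∃ d ≤ 15, HomogFun0 f d} = pureAlg0 K 5 := 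
  ⟨CK.part1 CK.main_chk, CK.part2 CK.main_chk⟩
end
end
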